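/- Let M be a σ-compact, non-compact, connected 2-manifold homeomorphic to X \ K, where X is the annulus S¹ × [0,1], the closed 2-disk, or the Möbius band, and K is a non-empty compact subset of one boundary circle of X. Then every compactly supported homeomorphism of M lies in the identity connected component 𝓗₀(M) of 𝓗(M); that is, the mapping class group 𝓜_c(M) = 𝓗_c(M)/𝓗₀(M) is trivial. -/

import Mathlib

noncomputable section

open scoped Pointwise

/-- The Whitney topology on the homeomorphism group of a space `M`:
it is generated by the sets `{f | graph f ⊆ U}` where `U` runs over the open subsets
of `M × M`. -/
def whitneyTopology (M : Type*) [TopologicalSpace M] : TopologicalSpace (M ≃ₜ M) :=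
  TopologicalSpace.generateFrom
    {S : Set (M ≃ₜ M) | ∃ U : Set (M × M), IsOpen U ∧ S = {f : M ≃ₜ M | ∀ x : M, (x, f x) ∈ U}}

/-- We endow the homeomorphism group `𝓗(M)` with the Whitney topology. -/
instance (M : Type*) [TopologicalSpace M] : TopologicalSpace (M ≃ₜ M) := whitneyTopology M

/-- `𝓗_c(M)`: the set of compactly supported homeomorphisms of `M`. -/
def Hc (M : Type*) [TopologicalSpace M] : Set (M ≃ₜ M) :=
  {f : M ≃ₜ M | IsCompact (closure {x : M | f x ≠ x})}

/-- `𝓗₀(M)`: the identity component of the homeomorphism group of `M` with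
the Whitney topology. -/
def H0 (M : Type*) [TopologicalSpace M] : Set (M ≃ₜ M) :=
  connectedComponent (Homeomorph.refl M)

/-- The circle `S¹`. -/
abbrev Circle2 : Type := ↥(Metric.sphere (0 : EuclideanSpace ℝ (Fin 2)) 1)

/-- The gluing relation for the Möbius band: `(0, t) ∼ (1, 1 - t)`. -/
def mobiusRel (p q : unitInterval × unitInterval) : Prop :=
  p.1 = 0 ∧ q.1 = 1 ∧ (q.2 : ℝ) = 1 - (p.2 : ℝ)

/-- The Möbius band: the quotient of `[0,1] × [0,1]` identifying `(0,t)` with `(1, 1-t)`. -/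
def MobiusBand : Type := Quot mobiusRel

instance : TopologicalSpace MobiusBand :=
  inferInstanceAs (TopologicalSpace (Quot mobiusRel))

/-- The boundary circle of the Möbius band: the image of `[0,1] × {0,1}`. -/
def mobiusBoundary : Set MobiusBand :=
  Quot.mk _ '' {p : unitInterval × unitInterval | p.2 = 0 ∨ p.2 = 1}

/-- `M` is an exceptional non-compact surface: `M` is homeomorphic to `X \ K`, where `X` is
the annulus `S¹ × [0,1]`, the closed 2-disk, or the Möbius band, and `K` is a non-empty
compact subset of a boundary circle of `X`. -/
def IsExceptional (M : Type*) [TopologicalSpace M] : Prop :=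
  -- the annulus case
  (∃ K : Set (Circle2 × unitInterval), K.Nonempty ∧ IsCompact K ∧
    (∃ i : unitInterval, (i = 0 ∨ i = 1) ∧ ∀ p ∈ K, p.2 = i) ∧
    Nonempty (M ≃ₜ {p : Circle2 × unitInterval // p ∉ K})) ∨
  -- the disk case
  (∃ K : Set (EuclideanSpace ℝ (Fin 2)), K.Nonempty ∧ IsCompact K ∧
    K ⊆ Metric.sphere (0 : EuclideanSpace ℝ (Fin 2)) 1 ∧
    Nonempty (M ≃ₜ ↥(Metric.closedBall (0 : EuclideanSpace ℝ (Fin 2)) 1 \ K))) ∨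
  -- the Möbius band case
  (∃ K : Set MobiusBand, K.Nonempty ∧ IsCompact K ∧ K ⊆ mobiusBoundary ∧
    Nonempty (M ≃ₜ {x : MobiusBand // x ∉ K}))


section

open Set Filter Topology

/-- A continuous family of bijections with bounded displacement has a continuous family of
inverses. -/
theorem continuous_family_inverse {A Z : Type*} [TopologicalSpace A] [T2Space A]
    [LocallyCompactSpace A]
    [NormedAddCommGroup Z] [ProperSpace Z]
    {F G : A × Z → Z} (hF : Continuous F) {C : ℝ} (hC : ∀ t z, ‖F (t, z) - z‖ ≤ C)
    (hGF : ∀ t z, G (t, F (t, z)) = z) (hFG : ∀ t z, F (t, G (t, z)) = z) : Continuous G := by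
  let Φ : A × Z → A × Z := fun p => (p.1, F p)
  let Γ : A × Z → A × Z := fun p => (p.1, G p)
  have hΦ : Continuous Φ := continuous_fst.prodMk hF
  have hprop : IsProperMap Φ := by
    rw [isProperMap_iff_isCompact_preimage]
    refine ⟨hΦ, fun K hK => ?_⟩
    have h1 : IsCompact (Prod.fst '' K) := hK.image continuous_fst
    have h2 : IsCompact (Prod.snd '' K) := hK.image continuous_snd
    obtain ⟨R, hR⟩ := h2.isBounded.exists_norm_le
    refine (h1.prod (isCompact_closedBall (0 : Z) (R + C))).of_isClosed_subset
      (hK.isClosed.preimage hΦ) ?_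
    rintro ⟨t, z⟩ hz
    refine ⟨⟨_, hz, rfl⟩, ?_⟩
    have h3 : ‖F (t, z)‖ ≤ R := hR _ ⟨_, hz, rfl⟩
    have h4 := hC t z
    rw [mem_closedBall_zero_iff]
    calc ‖z‖ = ‖F (t, z) - (F (t, z) - z)‖ := by congr 1; abel
      _ ≤ ‖F (t, z)‖ + ‖F (t, z) - z‖ := norm_sub_le _ _
      _ ≤ R + C := add_le_add h3 h4
  have hΓ : Continuous Γ := by
    rw [continuous_iff_isClosed]
    intro s hs
    have : Γ ⁻¹' s = Φ '' s := by
      ext ⟨t, z⟩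
      constructor
      · intro h; exact ⟨_, h, by simp [Φ, Γ, hFG]⟩
      · rintro ⟨⟨t', z'⟩, h, h'⟩
        simp only [Φ, Prod.mk.injEq] at h'
        obtain ⟨rfl, rfl⟩ := h'
        simpa [Γ, hGF] using h
    rw [this]
    exact hprop.isClosedMap s hs
  exact continuous_snd.comp hΓ

/-- The coordinate plane. -/
abbrev Plane : Type := ℝ × ℝ

/-- `f` is isotopic to the identity through homeomorphisms of the plane of uniformly bounded
displacement, commuting with `T`, preserving `S`, and fixing a common member of `𝓕` pointwise. -/
def Iso (T : Plane → Plane) (S : Set Plane) (𝓕 : Filter Plane) (f : Plane → Plane) : Prop :=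
  ∃ F : unitInterval × Plane → Plane, Continuous F ∧ (∀ t, (fun z => F (t, z)).Bijective) ∧
    (∃ C, ∀ t z, ‖F (t, z) - z‖ ≤ C) ∧ (∀ t z, F (t, T z) = T (F (t, z))) ∧
    (∀ t z, F (t, z) ∈ S ↔ z ∈ S) ∧ (∀ᶠ z in 𝓕, ∀ t, F (t, z) = z) ∧
    (∀ z, F (0, z) = z) ∧ ∀ z, F (1, z) = f z

namespace Iso

variable {T : Plane → Plane} {S : Set Plane} {𝓕 𝓖 : Filter Plane} {f g h : Plane → Plane}

theorem mono (hf : Iso T S 𝓕 f) (hl : 𝓖 ≤ 𝓕) : Iso T S 𝓖 f := by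
  obtain ⟨F, h1, h2, h3, h4, h5, h6, h7⟩ := hf
  exact ⟨F, h1, h2, h3, h4, h5, h6.filter_mono hl, h7⟩

theorem comp (hf : Iso T S 𝓕 f) (hg : Iso T S 𝓕 g) : Iso T S 𝓕 (f ∘ g) := by
  obtain ⟨F, h1, h2, ⟨C, h3⟩, h4, h5, h6, h7, h8⟩ := hf
  obtain ⟨G, g1, g2, ⟨D, g3⟩, g4, g5, g6, g7, g8⟩ := hg
  refine ⟨fun p => F (p.1, G p), by fun_prop, fun t => (h2 t).comp (g2 t), ⟨C + D, fun t z => ?_⟩,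
    fun t z => by simp [h4, g4], fun t z => by simp [h5, g5], ?_, fun z => by simp [h7, g7],
    fun z => by simp [h8, g8]⟩
  · calc ‖F (t, G (t, z)) - z‖ = ‖(F (t, G (t, z)) - G (t, z)) + (G (t, z) - z)‖ := by congr 1; abel
      _ ≤ _ := norm_add_le_of_le (h3 _ _) (g3 _ _)
  · filter_upwards [h6, g6] with z hz hz' t
    simp [hz, hz']

theorem symm (hf : Iso T S 𝓕 f) (hgf : ∀ z, g (f z) = z) : Iso T S 𝓕 g := by
  obtain ⟨F, h1, h2, ⟨C, h3⟩, h4, h5, h6, h7, h8⟩ := hf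
  let G : unitInterval × Plane → Plane := fun p => (Equiv.ofBijective _ (h2 p.1)).symm p.2
  have hGF : ∀ t z, G (t, F (t, z)) = z := fun t z =>
    (Equiv.ofBijective _ (h2 t)).symm_apply_apply z
  have hFG : ∀ t z, F (t, G (t, z)) = z := fun t z =>
    (Equiv.ofBijective _ (h2 t)).apply_symm_apply z
  refine ⟨G, continuous_family_inverse h1 h3 hGF hFG, fun t =>
    (Equiv.ofBijective _ (h2 t)).symm.bijective, ⟨C, fun t z => ?_⟩, fun t z => ?_, fun t z =>
    ?_, ?_, fun z => ?_, fun z => ?_⟩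
  · have := h3 t (G (t, z))
    rwa [hFG, norm_sub_rev] at this
  · apply (h2 t).1
    simp only [hFG, h4]
  · rw [← h5 t (G (t, z)), hFG]
  · filter_upwards [h6] with z hz t
    conv_lhs => rw [← hz t]
    exact hGF t z
  · conv_lhs => rw [← h7 z]
    exact hGF 0 z
  · have := hFG 1 z
    rw [h8] at this
    conv_rhs => rw [← this, hgf]

/-- If `F` is an isotopy with `F 1` isotopic to the identity then so is `F 0`. -/
theorem of_path {F : unitInterval × Plane → Plane} (h1 : Continuous F)
    (h2 : ∀ t, (fun z => F (t, z)).Bijective)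
    (h3 : ∃ C, ∀ t z, ‖F (t, z) - z‖ ≤ C) (h4 : ∀ t z, F (t, T z) = T (F (t, z)))
    (h5 : ∀ t z, F (t, z) ∈ S ↔ z ∈ S) (h6 : ∀ᶠ z in 𝓕, ∀ t, F (t, z) = z)
    (hg : Iso T S 𝓕 (fun z => F (1, z))) : Iso T S 𝓕 (fun z => F (0, z)) := by
  obtain ⟨C, h3⟩ := h3
  set e := Equiv.ofBijective _ (h2 1) with he
  have hE : ∀ z, F (1, e.symm z) = z := fun z => e.apply_symm_apply z
  have hE' : ∀ z, e.symm (F (1, z)) = z := fun z => e.symm_apply_apply z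
  have hec : Continuous e.symm := by
    have := continuous_family_inverse (F := fun p : unitInterval × Plane => F (1, p.2))
      (G := fun p => e.symm p.2) (by fun_prop) (fun t z => h3 1 z) (fun t z => hE' z)
      (fun t z => hE z)
    exact this.comp (Continuous.prodMk_right (0 : unitInterval))
  have key : Iso T S 𝓕 (fun z => F (0, e.symm z)) := by
    refine ⟨fun p => F (unitInterval.symm p.1, e.symm p.2), by fun_prop,
      fun t => (h2 (unitInterval.symm t)).comp e.symm.bijective, ⟨C + C, fun t z => ?_⟩, fun t z =>
        ?_, fun t z => ?_, ?_,
      fun z => by simp [hE], fun z => by simp⟩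
    · have := h3 1 (e.symm z)
      rw [hE, norm_sub_rev] at this
      calc ‖F (unitInterval.symm t, e.symm z) - z‖
        = ‖(F (unitInterval.symm t, e.symm z) - e.symm z) + (e.symm z - z)‖ := by congr 1; abel
        _ ≤ _ := norm_add_le_of_le (h3 _ _) this
    · have : e.symm (T z) = T (e.symm z) := by
        apply (h2 1).1
        simp only [hE, h4]
      simp [this, h4]
    · simp only [h5]
      rw [← h5 1 (e.symm z), hE]
    · filter_upwards [h6] with z hz t
      have : e.symm z = z := by
        conv_lhs => rw [← hz 1]
        exact hE' z
      simp [this, hz]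
  have := key.comp hg
  convert this using 1
  funext z
  simp [hE']

end Iso

/-- An isotopy with compact support is continuous in the Whitney topology, so that its end
lies in the identity component. -/
theorem mem_H0_of_isotopy {M : Type*} [TopologicalSpace M] [T2Space M]
    (F : unitInterval → M ≃ₜ M) (hF : Continuous fun p : unitInterval × M => F p.1 p.2)
    {C : Set M} (hC : IsCompact C) (hid : ∀ t, ∀ x ∉ C, F t x = x) (h0 : ∀ x, F 0 x = x) :
    F 1 ∈ H0 M := by
  have hcont : Continuous F := by
    refine continuous_generateFrom_iff.2 ?_
    rintro _ ⟨U, hU, rfl⟩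
    rw [isOpen_iff_mem_nhds]
    intro t ht
    have ht : ∀ x, (x, F t x) ∈ U := ht
    have hopen : IsOpen {p : unitInterval × M | (p.2, F p.1 p.2) ∈ U} :=
      hU.preimage (by fun_prop)
    obtain ⟨u, v, hu, hv, htu, hCv, huv⟩ := generalized_tube_lemma (isCompact_singleton (x := t)) hC
      hopen (by rintro ⟨s, x⟩ ⟨rfl, _⟩; exact ht x)
    filter_upwards [hu.mem_nhds (htu rfl)] with s hs x
    by_cases hx : x ∈ C
    · exact huv (⟨hs, hCv hx⟩ : (s, x) ∈ u ×ˢ v)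
    · have := ht x
      rw [hid _ _ hx] at this
      rwa [hid _ _ hx]
  have hpre : IsPreconnected (range F) := isPreconnected_range hcont
  have hr : F 0 = Homeomorph.refl M := Homeomorph.ext h0
  exact hpre.subset_connectedComponent ⟨0, hr⟩ ⟨1, rfl⟩

/-- The six lattice directions, in cyclic order. -/
def hexDir {A : Type*} [AddCommGroup A] (e₁ e₂ : A) : Fin 6 → A :=
  ![e₁, e₂, e₂ - e₁, -e₁, -e₂, e₁ - e₂]

/-- The number of sign changes in a cyclic sequence of six signs. -/
def signChanges (b : Fin 6 → Bool) : ℕ := ∑ k, (b k != b (k + 1)).toNat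

theorem two_le_signChanges : ∀ b : Fin 6 → Bool, (∃ k, b k = true) → (∃ k, b k = false) →
    2 ≤ signChanges b := by
  unfold signChanges
  decide

theorem triangle_signChanges : ∀ b₀ b₁ b₂ : Bool, ¬ (b₀ = b₁ ∧ b₁ = b₂) →
    (b₀ != !b₂).toNat + (b₁ != !b₀).toNat + (b₂ != !b₁).toNat = 1 := by
  decide

/-- Given a triangle-acyclic orientation of the edges of a toroidal triangular lattice in which no
vertex is a source or a sink, there are exactly two sign changes around each vertex. -/
theorem signChanges_eq_two {A : Type*} [AddCommGroup A] [Finite A] {e₁ e₂ : A}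
    {s : A → Fin 6 → Bool}
    (anti : ∀ a k, s (a + hexDir e₁ e₂ k) (k + 3) = !s a k)
    (up : ∀ a, ¬ (s a 0 = s (a + e₁) 2 ∧ s (a + e₁) 2 = s (a + e₂) 4))
    (down : ∀ a, ¬ (s a 1 = s (a + e₂) 3 ∧ s (a + e₂) 3 = s (a + e₂ - e₁) 5))
    (hpos : ∀ a, ∃ k, s a k = true) (hneg : ∀ a, ∃ k, s a k = false) (a : A) :
    signChanges (s a) = 2 := by
  have := Fintype.ofFinite A
  have hle : ∀ a ∈ Finset.univ, 2 ≤ signChanges (s a) := fun a _ =>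
    two_le_signChanges _ (hpos a) (hneg a)
  let c : A → Fin 6 → ℕ := fun a k => (s a k != s a (k + 1)).toNat
  have shift : ∀ k (v : A), ∑ a, c a k = ∑ a, c (a + v) k := fun k v =>
    (Equiv.sum_comp (Equiv.addRight v) fun a => c a k).symm
  have hsum : ∑ a, signChanges (s a) = ∑ a : A, 2 := by
    have h1 : ∑ a, signChanges (s a) = ∑ a, (c a 0 + c (a + e₁) 2 + c (a + e₂) 4) +
        ∑ a, (c a 1 + c (a + e₂) 3 + c (a + e₂ - e₁) 5) := by
      have h5 := shift 5 (e₂ - e₁)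
      simp only [← add_sub_assoc] at h5
      simp only [Finset.sum_add_distrib, ← shift 2 e₁, ← shift 4 e₂, ← shift 3 e₂, ← h5]
      simp only [signChanges, Fin.sum_univ_six, Finset.sum_add_distrib, c]
      ring
    have h2 : ∀ a, c a 0 + c (a + e₁) 2 + c (a + e₂) 4 = 1 := by
      intro a
      have i1 : s a 1 = !s (a + e₂) 4 := by
        rw [show (4 : Fin 6) = 1 + 3 from rfl, ← Bool.not_not (s a 1), ← anti a 1]; rfl
      have i2 : s (a + e₁) 3 = !s a 0 := anti a 0
      have i3 : s (a + e₂) 5 = !s (a + e₁) 2 := by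
        rw [← anti (a + e₁) 2]; simp [hexDir]
      simpa [c, i1, i2, i3] using triangle_signChanges _ _ _ (up a)
    have h3 : ∀ a, c a 1 + c (a + e₂) 3 + c (a + e₂ - e₁) 5 = 1 := by
      intro a
      have i1 : s a 2 = !s (a + e₂ - e₁) 5 := by
        have := anti a 2
        rw [← Bool.not_not (s a 2), ← this]; simp [hexDir, add_sub_assoc]
      have i2 : s (a + e₂) 4 = !s a 1 := anti a 1
      have i3 : s (a + e₂ - e₁) 0 = !s (a + e₂) 3 := by
        have := anti (a + e₂) 3
        rw [← this]; simp [hexDir, sub_eq_add_neg]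
      simpa [c, i1, i2, i3] using triangle_signChanges _ _ _ (down a)
    rw [h1]
    simp only [h2, h3, ← Finset.sum_add_distrib]
  exact ((Finset.sum_eq_sum_iff_of_le hle).1 hsum.symm a (Finset.mem_univ _)).symm

theorem signChanges_shift (b : Fin 6 → Bool) (k : Fin 6) :
    signChanges (fun i => b (k + i)) = signChanges b := by
  unfold signChanges
  rw [← Equiv.sum_comp (Equiv.addLeft k) fun i => (b i != b (i + 1)).toNat]
  simp [add_assoc]

theorem lt_of_signChanges : ∀ b : Fin 6 → Bool, ∀ i j : Fin 6, b 0 ≠ b 1 ∧ signChanges b = 2 ∧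
    1 < i ∧ 1 < j ∧ b i = b 0 ∧ b j = b 1 → j < i := by
  unfold signChanges
  decide

theorem flat_bool {p q : Fin 6 → Bool} {k : Fin 6} (hp : p k ≠ p (k + 1)) (hq : q k = p (k + 1))
    (hq' : q (k + 1) = p k) (h5 : signChanges p = 2) (h6 : signChanges q = 2)
    {i j : Fin 6} (hi : i ≠ k) (hi' : i ≠ k + 1) (hj : j ≠ k) (hj' : j ≠ k + 1)
    (a : p i = p k) (b : q i = p k) (c : p j = p (k + 1)) (d : q j = p (k + 1)) : False := by
  have e : ∀ i, k + (i - k) = i := fun i => by abel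
  have e1 : ∀ i, i ≠ k → i ≠ k + 1 → 1 < i - k := fun i h h' => by
    have h1 : i - k ≠ 0 := sub_ne_zero.2 h
    have h2 : i - k ≠ 1 := fun h'' => h' (by rw [← h'', e])
    omega
  have x := lt_of_signChanges (fun i => p (k + i)) (i - k) (j - k)
    ⟨by simpa using hp, by rwa [signChanges_shift], e1 _ hi hi', e1 _ hj hj', by simpa [e] using a,
      by simpa [e] using c⟩
  have y := lt_of_signChanges (fun i => q (k + i)) (j - k) (i - k)
    ⟨by simpa [hq, hq'] using hp.symm, by rwa [signChanges_shift], e1 _ hj hj', e1 _ hi hi',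
      by simpa [e, hq] using d, by simpa [e, hq'] using b⟩
  exact lt_asymm x y

/-- Lexicographic positivity of a pair of reals. -/
def lexPos (x y : ℝ) : Bool := decide (0 < x ∨ x = 0 ∧ 0 < y)

theorem lexPos_neg {x y : ℝ} (hy : y ≠ 0) : lexPos (-x) (-y) = !lexPos x y := by
  unfold lexPos
  rw [← decide_not, decide_eq_decide]
  grind

theorem lexPos_triangle {x y z x' y' z' : ℝ} (hx : x + y + z = 0) (hx' : x' + y' + z' = 0)
    (h0 : x' ≠ 0) :
    ¬ (lexPos x x' = lexPos y y' ∧ lexPos y y' = lexPos z z') := by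
  unfold lexPos
  rw [decide_eq_decide, decide_eq_decide]
  grind

/-- A cocycle on the directed edges of a toroidal triangular lattice. -/
structure HexCocycle {A : Type*} [AddCommGroup A] (e₁ e₂ : A) (L : A → Fin 6 → ℝ) : Prop where
  anti : ∀ a k, L (a + hexDir e₁ e₂ k) (k + 3) = - L a k
  up : ∀ a, L a 0 + L (a + e₁) 2 + L (a + e₂) 4 = 0
  down : ∀ a, L a 1 + L (a + e₂) 3 + L (a + e₂ - e₁) 5 = 0

/-- A weighted balancing condition for six numbers placed around a vertex. -/
def HexBalanced (x : Fin 6 → ℝ) : Prop := ∃ w : Fin 6 → ℝ, (∀ k, 0 < w k) ∧ ∑ k, w k * x k = 0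

theorem HexBalanced.exists_pos {x : Fin 6 → ℝ} (h : HexBalanced x) {m : Fin 6} (hm : x m ≠ 0) :
    ∃ k, 0 < x k := by
  obtain ⟨w, hw, h⟩ := h
  by_contra! hc
  have : ∀ k ∈ Finset.univ, w k * x k ≤ 0 := fun k _ =>
    mul_nonpos_of_nonneg_of_nonpos (hw k).le (hc k)
  have := (Finset.sum_eq_zero_iff_of_nonpos this).1 h m (Finset.mem_univ _)
  exact (mul_ne_zero (hw m).ne' hm) this

theorem HexBalanced.neg {x : Fin 6 → ℝ} (h : HexBalanced x) : HexBalanced (fun k => -x k) := by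
  obtain ⟨w, hw, h⟩ := h
  exact ⟨w, hw, by simp [h]⟩

theorem HexBalanced.exists_neg {x : Fin 6 → ℝ} (h : HexBalanced x) {m : Fin 6} (hm : x m ≠ 0) :
    ∃ k, x k < 0 := by
  obtain ⟨k, hk⟩ := h.neg.exists_pos (m := m) (by simpa using hm)
  exact ⟨k, by linarith⟩

theorem HexCocycle.signChanges_eq {A : Type*} [AddCommGroup A] [Finite A] {e₁ e₂ : A}
    {L : A → Fin 6 → ℝ} (hL : HexCocycle e₁ e₂ L)
    (hbal : ∀ a, L a 3 = - L a 0 ∨ HexBalanced (L a)) {f : Fin 6 → ℝ} (hf : ∀ k, f (k + 3) = -f k)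
    (hf0 : ∀ k, f k ≠ 0) (hsum : f 0 + f 2 + f 4 = 0) (a : A) :
    signChanges (fun k => lexPos (L a k) (f k)) = 2 := by
  have hsum' : f 1 + f 3 + f 5 = 0 := by
    have := hf 0; have := hf 2; have h4 := hf 4
    rw [show (4 : Fin 6) + 3 = 1 from rfl] at h4
    rw [show (0 : Fin 6) + 3 = 3 from rfl, show (2 : Fin 6) + 3 = 5 from rfl] at *
    linarith
  have hall : ∀ a, (∃ k, lexPos (L a k) (f k) = true) ∧ ∃ k, lexPos (L a k) (f k) = false := by
    intro a
    have h03 : L a 3 = - L a 0 → (∃ k, lexPos (L a k) (f k) = true) ∧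
        ∃ k, lexPos (L a k) (f k) = false := by
      intro h
      have := lexPos_neg (x := L a 0) (hf0 0)
      rw [← h, ← hf 0, show (0 : Fin 6) + 3 = 3 from rfl] at this
      cases hb : lexPos (L a 0) (f 0) with
      | true => exact ⟨⟨0, hb⟩, 3, by rw [this, hb]; rfl⟩
      | false => exact ⟨⟨3, by rw [this, hb]; rfl⟩, 0, hb⟩
    rcases hbal a with h | h
    · exact h03 h
    · by_cases hz : ∀ m, L a m = 0
      · exact h03 (by simp [hz])
      · push Not at hz
        obtain ⟨m, hm⟩ := hz
        obtain ⟨k, hk⟩ := h.exists_pos hm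
        obtain ⟨j, hj⟩ := h.exists_neg hm
        refine ⟨⟨k, by simp [lexPos, hk]⟩, j, ?_⟩
        simp only [lexPos, decide_eq_false_iff_not]
        grind
  refine signChanges_eq_two (e₁ := e₁) (e₂ := e₂) (s := fun a k => lexPos (L a k) (f k)) ?_ ?_ ?_
    (fun a => (hall a).1) (fun a => (hall a).2) a
  · intro a k
    simp only [hL.anti, hf, lexPos_neg (hf0 k)]
  · intro a
    exact lexPos_triangle (hL.up a) hsum (hf0 _)
  · intro a
    exact lexPos_triangle (hL.down a) hsum' (hf0 _)

theorem exists_generic (k : Fin 6) : ∃ f : Fin 6 → ℝ, (∀ k, f (k + 3) = -f k) ∧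
    (∀ k, f k ≠ 0) ∧ f 0 + f 2 + f 4 = 0 ∧ 0 < f k ∧ f (k + 1) < 0 := by
  have main : ∀ k : Fin 6, ∃ f : Fin 6 → ℤ, (∀ k, f (k + 3) = -f k) ∧
    (∀ k, f k ≠ 0) ∧ f 0 + f 2 + f 4 = 0 ∧ 0 < f k ∧ f (k + 1) < 0 := by
    intro k
    fin_cases k
    · exact ⟨![1, -1, -2, -1, 1, 2], by decide⟩
    · exact ⟨![2, 1, -1, -2, -1, 1], by decide⟩
    · exact ⟨![1, 2, 1, -1, -2, -1], by decide⟩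
    · exact ⟨![-1, 1, 2, 1, -1, -2], by decide⟩
    · exact ⟨![-2, -1, 1, 2, 1, -1], by decide⟩
    · exact ⟨![-1, -2, -1, 1, 2, 1], by decide⟩
  obtain ⟨f, h1, h2, h3, h4, h5⟩ := main k
  exact ⟨fun i => f i, fun i => by simp only [h1, Int.cast_neg], fun i => Int.cast_ne_zero.2 (h2 i),
    by beta_reduce; exact_mod_cast h3, by beta_reduce; exact_mod_cast h4,
    by beta_reduce; exact_mod_cast h5⟩

/-- A balanced vertex with two consecutive null edges is flat. -/
theorem HexCocycle.flat {A : Type*} [AddCommGroup A] [Finite A] {e₁ e₂ : A}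
    {L : A → Fin 6 → ℝ} (hL : HexCocycle e₁ e₂ L)
    (hbal : ∀ a, L a 3 = - L a 0 ∨ HexBalanced (L a)) {a : A} (ha : HexBalanced (L a)) {k : Fin 6}
    (h0 : L a k = 0) (h1 : L a (k + 1) = 0) (m : Fin 6) : L a m = 0 := by
  by_contra hm
  obtain ⟨i, hi⟩ := ha.exists_pos hm
  obtain ⟨j, hj⟩ := ha.exists_neg hm
  obtain ⟨f, hf, hf0, hsum, hk, hk'⟩ := exists_generic k
  have s1 := hL.signChanges_eq hbal hf hf0 hsum a
  have s2 := hL.signChanges_eq hbal (f := fun k => - f k) (by simp [hf]) (by simp [hf0])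
    (by linarith) a
  have nf : ∀ {x y : ℝ}, x < 0 → lexPos x y = false := by
    intro x y hx
    simp only [lexPos, decide_eq_false_iff_not]
    grind
  have pf : ∀ {x y : ℝ}, 0 < x → lexPos x y = true := by
    intro x y hx
    simp [lexPos, hx]
  have e1 : lexPos (L a k) (f k) = true := by simp [lexPos, h0, hk]
  have e2 : lexPos (L a (k + 1)) (f (k + 1)) = false := by simp [lexPos, h1, hk'.le]
  have e3 : lexPos (L a k) (-f k) = false := by simp [lexPos, h0, hk.le]
  have e4 : lexPos (L a (k + 1)) (-f (k + 1)) = true := by simp [lexPos, h1, hk']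
  exact flat_bool (p := fun k => lexPos (L a k) (f k)) (q := fun k => lexPos (L a k) (-f k))
    (k := k) (i := i) (j := j) (by simp only [e1, e2]; decide) (by simp only [e2, e3])
    (by simp only [e1, e4]) s1 s2 (by rintro rfl; linarith) (by rintro rfl; linarith)
    (by rintro rfl; linarith) (by rintro rfl; linarith) (by simp only [e1, pf hi])
    (by simp only [e1, pf hi]) (by simp only [e2, nf hj]) (by simp only [e2, nf hj])

section MaxPrinciple

variable {A : Type*} [Finite A] {κ : Type*} [Fintype κ]

/-- A transition system on `A`, with moves `nb a : κ → A` and weights `w a`, is absorbed by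
`Fx` when no nonempty set disjoint from `Fx` is closed under moves of positive weight. -/
def Absorbing (nb : A → κ → A) (Fx : Set A) (w : A → κ → ℝ) : Prop :=
  ∀ B : Set A, B.Nonempty → (∀ a ∈ B, a ∉ Fx) → ¬ ∀ a ∈ B, ∀ k, 0 < w a k → nb a k ∈ B

variable {nb : A → κ → A} {Fx : Set A} {w : A → κ → ℝ}

theorem Absorbing.nonpos (h : Absorbing nb Fx w) (hw : ∀ a k, 0 ≤ w a k)
    (hw1 : ∀ a, ∑ k, w a k = 1) {g : A → ℝ} (h0 : ∀ a ∈ Fx, g a ≤ 0)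
    (hg : ∀ a ∉ Fx, g a = ∑ k, w a k * g (nb a k)) (a : A) : g a ≤ 0 := by
  have : Nonempty A := ⟨a⟩
  obtain ⟨m, hm⟩ := Finite.exists_max g
  by_contra! hpos
  have hmp : 0 < g m := hpos.trans_le (hm a)
  refine h {b | g b = g m} ⟨m, rfl⟩ (fun b hb hF => ?_) fun b hb k hk => ?_
  · have := h0 b hF
    have hb : g b = g m := hb
    linarith
  · have hb : g b = g m := hb
    have hF : b ∉ Fx := fun hF => by have := h0 b hF; linarith
    have h1 : ∑ k, w b k * (g m - g (nb b k)) = 0 := by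
      simp only [mul_sub, Finset.sum_sub_distrib, ← Finset.sum_mul, hw1, ← hg b hF, hb]
      ring
    have h2 := (Finset.sum_eq_zero_iff_of_nonneg fun k _ =>
      mul_nonneg (hw b k) (sub_nonneg.2 (hm _))).1 h1 k (Finset.mem_univ _)
    have := (mul_eq_zero.1 h2).resolve_left hk.ne'
    exact (sub_eq_zero.1 this).symm

theorem Absorbing.eq_zero (h : Absorbing nb Fx w) (hw : ∀ a k, 0 ≤ w a k)
    (hw1 : ∀ a, ∑ k, w a k = 1) {g : A → ℝ} (h0 : ∀ a ∈ Fx, g a = 0)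
    (hg : ∀ a ∉ Fx, g a = ∑ k, w a k * g (nb a k)) (a : A) : g a = 0 := by
  refine le_antisymm (h.nonpos hw hw1 (fun a ha => (h0 a ha).le) hg a) ?_
  have := h.nonpos hw hw1 (g := fun a => -g a) (fun a ha => by simp [h0 a ha])
    (fun a ha => by simp [hg a ha]) a
  linarith

/-- Solvability of the Dirichlet problem, with continuous dependence on parameters. -/
theorem exists_dirichlet {Y : Type*} [TopologicalSpace Y] {w : Y → A → κ → ℝ}
    (hc : ∀ a k, Continuous fun s => w s a k) (h : ∀ s, Absorbing nb Fx (w s))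
    (hw : ∀ s a k, 0 ≤ w s a k) (hw1 : ∀ s a, ∑ k, w s a k = 1) (P : κ → ℝ) :
    ∃ g : Y → A → ℝ, (∀ a, Continuous fun s => g s a) ∧ (∀ s, ∀ a ∈ Fx, g s a = 0) ∧
      ∀ s, ∀ a ∉ Fx, g s a = ∑ k, w s a k * (P k + g s (nb a k)) := by
  classical
  have := Fintype.ofFinite A
  let M : Y → Matrix A A ℝ := fun s => Matrix.of fun a b =>
    (if a = b then 1 else 0) - if a ∈ Fx then 0 else ∑ k, if nb a k = b then w s a k else 0
  have hM : ∀ s (g : A → ℝ) a, (M s).mulVec g a =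
      g a - if a ∈ Fx then 0 else ∑ k, w s a k * g (nb a k) := by
    intro s g a
    simp only [Matrix.mulVec, dotProduct, M, Matrix.of_apply, sub_mul, Finset.sum_sub_distrib]
    congr 1
    · simp
    · split_ifs
      · simp
      · simp only [Finset.sum_mul]
        rw [Finset.sum_comm]
        simp
  have hdet : ∀ s, IsUnit (M s).det := by
    intro s
    rw [isUnit_iff_ne_zero]
    intro h0
    obtain ⟨g, hg0, hg⟩ := Matrix.exists_mulVec_eq_zero_iff.2 h0
    apply hg0
    funext a
    have key := fun a => (hM s g a).symm.trans (congrFun hg a)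
    refine (h s).eq_zero (hw s) (hw1 s) (fun a ha => ?_) (fun a ha => ?_) a
    · simpa [ha] using key a
    · simpa [ha, sub_eq_zero] using key a
  let b : Y → A → ℝ := fun s a => if a ∈ Fx then 0 else ∑ k, w s a k * P k
  have hMc : Continuous M := by
    refine continuous_matrix fun a b => ?_
    simp only [M, Matrix.of_apply]
    refine continuous_const.sub ?_
    split_ifs
    · exact continuous_const
    · refine continuous_finsetSum _ fun k _ => ?_
      split_ifs
      · exact hc a k
      · exact continuous_const
  have hbc : Continuous b := by
    refine continuous_pi fun a => ?_
    simp only [b]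
    split_ifs
    · exact continuous_const
    · exact continuous_finsetSum _ fun k _ => (hc a k).mul continuous_const
  have hinv : Continuous fun s => (M s)⁻¹ := by
    have : (fun s => (M s)⁻¹) = fun s => ((M s).det)⁻¹ • (M s).adjugate := by
      funext s
      rw [Matrix.inv_def, Ring.inverse_eq_inv']
    rw [this]
    exact (hMc.matrix_det.inv₀ fun s => (hdet s).ne_zero).smul hMc.matrix_adjugate
  refine ⟨fun s => (M s)⁻¹.mulVec (b s), fun a => ?_, ?_, ?_⟩
  · exact (continuous_apply a).comp (hinv.matrix_mulVec hbc)
  all_goals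
    intro s a ha
    have := hM s ((M s)⁻¹.mulVec (b s)) a
    rw [Matrix.mulVec_mulVec, Matrix.mul_nonsing_inv _ (hdet s), Matrix.one_mulVec] at this
    simp only [b, ha, if_true, if_false] at this
  · simpa using this.symm
  · simp only [mul_add, Finset.sum_add_distrib]
    simp only [b] at this ⊢
    rw [this]
    ring

end MaxPrinciple

theorem hexDir_add_two {A : Type*} [AddCommGroup A] (e₁ e₂ : A) (k : Fin 6) :
    hexDir e₁ e₂ k + hexDir e₁ e₂ (k + 2) = hexDir e₁ e₂ (k + 1) := by
  fin_cases k <;> simp [hexDir] <;> abel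

theorem hexDir_add_three {A : Type*} [AddCommGroup A] (e₁ e₂ : A) (k : Fin 6) :
    hexDir e₁ e₂ (k + 3) = - hexDir e₁ e₂ k := by
  fin_cases k <;> simp [hexDir]

theorem map_hexDir {A B F : Type*} [AddCommGroup A] [AddCommGroup B] [FunLike F A B]
    [AddMonoidHomClass F A B] (g : F) (e₁ e₂ : A) (k : Fin 6) :
    g (hexDir e₁ e₂ k) = hexDir (g e₁) (g e₂) k := by
  fin_cases k <;> simp [hexDir]

/-- The vertices of the toroidal lattice. -/
abbrev Tor (n : ℕ) : Type := ZMod (2 * n) × ZMod (2 * n)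

/-- The six directions on the torus. -/
abbrev torDir (n : ℕ) (k : Fin 6) : Tor n := hexDir (1, 0) (0, 1) k

/-- The distinguished row of the torus. -/
def fixedRow (n : ℕ) : Set (Tor n) := {a | a.2 = n}

/-- The edge vectors of a displaced toroidal lattice. -/
def edgeVec {V : Type*} [AddCommGroup V] (p₁ p₂ : V) {n : ℕ} (δ : Tor n → V) (a : Tor n)
    (k : Fin 6) : V := hexDir p₁ p₂ k + δ (a + torDir n k) - δ a

section Nondegenerate

variable {V : Type*} [AddCommGroup V] {p₁ p₂ : V} {n : ℕ} {δ : Tor n → V}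

theorem edgeVec_anti (a : Tor n) (k : Fin 6) :
    edgeVec p₁ p₂ δ (a + torDir n k) (k + 3) = - edgeVec p₁ p₂ δ a k := by
  simp only [edgeVec, torDir, hexDir_add_three, add_neg_cancel_right]
  abel

theorem edgeVec_add_two (a : Tor n) (k : Fin 6) :
    edgeVec p₁ p₂ δ (a + torDir n k) (k + 2) = edgeVec p₁ p₂ δ a (k + 1) - edgeVec p₁ p₂ δ a k := by
  rw [edgeVec, edgeVec, edgeVec, ← hexDir_add_two p₁ p₂ k, torDir, torDir, add_assoc a,
    hexDir_add_two]
  abel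

variable [Module ℝ V]

theorem hexCocycle_edgeVec (ℓ : V →ₗ[ℝ] ℝ) :
    HexCocycle (1, 0) (0, 1) fun (a : Tor n) k => ℓ (edgeVec p₁ p₂ δ a k) := by
  refine ⟨fun a k => ?_, fun a => ?_, fun a => ?_⟩
  · rw [edgeVec_anti, map_neg]
  · have h1 := edgeVec_add_two (p₁ := p₁) (p₂ := p₂) (δ := δ) a 0
    have h2 := edgeVec_anti (p₁ := p₁) (p₂ := p₂) (δ := δ) a 1
    simp only [torDir, hexDir, show (0 : Fin 6) + 2 = 2 from rfl, show (1 : Fin 6) + 3 = 4 from rfl,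
      zero_add, Matrix.cons_val_zero, Matrix.cons_val_one] at h1 h2
    rw [h1, h2, ← map_add, ← map_add]
    simp
  · have h1 := edgeVec_add_two (p₁ := p₁) (p₂ := p₂) (δ := δ) a 1
    have h2 := edgeVec_anti (p₁ := p₁) (p₂ := p₂) (δ := δ) a 2
    simp only [torDir, hexDir, show (1 : Fin 6) + 2 = 3 from rfl, show (2 : Fin 6) + 3 = 5 from rfl,
      show (1 : Fin 6) + 1 = 2 from rfl, Matrix.cons_val, ← add_sub_assoc] at h1 h2
    rw [h1, h2, ← map_add, ← map_add]
    simp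

variable (hn : 2 ≤ n) (h0 : ∀ a ∈ fixedRow n, δ a = 0)

omit [Module ℝ V] in
include h0 in
theorem edgeVec_fixed {a : Tor n} (ha : a ∈ fixedRow n) : edgeVec p₁ p₂ δ a 0 = p₁ ∧
    edgeVec p₁ p₂ δ a 3 = - p₁ := by
  constructor
  · rw [edgeVec, h0 a ha, h0]
    · simp [hexDir]
    · simpa [fixedRow, torDir, hexDir] using ha
  · rw [edgeVec, h0 a ha, h0]
    · simp [hexDir]
    · simpa [fixedRow, torDir, hexDir] using ha

include hn h0 in
/-- A displaced lattice with all vertices off the distinguished row in weighted equilibrium has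
nondegenerate triangles. -/
theorem edgeVec_nondegenerate (hbal : ∀ a ∉ fixedRow n, ∃ w : Fin 6 → ℝ, (∀ k, 0 < w k) ∧
      ∑ k, w k • edgeVec p₁ p₂ δ a k = 0)
    (ℓ : V →ₗ[ℝ] ℝ) {a : Tor n} {k : Fin 6} (hk : ℓ (edgeVec p₁ p₂ δ a k) = 0)
    (hk' : ℓ (edgeVec p₁ p₂ δ a (k + 1)) = 0) : ℓ p₁ = 0 ∧ ℓ p₂ = 0 := by
  have : NeZero (2 * n) := ⟨by omega⟩
  have hne : (1 : ZMod (2 * n)) ≠ 0 := by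
    have : Fact (1 < 2 * n) := ⟨by omega⟩
    exact one_ne_zero
  have hL := hexCocycle_edgeVec (p₁ := p₁) (p₂ := p₂) (δ := δ) ℓ
  have hb : ∀ a ∉ fixedRow n, HexBalanced fun k => ℓ (edgeVec p₁ p₂ δ a k) := by
    intro a ha
    obtain ⟨w, hw, h⟩ := hbal a ha
    refine ⟨w, hw, ?_⟩
    have := congrArg ℓ h
    simpa using this
  have hb' : ∀ a, ℓ (edgeVec p₁ p₂ δ a 3) = - ℓ (edgeVec p₁ p₂ δ a 0) ∨
      HexBalanced fun k => ℓ (edgeVec p₁ p₂ δ a k) := by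
    intro a
    by_cases ha : a ∈ fixedRow n
    · left; rw [(edgeVec_fixed h0 ha).1, (edgeVec_fixed h0 ha).2, map_neg]
    · exact Or.inr (hb a ha)
  have hflat : ∀ a ∉ fixedRow n, ∀ k, ℓ (edgeVec p₁ p₂ δ a k) = 0 →
      ℓ (edgeVec p₁ p₂ δ a (k + 1)) = 0 → ∀ m, ℓ (edgeVec p₁ p₂ δ a m) = 0 := fun a ha k h1 h2 m =>
    hL.flat hb' (hb a ha) h1 h2 m
  obtain ⟨b, hbF, hbflat⟩ : ∃ b, b ∉ fixedRow n ∧ ∀ m, ℓ (edgeVec p₁ p₂ δ b m) = 0 := by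
    by_cases ha : a ∈ fixedRow n
    · have hrow : a + torDir n k ∉ fixedRow n ∨ a + torDir n (k + 1) ∉ fixedRow n := by
        have ha : a.2 = n := ha
        simp only [fixedRow, mem_ofPred_eq, Prod.snd_add, ha, add_eq_left]
        fin_cases k <;> simp [torDir, hexDir, hne]
      have e2 : ℓ (edgeVec p₁ p₂ δ (a + torDir n k) (k + 2)) = 0 := by
        rw [edgeVec_add_two, map_sub, hk, hk', sub_zero]
      rcases hrow with h | h
      · refine ⟨_, h, hflat _ h (k + 2) e2 ?_⟩
        rw [add_assoc, show (2 : Fin 6) + 1 = 3 from rfl, edgeVec_anti, map_neg, hk, neg_zero]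
      · refine ⟨_, h, hflat _ h (k + 1 + 3) ?_ ?_⟩
        · rw [edgeVec_anti, map_neg, hk', neg_zero]
        · have := edgeVec_anti (p₁ := p₁) (p₂ := p₂) (δ := δ) (a + torDir n k) (k + 2)
          rw [add_assoc a, torDir, torDir, hexDir_add_two] at this
          rw [show k + 1 + 3 + 1 = k + 2 + 3 by simp only [add_assoc]; rfl, this, map_neg, e2,
            neg_zero]
    · exact ⟨a, ha, hflat a ha k hk hk'⟩
  have down : ∀ j : ℕ, (∀ i < j, b - i • ((0, 1) : Tor n) ∉ fixedRow n) →
      ℓ (edgeVec p₁ p₂ δ (b - j • ((0, 1) : Tor n)) 0) = 0 ∧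
      ℓ (edgeVec p₁ p₂ δ (b - j • ((0, 1) : Tor n)) 1) = 0 ∧
      ℓ ((j : ℝ) • p₂ + δ b - δ (b - j • ((0, 1) : Tor n))) = 0 := by
    intro j
    induction j with
    | zero => intro _; simp [hbflat]
    | succ j ih =>
      intro hj
      obtain ⟨h1, h2, h3⟩ := ih fun i hi => hj i (by omega)
      set c := b - j • ((0, 1) : Tor n) with hc
      have hcf := hflat c (hj j (by omega)) 0 h1 h2
      have hc' : b - (j + 1) • ((0, 1) : Tor n) = c + torDir n 4 := by
        simp only [hc, torDir, hexDir, succ_nsmul, Matrix.cons_val]; abel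
      rw [hc']
      have i1 : ℓ (edgeVec p₁ p₂ δ (c + torDir n 4) 1) = 0 := by
        rw [show (1 : Fin 6) = 4 + 3 from rfl, edgeVec_anti, map_neg, hcf, neg_zero]
      refine ⟨?_, i1, ?_⟩
      · rw [show (0 : Fin 6) = 4 + 2 from rfl, edgeVec_add_two, map_sub, hcf, hcf, sub_zero]
      · have h4 := hcf 4
        rw [edgeVec] at h4
        rw [← sub_eq_zero.2 (h3.trans h4.symm), ← map_sub]
        simp only [hexDir, Nat.cast_succ, Matrix.cons_val, add_smul, one_smul]
        congr 1
        abel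
  have up : ∀ j : ℕ, (∀ i < j, b + i • ((0, 1) : Tor n) ∉ fixedRow n) →
      ℓ (edgeVec p₁ p₂ δ (b + j • ((0, 1) : Tor n)) 3) = 0 ∧
      ℓ (edgeVec p₁ p₂ δ (b + j • ((0, 1) : Tor n)) 4) = 0 ∧
      ℓ ((j : ℝ) • p₂ + δ (b + j • ((0, 1) : Tor n)) - δ b) = 0 := by
    intro j
    induction j with
    | zero => intro _; simp [hbflat]
    | succ j ih =>
      intro hj
      obtain ⟨h1, h2, h3⟩ := ih fun i hi => hj i (by omega)
      set c := b + j • ((0, 1) : Tor n) with hc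
      have hcf := hflat c (hj j (by omega)) 3 h1 h2
      have hc' : b + (j + 1) • ((0, 1) : Tor n) = c + torDir n 1 := by
        simp only [hc, torDir, hexDir, succ_nsmul, Matrix.cons_val]; abel
      rw [hc']
      have i1 : ℓ (edgeVec p₁ p₂ δ (c + torDir n 1) 4) = 0 := by
        rw [show (4 : Fin 6) = 1 + 3 from rfl, edgeVec_anti, map_neg, hcf, neg_zero]
      refine ⟨?_, i1, ?_⟩
      · rw [show (3 : Fin 6) = 1 + 2 from rfl, edgeVec_add_two, map_sub, hcf, hcf, sub_zero]
      · have h4 := hcf 1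
        rw [edgeVec] at h4
        rw [← add_zero (0 : ℝ)]
        nth_rewrite 2 [← h3]
        rw [← h4, ← map_add]
        simp only [hexDir, Nat.cast_succ, Matrix.cons_val, add_smul, one_smul]
        congr 1
        abel
  have ex1 : ∃ j : ℕ, b - j • ((0, 1) : Tor n) ∈ fixedRow n :=
    ⟨(b.2 - n).val, by simp [fixedRow]⟩
  have ex2 : ∃ j : ℕ, b + j • ((0, 1) : Tor n) ∈ fixedRow n :=
    ⟨((n : ZMod (2 * n)) - b.2).val, by simp [fixedRow]⟩
  classical
  obtain ⟨h1, -, h2⟩ := down (Nat.find ex1) fun i hi => Nat.find_min ex1 hi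
  obtain ⟨-, -, h3⟩ := up (Nat.find ex2) fun i hi => Nat.find_min ex2 hi
  rw [(edgeVec_fixed h0 (Nat.find_spec ex1)).1] at h1
  rw [h0 _ (Nat.find_spec ex1)] at h2
  rw [h0 _ (Nat.find_spec ex2)] at h3
  have hpos : Nat.find ex1 ≠ 0 := by
    intro h
    have := Nat.find_spec ex1
    rw [h] at this
    exact hbF (by simpa using this)
  refine ⟨h1, ?_⟩
  simp only [map_add, map_sub, map_smul, map_zero, smul_eq_mul] at h2 h3
  have h4 : ((Nat.find ex1 : ℝ) + Nat.find ex2) * ℓ p₂ = 0 := by linarith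
  refine (mul_eq_zero.1 h4).resolve_left ?_
  have : (0 : ℝ) < Nat.find ex1 := by exact_mod_cast Nat.pos_of_ne_zero hpos
  positivity

end Nondegenerate

theorem Absorbing.eq_zero_plane {A κ : Type*} [Finite A] [Fintype κ] {nb : A → κ → A} {Fx : Set A}
    {w : A → κ → ℝ} (h : Absorbing nb Fx w) (hw : ∀ a k, 0 ≤ w a k)
    (hw1 : ∀ a, ∑ k, w a k = 1) {g : A → Plane} (h0 : ∀ a ∈ Fx, g a = 0)
    (hg : ∀ a ∉ Fx, g a = ∑ k, w a k • g (nb a k)) (a : A) : g a = 0 := by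
  refine Prod.ext ?_ ?_
  · exact h.eq_zero hw hw1 (g := fun a => (g a).1) (fun a ha => by simp [h0 a ha])
      (fun a ha => by simpa [Prod.fst_sum] using congrArg Prod.fst (hg a ha)) a
  · exact h.eq_zero hw hw1 (g := fun a => (g a).2) (fun a ha => by simp [h0 a ha])
      (fun a ha => by simpa [Prod.snd_sum] using congrArg Prod.snd (hg a ha)) a

/-- The planar determinant. -/
def pdet (u v : Plane) : ℝ := u.1 * v.2 - u.2 * v.1

/-- The first basis vector of the lattice of mesh `1 / n`. -/
def latA (n : ℕ) : Plane := (1 / n, 0)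

/-- The second basis vector of the lattice of mesh `1 / n`. -/
def latB (n : ℕ) : Plane := (1 / (2 * n), 1 / n)

/-- The position of a lattice vertex. -/
def latPos (n : ℕ) (v : ℤ × ℤ) : Plane := (((v.1 : ℝ) + v.2 / 2) / n, (v.2 : ℝ) / n)

/-- Reduction of the lattice to the torus. -/
def torProj (n : ℕ) : ℤ × ℤ →+ Tor n :=
  (Int.castAddHom _).prodMap (Int.castAddHom _)

@[simp] theorem torProj_apply (n : ℕ) (v : ℤ × ℤ) : torProj n v =
  ((v.1 : ZMod _), (v.2 : ZMod _)) := rfl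

/-- The six lattice directions in the integer lattice. -/
abbrev latDir (k : Fin 6) : ℤ × ℤ := hexDir ((1, 0) : ℤ × ℤ) (0, 1) k

theorem torProj_latDir (n : ℕ) (k : Fin 6) : torProj n (latDir k) = torDir n k := by
  rw [latDir, map_hexDir]; simp

theorem latPos_add (n : ℕ) (v w : ℤ × ℤ) : latPos n (v + w) = latPos n v + latPos n w := by
  ext <;> simp [latPos] <;> ring

theorem latPos_latDir (n : ℕ) (k : Fin 6) : latPos n (latDir k) = hexDir (latA n) (latB n) k := by
  have := map_hexDir (AddMonoidHom.mk' (latPos n) (latPos_add n)) ((1, 0) : ℤ × ℤ) (0, 1) k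
  simp only [AddMonoidHom.mk'_apply] at this
  rw [this]
  congr 1 <;> ext <;> simp [latPos, latA, latB]; ring

/-- The deck transformation `(x, y) ↦ (x + 1, σ y)`. -/
def deck (σ : ℤ) (z : Plane) : Plane := (z.1 + 1, σ * z.2)

/-- The action of the deck transformation on the lattice. -/
def latDeck (n : ℕ) (σ : ℤ) (v : ℤ × ℤ) : ℤ × ℤ := (v.1 + n + (if σ = 1 then 0 else v.2), σ * v.2)

/-- The action of the deck transformation on the toroidal lattice. -/
def torDeck (n : ℕ) (σ : ℤ) (a : Tor n) : Tor n := (a.1 + n + (if σ = 1 then 0 else a.2), σ * a.2)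

/-- The action of the deck transformation on directions. -/
def dirDeck (σ : ℤ) : Equiv.Perm (Fin 6) := if σ = 1 then Equiv.refl _ else Equiv.neg _

section Deck

variable {n : ℕ} {σ : ℤ} (hσ : σ = 1 ∨ σ = -1)

include hσ

theorem torProj_latDeck (v : ℤ × ℤ) : torProj n (latDeck n σ v) = torDeck n σ (torProj n v) := by
  rcases hσ with rfl | rfl <;> simp [latDeck, torDeck]

theorem latDeck_latDeck (v : ℤ × ℤ) : latDeck n σ (latDeck n σ v) = v + (2 * (n : ℤ), 0) := by
  rcases hσ with rfl | rfl <;> ext <;> simp [latDeck] <;> ring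

theorem torDeck_torDeck (a : Tor n) : torDeck n σ (torDeck n σ a) = a := by
  have : ((n : ZMod (2 * n)) + n) = 0 := by
    have := ZMod.natCast_self (2 * n)
    push_cast at this
    rw [← this]; ring
  rcases hσ with rfl | rfl <;> ext <;> simp [torDeck]
  · rw [add_assoc, this, add_zero]
  · linear_combination this

theorem dirDeck_dirDeck (k : Fin 6) : dirDeck σ (dirDeck σ k) = k := by
  rcases hσ with rfl | rfl <;> simp [dirDeck]

theorem latDeck_add (v : ℤ × ℤ) (k : Fin 6) :
    latDeck n σ (v + latDir k) = latDeck n σ v + latDir (dirDeck σ k) := by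
  rcases hσ with rfl | rfl
  · ext <;> simp [latDeck, dirDeck]; ring
  · have : latDeck n (-1) (v + latDir k) = latDeck n (-1) v + 
      ((latDir k).1 + (latDir k).2, -(latDir k).2) := by
      ext <;> simp [latDeck]; ring; ring
    rw [this]
    congr 1
    simp only [dirDeck]
    fin_cases k <;> decide

theorem torDeck_add (a : Tor n) (k : Fin 6) :
    torDeck n σ (a + torDir n k) = torDeck n σ a + torDir n (dirDeck σ k) := by
  have := latDeck_add (n := n) hσ 0 k
  have h0 := congrArg (torProj n) this
  rw [zero_add, torProj_latDeck hσ, map_add, torProj_latDir, torProj_latDir, torProj_latDeck hσ,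
    map_zero] at h0
  have e : ∀ a b : Tor n, torDeck n σ (a + b) + torDeck n σ 0 = torDeck n σ a + torDeck n σ b := by
    intro a b
    rcases hσ with rfl | rfl <;> ext <;> simp [torDeck] <;> ring
  have := e a (torDir n k)
  rw [h0, ← add_assoc, add_right_comm] at this
  exact add_right_cancel this

theorem torDeck_mem_fixedRow {a : Tor n} (ha : a ∈ fixedRow n) : torDeck n σ a ∈ fixedRow n := by
  have : ((n : ZMod (2 * n)) + n) = 0 := by
    have := ZMod.natCast_self (2 * n)
    push_cast at this
    rw [← this]; ring
  have ha : a.2 = n := ha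
  rcases hσ with rfl | rfl
  · simp [fixedRow, torDeck, ha]
  · simp only [fixedRow, torDeck, ha, mem_ofPred_eq]
    push_cast
    linear_combination -this

theorem hexDir_dirDeck (k : Fin 6) : hexDir (latA n) (latB n) (dirDeck σ k) =
    ((hexDir (latA n) (latB n) k).1, σ * (hexDir (latA n) (latB n) k).2) := by
  rcases hσ with rfl | rfl
  · simp [dirDeck]
  · simp only [dirDeck]
    fin_cases k <;> ext <;> simp [hexDir, latA, latB] <;> ring

end Deck

theorem torProj_mem_fixedRow {n : ℕ} (hn : 2 ≤ n) {v : ℤ × ℤ} (h1 : -(n : ℤ) ≤ v.2) (h2 : v.2 ≤ n) :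
    torProj n v ∈ fixedRow n ↔ v.2 = n ∨ v.2 = -n := by
  have : torProj n v ∈ fixedRow n ↔ ((v.2 : ℤ) : ZMod (2 * n)) = ((n : ℤ) : ZMod (2 * n)) := by
    simp [fixedRow]
  rw [this, ZMod.intCast_eq_intCast_iff_dvd_sub]
  constructor
  · rintro ⟨c, hc⟩
    push_cast at hc
    have : c = 0 ∨ c = 1 := by
      have h3 : 0 ≤ c := by
        by_contra! h
        nlinarith
      have h4 : c ≤ 1 := by
        by_contra! h
        nlinarith
      omega
    rcases this with rfl | rfl
    · left; linarith
    · right; linarith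
  · rintro (h | h)
    · rw [h]; simp
    · exact ⟨1, by rw [h]; push_cast; ring⟩

open Classical in
/-- The uniform transition weights along a relation, or along all moves if the relation allows
none. -/
def relWeight {A κ : Type*} [Fintype κ] (E : A → κ → Prop) (a : A) (k : κ) : ℝ :=
  if ∃ j, E a j then (if E a k then 1 else 0) / ∑ j, (if E a j then (1 : ℝ) else 0)
  else 1 / Fintype.card κ

section relWeight

variable {A κ : Type*} [Fintype κ] {E : A → κ → Prop}

theorem relWeight_sum_pos {a : A} [DecidablePred (E a)] (h : ∃ j, E a j) :
    0 < ∑ j, (if E a j then (1 : ℝ) else 0) := by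
  obtain ⟨j, hj⟩ := h
  exact Finset.sum_pos' (fun i _ => by split_ifs <;> simp) ⟨j, Finset.mem_univ _, by simp [hj]⟩

theorem relWeight_nonneg (a : A) (k : κ) : 0 ≤ relWeight E a k := by
  classical
  unfold relWeight
  split_ifs with h h'
  · exact div_nonneg zero_le_one (relWeight_sum_pos h).le
  · simp
  · positivity

theorem relWeight_pos_iff {a : A} (h : ∃ j, E a j) (k : κ) : 0 < relWeight E a k ↔ E a k := by
  classical
  unfold relWeight
  rw [if_pos h]
  split_ifs with h'
  · simpa [h'] using relWeight_sum_pos h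
  · simp [h']

theorem relWeight_pos_of_not {a : A} (h : ¬ ∃ j, E a j) (k : κ) : 0 < relWeight E a k := by
  unfold relWeight
  rw [if_neg h]
  have : Nonempty κ := ⟨k⟩
  have : 0 < Fintype.card κ := Fintype.card_pos
  positivity

theorem sum_relWeight [Nonempty κ] (a : A) : ∑ k, relWeight E a k = 1 := by
  classical
  unfold relWeight
  split_ifs with h
  · rw [← Finset.sum_div]
    exact div_self (by convert (relWeight_sum_pos h).ne')
  · simp

theorem relWeight_equivariant {τ : A → A} {ρ : Equiv.Perm κ}
    (h : ∀ a k, E (τ a) (ρ k) ↔ E a k) (a : A) (k : κ) :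
    relWeight E (τ a) (ρ k) = relWeight E a k := by
  classical
  have h1 : (∃ j, E (τ a) j) ↔ ∃ j, E a j := by
    rw [← ρ.exists_congr_right]
    simp [h]
  have h2 : ∑ j, (if E (τ a) j then (1 : ℝ) else 0) = ∑ j, (if E a j then (1 : ℝ) else 0) := by
    rw [← Equiv.sum_comp ρ]
    simp [h]
  simp only [relWeight, h1, h]
  split_ifs
  · exact congrArg _ (by convert h2)
  · exact congrArg _ (by convert h2)
  · rfl

end relWeight

/-- A family of sets of lattice vertices tracing an arc across the strip and its translates. -/
structure ArcTrace (n : ℕ) (σ : ℤ) (N : ℤ → Set (ℤ × ℤ)) : Prop where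
  finite : (N 0).Finite
  low : ∀ m, ∀ v ∈ N m, -(n : ℤ) ≤ v.2
  high : ∀ m, ∀ v ∈ N m, v.2 ≤ n
  disj : ∀ m m' v, v ∈ N m → v ∈ N m' → m = m'
  deck : ∀ m v, latDeck n σ v ∈ N (m + 1) ↔ v ∈ N m
  conn : ∀ m, ∀ B : Set (ℤ × ℤ), (∃ v ∈ N m, v ∈ B) →
    (∀ v ∈ N m, v ∈ B → ∀ k, v + latDir k ∈ N m → v + latDir k ∈ B) →
    ∃ v ∈ N m, v ∈ B ∧ (v.2 = n ∨ v.2 = -n)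
  root : ∀ v ∈ N 0, (v.2 = n ∨ v.2 = -n) → |(latPos n v).1| ≤ 2 / n

/-- The adjacency relation along the traces of an arc, on the torus. -/
def arcRel (n : ℕ) (N : ℤ → Set (ℤ × ℤ)) (a : Tor n) (k : Fin 6) : Prop :=
  ∃ u m, torProj n u = a ∧ u ∈ N m ∧ u + latDir k ∈ N m

section Arc

variable {n : ℕ} {σ : ℤ} {N : ℤ → Set (ℤ × ℤ)} (hN : ArcTrace n σ N) (hσ : σ = 1 ∨ σ = -1)
  (hn : 2 ≤ n)

include hN hσ

theorem ArcTrace.shift (m : ℤ) (v : ℤ × ℤ) (l : ℤ) :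
    v + (2 * n * l, 0) ∈ N (m + 2 * l) ↔ v ∈ N m := by
  have h1 : ∀ m (v : ℤ × ℤ), v + (2 * (n : ℤ), 0) ∈ N (m + 2) ↔ v ∈ N m := by
    intro m v
    rw [← latDeck_latDeck hσ, show m + 2 = m + 1 + 1 by ring, hN.deck, hN.deck]
  induction l using Int.induction_on generalizing m v with
  | zero => simp [show ((0, 0) : ℤ × ℤ) = 0 from rfl]
  | succ i ih =>
    refine Iff.trans ?_ ((h1 _ _).trans (ih m v))
    congr! 1
    · ring_nf
    · ext <;> simp; ring
  | pred i ih =>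
    refine Iff.trans (h1 _ _).symm (Iff.trans ?_ (ih m v))
    congr! 1
    · ring_nf
    · ext <;> simp; ring

include hn in
theorem ArcTrace.of_arcRel {m : ℤ} {v : ℤ × ℤ} (hv : v ∈ N m) (hf : torProj n v ∉ fixedRow n)
    {k : Fin 6} (h : arcRel n N (torProj n v) k) : v + latDir k ∈ N m := by
  obtain ⟨u, m', hu, hu1, hu2⟩ := h
  rw [torProj_mem_fixedRow hn (hN.low _ _ hv) (hN.high _ _ hv)] at hf
  simp only [torProj_apply, Prod.mk.injEq, ZMod.intCast_eq_intCast_iff_dvd_sub] at hu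
  obtain ⟨⟨c, hc⟩, ⟨d, hd⟩⟩ := hu
  push_cast at hc hd
  have i1 := hN.low _ _ hv
  have i2 := hN.high _ _ hv
  have i3 := hN.low _ _ hu1
  have i4 := hN.high _ _ hu1
  have hd0 : d = 0 := by
    have i5 : v.2 < n := by omega
    have i6 : -(n : ℤ) < v.2 := by omega
    have : d < 1 := by by_contra! h; nlinarith
    have : -1 < d := by by_contra! h; nlinarith
    omega
  have e : v = u + (2 * n * c, 0) := by
    ext <;> simp
    · linarith
    · rw [hd0] at hd; linarith
  have h1 : v ∈ N (m' + 2 * c) := by rw [e, hN.shift hσ]; exact hu1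
  obtain rfl := hN.disj _ _ _ hv h1
  rw [e, add_right_comm, hN.shift hσ]
  exact hu2

theorem arcRel_deck (a : Tor n) (k : Fin 6) :
    arcRel n N (torDeck n σ a) (dirDeck σ k) ↔ arcRel n N a k := by
  have h : ∀ a k, arcRel n N a k → arcRel n N (torDeck n σ a) (dirDeck σ k) := by
    rintro a k ⟨u, m, rfl, h1, h2⟩
    refine ⟨latDeck n σ u, m + 1, torProj_latDeck hσ u, (hN.deck _ _).2 h1, ?_⟩
    rw [← latDeck_add hσ, hN.deck]
    exact h2
  refine ⟨fun h' => ?_, h a k⟩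
  have := h _ _ h'
  rwa [torDeck_torDeck hσ, dirDeck_dirDeck hσ] at this

/-- The interpolated Tutte weights. -/
def tutteWeight (n : ℕ) (N : ℤ → Set (ℤ × ℤ)) (s : unitInterval) (a : Tor n) (k : Fin 6) : ℝ :=
  s * (1 / 6) + (1 - s) * relWeight (arcRel n N) a k

omit hN hσ in
theorem tutteWeight_nonneg (s : unitInterval) (a : Tor n) (k : Fin 6) :
    0 ≤ tutteWeight n N s a k := by
  have h1 := s.2.1
  have h2 : (0 : ℝ) ≤ 1 - s := sub_nonneg.2 s.2.2
  have := relWeight_nonneg (E := arcRel n N) a k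
  unfold tutteWeight
  positivity

omit hN hσ in
theorem tutteWeight_pos {s : unitInterval} (hs : 0 < s) (a : Tor n) (k : Fin 6) :
    0 < tutteWeight n N s a k := by
  have h1 : (0 : ℝ) < s := hs
  have h2 : (0 : ℝ) ≤ 1 - s := sub_nonneg.2 s.2.2
  have := relWeight_nonneg (E := arcRel n N) a k
  unfold tutteWeight
  positivity

omit hN hσ in
theorem sum_tutteWeight (s : unitInterval) (a : Tor n) : ∑ k, tutteWeight n N s a k = 1 := by
  simp only [tutteWeight, Finset.sum_add_distrib, ← Finset.mul_sum, sum_relWeight]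
  simp

omit hσ in
include hn in
theorem absorbing_tutteWeight (s : unitInterval) :
    Absorbing (fun a k => a + torDir n k) (fixedRow n) (tutteWeight n N s) := by
  have : NeZero (2 * n) := ⟨by omega⟩
  intro B ⟨b, hb⟩ hBF hB
  by_cases hcase : s = 0 ∧ ∃ a ∈ B, ∃ k, arcRel n N a k
  · obtain ⟨hs, a, ha, k, u, m, rfl, h1, h2⟩ := hcase
    obtain ⟨v, hv, hvB, hvF⟩ := hN.conn m {v | torProj n v ∈ B} ⟨u, h1, ha⟩ (by
      intro v hv hvB k hk
      have hrel : arcRel n N (torProj n v) k := ⟨v, m, rfl, hv, hk⟩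
      have := hB _ hvB k (by
        simp only [tutteWeight, hs]
        simpa using (relWeight_pos_iff ⟨k, hrel⟩ k).2 hrel)
      show torProj n (v + latDir k) ∈ B
      rwa [map_add, torProj_latDir])
    exact hBF _ hvB ((torProj_mem_fixedRow hn (hN.low _ _ hv) (hN.high _ _ hv)).2 hvF)
  · have hup : ∀ a ∈ B, a + (0, 1) ∈ B := by
      intro a ha
      refine hB a ha 1 ?_
      by_cases hs : s = 0
      · have : ¬ ∃ k, arcRel n N a k := fun h => hcase ⟨hs, a, ha, h⟩
        simp only [tutteWeight, hs]
        simpa using relWeight_pos_of_not this 1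
      · exact tutteWeight_pos (unitInterval.pos_iff_ne_zero.2 hs) a 1
    have hup' : ∀ j : ℕ, b + j • ((0, 1) : Tor n) ∈ B := by
      intro j
      induction j with
      | zero => simpa using hb
      | succ j ih => rw [succ_nsmul, ← add_assoc]; exact hup _ ih
    exact hBF _ (hup' ((n : ZMod (2 * n)) - b.2).val) (by simp [fixedRow])

include hn in
/-- Along the arc, the solution of the degenerate system stays close to the vertical axis. -/
theorem ArcTrace.abs_le {δ : Tor n → Plane} (h0 : ∀ a ∈ fixedRow n, δ a = 0)
    (hδ : ∀ a ∉ fixedRow n, δ a = ∑ k, tutteWeight n N 0 a k •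
      (hexDir (latA n) (latB n) k + δ (a + torDir n k))) {v : ℤ × ℤ} (hv : v ∈ N 0) :
    |(latPos n v).1 + (δ (torProj n v)).1| ≤ 2 / n := by
  classical
  have := hN.finite.to_subtype
  let nb : N 0 → Fin 6 → N 0 := fun v k => if h : v.1 + latDir k ∈ N 0 then ⟨_, h⟩ else v
  let Fx : Set (N 0) := {v | v.1.2 = n ∨ v.1.2 = -n}
  let w : N 0 → Fin 6 → ℝ := fun v k => tutteWeight n N 0 (torProj n v.1) k
  have hFx : ∀ v : N 0, v ∈ Fx ↔ torProj n v.1 ∈ fixedRow n := fun v =>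
    (torProj_mem_fixedRow hn (hN.low _ _ v.2) (hN.high _ _ v.2)).symm
  have hex : ∀ v : N 0, v ∉ Fx → ∃ k, arcRel n N (torProj n v.1) k := by
    intro v hv
    by_contra! hno
    obtain ⟨v', hv', h1, h2⟩ := hN.conn 0 {v.1} ⟨v.1, v.2, rfl⟩ (by
      intro u hu huv k hk
      obtain rfl : u = v.1 := huv
      exact absurd ⟨_, 0, rfl, hu, hk⟩ (hno k))
    obtain rfl : v' = v.1 := h1
    exact hv h2
  have hwpos : ∀ v : N 0, v ∉ Fx → ∀ k, 0 < w v k ↔ v.1 + latDir k ∈ N 0 := by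
    intro v hv k
    simp only [w, tutteWeight]
    have := relWeight_pos_iff (hex v hv) k
    simp only [Set.Icc.coe_zero, zero_mul, sub_zero, one_mul, zero_add, this]
    exact ⟨fun h => hN.of_arcRel hσ hn v.2 ((hFx v).not.1 hv) h, fun h => ⟨_, 0, rfl, v.2, h⟩⟩
  have habs : Absorbing nb Fx w := by
    rintro B ⟨b, hb⟩ hBF hB
    obtain ⟨v, hv, ⟨h1, h1'⟩, h2⟩ := hN.conn 0 (Subtype.val '' B) ⟨b.1, b.2, b, hb, rfl⟩ (by
      rintro _ hu ⟨u, huB, rfl⟩ k hk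
      have := hB u huB k ((hwpos u (hBF u huB) k).2 hk)
      simp only [nb, hk, dif_pos] at this
      exact ⟨_, this, rfl⟩)
    obtain ⟨h3, rfl⟩ := h1'
    exact hBF _ h3 h2
  let g : N 0 → ℝ := fun v => (latPos n v.1).1 + (δ (torProj n v.1)).1
  have hg : ∀ v ∉ Fx, g v = ∑ k, w v k * g (nb v k) := by
    intro v hv
    have h1 := congrArg Prod.fst (hδ _ ((hFx v).not.1 hv))
    simp only [Prod.fst_sum, Prod.smul_fst, Prod.fst_add, smul_eq_mul] at h1
    have h2 : g v = ∑ k, w v k * ((latPos n v.1).1 + ((hexDir (latA n) (latB n) k).1 +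
        (δ (torProj n v.1 + torDir n k)).1)) := by
      simp only [mul_add (w v _) (latPos n v.1).1, Finset.sum_add_distrib, ← Finset.sum_mul, w,
        sum_tutteWeight, ← h1, g, one_mul]
    rw [h2]
    refine Finset.sum_congr rfl fun k _ => ?_
    by_cases hk : v.1 + latDir k ∈ N 0
    · simp only [g, nb, hk, dif_pos, latPos_add, latPos_latDir, map_add, torProj_latDir,
        Prod.fst_add, add_assoc]
    · have h3 : w v k = 0 := le_antisymm (not_lt.1 ((hwpos v hv k).not.2 hk))
        (tutteWeight_nonneg _ _ _)
      simp [h3]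
  have hgF : ∀ v ∈ Fx, |g v| ≤ 2 / n := by
    intro v hv
    simp only [g, h0 _ ((hFx v).1 hv), Prod.fst_zero, add_zero]
    exact hN.root _ v.2 hv
  have hw0 : ∀ v k, 0 ≤ w v k := fun v k => tutteWeight_nonneg _ _ _
  have hw1 : ∀ v, ∑ k, w v k = 1 := fun v => sum_tutteWeight _ _
  rw [_root_.abs_le]
  constructor
  · have := habs.nonpos hw0 hw1 (g := fun v => -(2 / n) - g v)
      (fun a ha => by have := _root_.abs_le.1 (hgF a ha); linarith)
      (fun a ha => by simp only [mul_sub, Finset.sum_sub_distrib, ← Finset.sum_mul, hw1, hg a ha,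
        one_mul]) ⟨v, hv⟩
    simp only [g] at this
    linarith
  · have := habs.nonpos hw0 hw1 (g := fun v => g v - 2 / n)
      (fun a ha => by have := _root_.abs_le.1 (hgF a ha); linarith)
      (fun a ha => by simp only [mul_sub, Finset.sum_sub_distrib, ← Finset.sum_mul, hw1, hg a ha,
        one_mul]) ⟨v, hv⟩
    simp only [g] at this
    linarith

end Arc

theorem sum_hexDir {A : Type*} [AddCommGroup A] (e₁ e₂ : A) : ∑ k, hexDir e₁ e₂ k = 0 := by
  simp only [Fin.sum_univ_six, hexDir, Matrix.cons_val]
  abel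

theorem pdet_ne_zero {n : ℕ} (hn : n ≠ 0) {u v : Plane}
    (h : ∀ ℓ : Plane →ₗ[ℝ] ℝ, ℓ u = 0 → ℓ v = 0 → ℓ (latA n) = 0 ∧ ℓ (latB n) = 0) :
    pdet u v ≠ 0 := by
  intro h0
  have hn' : (n : ℝ) ≠ 0 := by exact_mod_cast hn
  let L : Plane → Plane →ₗ[ℝ] ℝ := fun w => w.1 • LinearMap.snd ℝ ℝ ℝ - w.2 • LinearMap.fst ℝ ℝ ℝ
  have hL : ∀ w z, L w z = pdet w z := fun w z => by simp [L, pdet]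
  have hz : ∀ w, L w (latA n) = 0 → L w (latB n) = 0 → w = 0 := by
    intro w h1 h2
    simp only [hL, pdet, latA, latB, mul_zero, zero_sub, neg_eq_zero] at h1 h2
    have h3 : w.2 = 0 := by simpa [hn'] using h1
    have h4 : w.1 = 0 := by simpa [hn', h3] using h2
    exact Prod.ext h4 h3
  have h1 : pdet u u = 0 := by simp only [pdet]; ring
  have h2 : pdet v v = 0 := by simp only [pdet]; ring
  have h3 : pdet v u = 0 := by simp only [pdet] at h0 ⊢; linarith
  obtain ⟨a, b⟩ := h (L u) (by rw [hL, h1]) (by rw [hL, h0])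
  obtain ⟨a', b'⟩ := h (L v) (by rw [hL, h3]) (by rw [hL, h2])
  have hu := hz u a b
  have hv := hz v a' b'
  have := (h (LinearMap.fst ℝ ℝ ℝ) (by simp [hu]) (by simp [hv])).1
  simp [latA, hn'] at this

theorem pdet_hexDir (n : ℕ) (k : Fin 6) :
    pdet (hexDir (latA n) (latB n) k) (hexDir (latA n) (latB n) (k + 1)) = 1 / n * (1 / n) := by
  fin_cases k <;> simp [pdet, hexDir, latA, latB] <;> ring

/-- The Tutte deformation of the lattice straightening a given arc. -/
theorem exists_tutte_family {n : ℕ} {σ : ℤ} {N : ℤ → Set (ℤ × ℤ)} (hN : ArcTrace n σ N)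
    (hσ : σ = 1 ∨ σ = -1) (hn : 2 ≤ n) :
    ∃ δ : unitInterval → Tor n → Plane, (∀ a, Continuous fun s => δ s a) ∧ (∀ a, δ 1 a = 0) ∧
      (∀ s, ∀ a ∈ fixedRow n, δ s a = 0) ∧
      (∀ s a, δ s (torDeck n σ a) = ((δ s a).1, σ * (δ s a).2)) ∧
      (∀ s a k, 0 < pdet (edgeVec (latA n) (latB n) (δ s) a k)
        (edgeVec (latA n) (latB n) (δ s) a (k + 1))) ∧
      ∀ v ∈ N 0, |(latPos n v).1 + (δ 0 (torProj n v)).1| ≤ 3 / n := by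
  have : NeZero (2 * n) := ⟨by omega⟩
  have hn0 : (0 : ℝ) < n := by exact_mod_cast (by omega : 0 < n)
  have habs := absorbing_tutteWeight hN hn
  have hwc : ∀ a k, Continuous fun s => tutteWeight n N s a k := fun a k => by
    unfold tutteWeight; fun_prop
  have hw0 := fun s => tutteWeight_nonneg (n := n) (N := N) s
  have hw1 := fun s => sum_tutteWeight (n := n) (N := N) s
  obtain ⟨g₁, c1, z1, r1⟩ := exists_dirichlet hwc habs hw0 hw1
    fun k => (hexDir (latA n) (latB n) k).1
  obtain ⟨g₂, c2, z2, r2⟩ := exists_dirichlet hwc habs hw0 hw1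
    fun k => (hexDir (latA n) (latB n) k).2
  let d : unitInterval → Tor n → Plane := fun s a => (g₁ s a, g₂ s a)
  have dc : ∀ a, Continuous fun s => d s a := fun a => (c1 a).prodMk (c2 a)
  have d0 : ∀ s, ∀ a ∈ fixedRow n, d s a = 0 := fun s a ha =>
    Prod.ext (z1 s a ha) (z2 s a ha)
  have deq : ∀ s, ∀ a ∉ fixedRow n, d s a = ∑ k, tutteWeight n N s a k •
      (hexDir (latA n) (latB n) k + d s (a + torDir n k)) := by
    intro s a ha
    refine Prod.ext ?_ ?_
    · simpa [Prod.fst_sum, d, mul_add] using r1 s a ha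
    · simpa [Prod.snd_sum, d, mul_add] using r2 s a ha
  have d1 : ∀ a, d 1 a = 0 := by
    refine (habs 1).eq_zero_plane (hw0 1) (hw1 1) (d0 1) fun a ha => ?_
    have h6 : ∀ a k, tutteWeight n N 1 a k = 1 / 6 := fun a k => by simp [tutteWeight]
    rw [deq 1 a ha]
    simp only [h6, smul_add, Finset.sum_add_distrib]
    simp only [← Finset.smul_sum, sum_hexDir, smul_zero, zero_add]
  have dequiv : ∀ s a, d s (torDeck n σ a) = ((d s a).1, σ * (d s a).2) := by
    intro s a
    let R : Plane →ₗ[ℝ] Plane := LinearMap.prodMap LinearMap.id ((σ : ℝ) • LinearMap.id)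
    have hR : ∀ z, R z = (z.1, σ * z.2) := fun z => by simp [R]
    rw [← hR, ← sub_eq_zero]
    refine (habs s).eq_zero_plane (hw0 s) (hw1 s) (g := fun a => d s (torDeck n σ a) - R (d s a))
      (fun a ha => ?_) (fun a ha => ?_) a
    · rw [d0 s a ha, d0 s _ (torDeck_mem_fixedRow hσ ha)]; simp
    · have ha' : torDeck n σ a ∉ fixedRow n := fun h => ha (by
        have := torDeck_mem_fixedRow hσ h
        rwa [torDeck_torDeck hσ] at this)
      have hwt : ∀ k, tutteWeight n N s (torDeck n σ a) (dirDeck σ k) = tutteWeight n N s a k := by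
        intro k
        simp only [tutteWeight]
        rw [relWeight_equivariant (arcRel_deck hN hσ)]
      rw [deq s a ha, deq s _ ha', ← Equiv.sum_comp (dirDeck σ), map_sum, ← Finset.sum_sub_distrib]
      refine Finset.sum_congr rfl fun k _ => ?_
      rw [hwt, map_smul, ← smul_sub, map_add, hR (hexDir _ _ _), ← hexDir_dirDeck hσ,
        torDeck_add hσ]
      congr 1
      abel
  have hnd : ∀ s, 0 < s → ∀ a k, pdet (edgeVec (latA n) (latB n) (d s) a k)
        (edgeVec (latA n) (latB n) (d s) a (k + 1)) ≠ 0 := by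
    intro s hs a k
    refine pdet_ne_zero (by omega : n ≠ 0) fun ℓ h1 h2 => ?_
    refine edgeVec_nondegenerate hn (d0 s) (fun a ha => ⟨tutteWeight n N s a,
      tutteWeight_pos hs a, ?_⟩) ℓ h1 h2
    simp only [edgeVec, smul_sub, Finset.sum_sub_distrib, ← Finset.sum_smul, hw1, one_smul,
      ← deq s a ha, sub_self]
  have hclose : ∀ᶠ s in 𝓝 (0 : unitInterval), ∀ v ∈ N 0,
      |(latPos n v).1 + (d s (torProj n v)).1| < 3 / n := by
    rw [eventually_all_finite hN.finite]
    intro v hv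
    have hc : Continuous fun s => |(latPos n v).1 + (d s (torProj n v)).1| :=
      (continuous_const.add (continuous_fst.comp (dc _))).abs
    refine hc.continuousAt.eventually_lt_const ?_
    refine (hN.abs_le hσ hn (d0 0) (deq 0) hv).trans_lt ?_
    gcongr
    norm_num
  obtain ⟨s₀, hs₀, hs₀'⟩ : ∃ s₀ : unitInterval, 0 < s₀ ∧ ∀ v ∈ N 0,
      |(latPos n v).1 + (d s₀ (torProj n v)).1| < 3 / n := by
    have h1 : (𝓝[>] (0 : unitInterval)).NeBot := nhdsGT_neBot_of_exists_gt ⟨1, zero_lt_one⟩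
    obtain ⟨s, h2, h3⟩ := ((hclose.filter_mono nhdsWithin_le_nhds).and
      (self_mem_nhdsWithin : Ioi (0 : unitInterval) ∈ 𝓝[>] 0)).exists
    exact ⟨s, h3, h2⟩
  let p : unitInterval → unitInterval := fun t =>
    unitInterval.symm (unitInterval.symm s₀ * unitInterval.symm t)
  have pc : Continuous p := by fun_prop
  have hp0 : p 0 = s₀ := by simp [p]
  have hp1 : p 1 = 1 := by simp [p]
  have hpp : ∀ t, 0 < p t := by
    intro t
    have h1 : (unitInterval.symm s₀ * unitInterval.symm t : unitInterval) < 1 := by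
      refine lt_of_le_of_lt unitInterval.mul_le_left ?_
      rw [← unitInterval.symm_zero]
      exact unitInterval.symm_lt_symm.2 hs₀
    rw [← unitInterval.symm_one]
    exact unitInterval.symm_lt_symm.2 h1
  refine ⟨fun t => d (p t), fun a => (dc a).comp pc, fun a => by simp only [hp1, d1],
    fun s => d0 _, fun s => dequiv _, fun s a k => ?_, fun v hv => ?_⟩
  · let q : unitInterval → ℝ := fun t => pdet (edgeVec (latA n) (latB n) (d (p t)) a k)
        (edgeVec (latA n) (latB n) (d (p t)) a (k + 1))
    have hec : ∀ k, Continuous fun t => edgeVec (latA n) (latB n) (d (p t)) a k := fun k =>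
      (continuous_const.add ((dc _).comp pc)).sub ((dc _).comp pc)
    have qc : Continuous q := by
      have h1 := hec k
      have h2 := hec (k + 1)
      simp only [q, pdet]
      fun_prop
    have q1 : 0 < q 1 := by
      simp only [q, hp1, edgeVec, d1, add_zero, sub_zero, pdet_hexDir]
      positivity
    by_contra! hneg
    obtain ⟨t, ht⟩ := mem_range_of_exists_le_of_exists_ge qc ⟨s, hneg⟩ ⟨1, q1.le⟩
    exact hnd (p t) (hpp t) a k ht
  · simp only [hp0]
    exact (hs₀' v hv).le

/-- The hexagonal norm. -/
def hexNorm (u : Plane) : ℝ := max (max |u.1| |u.2|) |u.1 + u.2|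

theorem hexNorm_lt_iff {u : Plane} {r : ℝ} : hexNorm u < r ↔ |u.1| < r ∧ |u.2| < r ∧ |u.1 + u.2| <
    r := by
  simp [hexNorm, and_assoc]

theorem hexNorm_neg (u : Plane) : hexNorm (-u) = hexNorm u := by
  simp only [hexNorm, Prod.fst_neg, Prod.snd_neg, abs_neg, ← neg_add]

theorem hexNorm_add_le (u v : Plane) : hexNorm (u + v) ≤ hexNorm u + hexNorm v := by
  simp only [hexNorm, Prod.fst_add, Prod.snd_add]
  refine max_le (max_le ?_ ?_) ?_
  · exact (abs_add_le _ _).trans (add_le_add (by simp) (by simp))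
  · exact (abs_add_le _ _).trans (add_le_add (by simp) (by simp))
  · rw [add_add_add_comm]
    exact (abs_add_le _ _).trans (add_le_add (by simp) (by simp))

theorem hexNorm_le (u : Plane) : hexNorm u ≤ 2 * ‖u‖ := by
  have h1 : |u.1| ≤ ‖u‖ := norm_fst_le u
  have h2 : |u.2| ≤ ‖u‖ := norm_snd_le u
  have h3 := norm_nonneg u
  exact max_le (max_le (by linarith) (by linarith)) ((abs_add_le _ _).trans (by linarith))

/-- The hexagonal tent function. -/
def hexHat (u : Plane) : ℝ := max 0 (1 - hexNorm u)

theorem continuous_hexNorm : Continuous hexNorm := by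
  unfold hexNorm; fun_prop

theorem continuous_hexHat : Continuous hexHat :=
  continuous_const.max (continuous_const.sub continuous_hexNorm)

theorem hexHat_nonneg (u : Plane) : 0 ≤ hexHat u := le_max_left _ _

theorem hexHat_ne_zero {u : Plane} : hexHat u ≠ 0 ↔ hexNorm u < 1 := by
  simp only [hexHat, ne_eq, max_eq_left_iff, sub_nonpos, not_le]

theorem hexHat_neg (u : Plane) : hexHat (-u) = hexHat u := by simp only [hexHat, hexNorm_neg]

theorem abs_hexHat_sub_le (u v : Plane) : |hexHat u - hexHat v| ≤ 2 * ‖u - v‖ := by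
  have h1 : hexNorm u ≤ hexNorm (u - v) + hexNorm v := by simpa using hexNorm_add_le (u - v) v
  have h2 : hexNorm v ≤ hexNorm (u - v) + hexNorm u := by
    have := hexNorm_add_le (-(u - v)) u
    rw [hexNorm_neg] at this
    simpa using this
  have h3 := hexNorm_le (u - v)
  have := abs_max_sub_max_le_abs (1 - hexNorm u) (1 - hexNorm v) 0
  rw [max_comm, max_comm _ (0 : ℝ)] at this
  refine this.trans ?_
  rw [abs_le]
  constructor <;> linarith

/-- The inclusion of the integer lattice in the coordinate plane. -/
def latCast (v : ℤ × ℤ) : Plane := (v.1, v.2)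

theorem latCast_add (v w : ℤ × ℤ) : latCast (v + w) = latCast v + latCast w := by
  simp [latCast]

theorem latCast_neg (v : ℤ × ℤ) : latCast (-v) = -latCast v := by
  simp [latCast]

/-- The hexagonal tent interpolation of a function on the integer lattice. -/
def hexInterp (f : ℤ × ℤ → Plane) (c : Plane) : Plane := ∑ᶠ v, hexHat (c - latCast v) • f v

theorem hexInterp_neg (f : ℤ × ℤ → Plane) (c : Plane) :
    hexInterp f (-c) = hexInterp (fun v => f (-v)) c := by
  unfold hexInterp
  rw [← finsum_comp_equiv (Equiv.neg (ℤ × ℤ))]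
  congr 1
  funext v
  rw [Equiv.neg_apply, latCast_neg, ← hexHat_neg]
  congr 2
  abel

theorem hexInterp_eq_sum {f : ℤ × ℤ → Plane} {c : Plane} {s : Finset (ℤ × ℤ)}
    (hs : ∀ v, hexHat (c - latCast v) ≠ 0 → v ∈ s) :
    hexInterp f c = ∑ v ∈ s, hexHat (c - latCast v) • f v :=
  finsum_eq_sum_of_support_subset _ fun v hv => hs v fun h => hv (by simp [h])

/-- The three vertices of an upward triangle. -/
def upTri (v : ℤ × ℤ) : Finset (ℤ × ℤ) := {v, v + (1, 0), v + (0, 1)}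

theorem mem_upTri {v w : ℤ × ℤ} {x y : ℝ} (hx : 0 ≤ x) (hy : 0 ≤ y) (hxy : x + y ≤ 1)
    (h : hexHat (latCast v + (x, y) - latCast w) ≠ 0) : w ∈ upTri v := by
  rw [hexHat_ne_zero, hexNorm_lt_iff] at h
  obtain ⟨h1, h2, h3⟩ := h
  simp only [latCast, Prod.fst_sub, Prod.fst_add, Prod.snd_sub, Prod.snd_add, abs_lt] at h1 h2 h3
  have a1 : v.1 - 1 < w.1 := by have : ((v.1 - 1 : ℤ) : ℝ) < w.1 := by push_cast; linarith
                                exact_mod_cast this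
  have a2 : w.1 < v.1 + 2 := by have : (w.1 : ℝ) < ((v.1 + 2 : ℤ) : ℝ) := by push_cast; linarith
                                exact_mod_cast this
  have b1 : v.2 - 1 < w.2 := by have : ((v.2 - 1 : ℤ) : ℝ) < w.2 := by push_cast; linarith
                                exact_mod_cast this
  have b2 : w.2 < v.2 + 2 := by have : (w.2 : ℝ) < ((v.2 + 2 : ℤ) : ℝ) := by push_cast; linarith
                                exact_mod_cast this
  have c2 : w.1 + w.2 < v.1 + v.2 + 2 := by
    have : ((w.1 + w.2 : ℤ) : ℝ) < ((v.1 + v.2 + 2 : ℤ) : ℝ) := by push_cast; linarith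
    exact_mod_cast this
  simp only [upTri, Finset.mem_insert, Finset.mem_singleton, Prod.ext_iff, Prod.fst_add,
    Prod.snd_add]
  omega

theorem hexInterp_up (f : ℤ × ℤ → Plane) (v : ℤ × ℤ) {x y : ℝ} (hx : 0 ≤ x) (hy : 0 ≤ y)
    (hxy : x + y ≤ 1) : hexInterp f (latCast v + (x, y)) =
      (1 - x - y) • f v + x • f (v + (1, 0)) + y • f (v + (0, 1)) := by
  rw [hexInterp_eq_sum fun w => mem_upTri hx hy hxy, upTri, Finset.sum_insert, Finset.sum_pair]
  · have e1 : hexHat (latCast v + (x, y) - latCast v) = 1 - x - y := by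
      simp only [add_sub_cancel_left, hexHat, hexNorm]
      rw [abs_of_nonneg hx, abs_of_nonneg hy, abs_of_nonneg (add_nonneg hx hy),
        max_eq_right (a := max x y) (max_le (by linarith) (by linarith)), max_eq_right]
      · ring
      · linarith
    have e2 : hexHat (latCast v + (x, y) - latCast (v + (1, 0))) = x := by
      have : latCast v + (x, y) - latCast (v + (1, 0)) = (x - 1, y) := by
        rw [latCast_add, add_sub_add_left_eq_sub]; simp [latCast]
      rw [this]
      simp only [hexHat, hexNorm]
      rw [abs_of_nonpos (by linarith : x - 1 ≤ 0), abs_of_nonneg hy,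
        abs_of_nonpos (by linarith : x - 1 + y ≤ 0), max_eq_left (b := y) (by linarith),
        max_eq_left (b := -(x - 1 + y)) (by linarith), max_eq_right]
      all_goals linarith
    have e3 : hexHat (latCast v + (x, y) - latCast (v + (0, 1))) = y := by
      have : latCast v + (x, y) - latCast (v + (0, 1)) = (x, y - 1) := by
        rw [latCast_add, add_sub_add_left_eq_sub]; simp [latCast]
      rw [this]
      simp only [hexHat, hexNorm]
      rw [abs_of_nonneg hx, abs_of_nonpos (by linarith : y - 1 ≤ 0),
        abs_of_nonpos (by linarith : x + (y - 1) ≤ 0), max_eq_right (a := x) (by linarith),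
        max_eq_left (b := -(x + (y - 1))) (by linarith), max_eq_right]
      all_goals linarith
    rw [e1, e2, e3, add_assoc]
  · simp
  · simp

theorem hexInterp_down (f : ℤ × ℤ → Plane) (v : ℤ × ℤ) {x y : ℝ} (hx : 0 ≤ x) (hy : 0 ≤ y)
    (hxy : x + y ≤ 1) : hexInterp f (latCast v - (x, y)) =
      (1 - x - y) • f v + x • f (v - (1, 0)) + y • f (v - (0, 1)) := by
  have := hexInterp_neg f (latCast (-v) + (x, y))
  rw [hexInterp_up _ _ hx hy hxy, latCast_neg] at this
  rw [show latCast v - (x, y) = -(-latCast v + (x, y)) by abel, this, neg_neg]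
  congr 3 <;> congr 1 <;> abel

/-- Every point of the plane lies in an upward or a downward triangle. -/
theorem exists_triangle (c : Plane) : ∃ v : ℤ × ℤ, ∃ x y : ℝ, 0 ≤ x ∧ 0 ≤ y ∧ x + y ≤ 1 ∧
    (c = latCast v + (x, y) ∨ c = latCast v - (x, y)) := by
  by_cases h : Int.fract c.1 + Int.fract c.2 ≤ 1
  · refine ⟨(⌊c.1⌋, ⌊c.2⌋), Int.fract c.1, Int.fract c.2, Int.fract_nonneg _, Int.fract_nonneg _, h,
      Or.inl ?_⟩
    ext <;> simp [latCast]
  · have h1 := Int.fract_lt_one c.1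
    have h2 := Int.fract_lt_one c.2
    refine ⟨(⌊c.1⌋ + 1, ⌊c.2⌋ + 1), 1 - Int.fract c.1, 1 - Int.fract c.2, by linarith, by linarith,
      by linarith, Or.inr ?_⟩
    ext <;> simp only [latCast, Prod.fst_sub, Prod.snd_sub, Int.cast_add, Int.cast_one] <;>
      linarith [Int.self_sub_floor c.1, Int.self_sub_floor c.2]

theorem exists_hexHat_support (c : Plane) : ∃ s : Finset (ℤ × ℤ), s.card ≤ 3 ∧
    ∀ v, hexHat (c - latCast v) ≠ 0 → v ∈ s := by
  obtain ⟨v, x, y, hx, hy, hxy, rfl | rfl⟩ := exists_triangle c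
  · exact ⟨upTri v, Finset.card_le_three, fun w => mem_upTri hx hy hxy⟩
  · refine ⟨(upTri (-v)).image Neg.neg, Finset.card_image_le.trans Finset.card_le_three,
      fun w hw => ?_⟩
    rw [Finset.mem_image]
    refine ⟨-w, mem_upTri hx hy hxy ?_, neg_neg w⟩
    rw [← hexHat_neg] at hw
    convert hw using 2
    simp only [latCast_neg]
    abel

theorem sum_hexHat {c : Plane} {s : Finset (ℤ × ℤ)}
    (hs : ∀ v, hexHat (c - latCast v) ≠ 0 → v ∈ s) : ∑ v ∈ s, hexHat (c - latCast v) = 1 := by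
  have h : hexInterp (fun _ => (1, 0)) c = (1, 0) := by
    obtain ⟨v, x, y, hx, hy, hxy, rfl | rfl⟩ := exists_triangle c
    · rw [hexInterp_up _ _ hx hy hxy]; ext <;> simp; ring
    · rw [hexInterp_down _ _ hx hy hxy]; ext <;> simp; ring
  rw [hexInterp_eq_sum hs] at h
  simpa [Prod.fst_sum] using congrArg Prod.fst h

theorem hexInterp_latCast (c : Plane) : hexInterp latCast c = c := by
  obtain ⟨v, x, y, hx, hy, hxy, rfl | rfl⟩ := exists_triangle c
  · rw [hexInterp_up _ _ hx hy hxy]; ext <;> simp [latCast] <;> ring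
  · rw [hexInterp_down _ _ hx hy hxy]; ext <;> simp [latCast] <;> ring

theorem norm_hexInterp_le {f : ℤ × ℤ → Plane} {C : ℝ} (hf : ∀ v, ‖f v‖ ≤ C) (c : Plane) :
    ‖hexInterp f c‖ ≤ C := by
  obtain ⟨s, -, hs⟩ := exists_hexHat_support c
  rw [hexInterp_eq_sum hs]
  refine (norm_sum_le _ _).trans ?_
  calc ∑ v ∈ s, ‖hexHat (c - latCast v) • f v‖ ≤ ∑ v ∈ s, hexHat (c - latCast v) * C := by
        refine Finset.sum_le_sum fun v _ => ?_
        rw [norm_smul, Real.norm_of_nonneg (hexHat_nonneg _)]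
        exact mul_le_mul_of_nonneg_left (hf v) (hexHat_nonneg _)
    _ = C := by rw [← Finset.sum_mul, sum_hexHat hs, one_mul]

theorem norm_hexInterp_sub_le {f : ℤ × ℤ → Plane} {C : ℝ} (hf : ∀ v, ‖f v‖ ≤ C) (c c' : Plane) :
    ‖hexInterp f c - hexInterp f c'‖ ≤ 12 * C * ‖c - c'‖ := by
  classical
  obtain ⟨s, hs3, hs⟩ := exists_hexHat_support c
  obtain ⟨s', hs3', hs'⟩ := exists_hexHat_support c'
  have hC : 0 ≤ C := (norm_nonneg _).trans (hf 0)
  rw [hexInterp_eq_sum (s := s ∪ s') fun v hv => Finset.mem_union_left _ (hs v hv),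
    hexInterp_eq_sum (s := s ∪ s') fun v hv => Finset.mem_union_right _ (hs' v hv),
    ← Finset.sum_sub_distrib]
  have hterm : ∀ v ∈ s ∪ s', ‖hexHat (c - latCast v) • f v - hexHat (c' - latCast v) • f v‖ ≤
      2 * ‖c - c'‖ * C := by
    intro v _
    rw [← sub_smul, norm_smul]
    refine mul_le_mul ?_ (hf v) (norm_nonneg _) (by positivity)
    simpa using abs_hexHat_sub_le (c - latCast v) (c' - latCast v)
  refine (norm_sum_le_of_le _ hterm).trans ?_
  rw [Finset.sum_const, nsmul_eq_mul]
  have : ((s ∪ s').card : ℝ) ≤ 6 := by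
    exact_mod_cast (Finset.card_union_le _ _).trans (by omega)
  have h2 : 0 ≤ 2 * ‖c - c'‖ * C := by positivity
  nlinarith

theorem continuous_hexInterp {Y : Type*} [TopologicalSpace Y] {f : Y → ℤ × ℤ → Plane}
    (hf : ∀ v, Continuous fun s => f s v) :
    Continuous fun p : Y × Plane => hexInterp (f p.1) p.2 := by
  unfold hexInterp
  refine continuous_finsum (fun v => ?_) ?_
  · exact (continuous_hexHat.comp (continuous_snd.sub continuous_const)).smul
      ((hf v).comp continuous_fst)
  · rintro ⟨s, c⟩
    refine ⟨univ ×ˢ Metric.ball c 1, prod_mem_nhds univ_mem (Metric.ball_mem_nhds _ one_pos), ?_⟩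
    refine ((Set.finite_Icc (⌊c.1⌋ - 2) (⌊c.1⌋ + 3)).prod
      (Set.finite_Icc (⌊c.2⌋ - 2) (⌊c.2⌋ + 3))).subset ?_
    rintro v ⟨⟨s', c'⟩, h1, -, h2⟩
    have h3 : hexHat (c' - latCast v) ≠ 0 := fun h => h1 (by simp [h])
    rw [hexHat_ne_zero, hexNorm_lt_iff] at h3
    obtain ⟨h4, h5, -⟩ := h3
    simp only [latCast, Prod.fst_sub, Prod.snd_sub, abs_lt] at h4 h5
    rw [mem_ball_iff_norm] at h2
    have h6 : |c'.1 - c.1| < 1 := (norm_fst_le (c' - c)).trans_lt h2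
    have h7 : |c'.2 - c.2| < 1 := (norm_snd_le (c' - c)).trans_lt h2
    rw [abs_lt] at h6 h7
    have f1 := Int.floor_le c.1
    have f2 := Int.lt_floor_add_one c.1
    have f3 := Int.floor_le c.2
    have f4 := Int.lt_floor_add_one c.2
    refine ⟨⟨?_, ?_⟩, ?_, ?_⟩
    all_goals
      rw [← Int.cast_le (R := ℝ)]
      push_cast
      linarith

/-- The coordinates of a point with respect to the lattice basis. -/
def latCoord (n : ℕ) (z : Plane) : Plane := (n * z.1 - n * z.2 / 2, n * z.2)

theorem continuous_latCoord (n : ℕ) : Continuous (latCoord n) := by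
  unfold latCoord; fun_prop

theorem eq_of_latCoord_eq {n : ℕ} (hn : n ≠ 0) {z c : Plane} (h : latCoord n z = c) :
    z = c.1 • latA n + c.2 • latB n := by
  have : (n : ℝ) ≠ 0 := by exact_mod_cast hn
  subst h
  ext <;> simp [latCoord, latA, latB] <;> field_simp
  ring

theorem latPos_eq (n : ℕ) (v : ℤ × ℤ) : latPos n v = (latCast v).1 • latA n +
    (latCast v).2 • latB n := by
  ext <;> simp [latPos, latCast, latA, latB] <;> ring

theorem norm_latCoord_sub_le (n : ℕ) (z z' : Plane) :
    ‖latCoord n z - latCoord n z'‖ ≤ 2 * n * ‖z - z'‖ := by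
  have h1 : |z.1 - z'.1| ≤ ‖z - z'‖ := norm_fst_le (z - z')
  have h2 : |z.2 - z'.2| ≤ ‖z - z'‖ := norm_snd_le (z - z')
  have hn : (0 : ℝ) ≤ n := n.cast_nonneg
  have a1 := mul_le_mul_of_nonneg_left h1 hn
  have a2 := mul_le_mul_of_nonneg_left h2 hn
  rw [← abs_of_nonneg hn, ← abs_mul, abs_of_nonneg hn, _root_.abs_le] at a1 a2
  have := norm_nonneg (z - z')
  have b : 0 ≤ n * ‖z - z'‖ := by positivity
  rw [Prod.norm_def, max_le_iff, Real.norm_eq_abs, Real.norm_eq_abs, _root_.abs_le, _root_.abs_le]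
  simp only [latCoord, Prod.fst_sub, Prod.snd_sub]
  refine ⟨⟨?_, ?_⟩, ?_, ?_⟩ <;> linarith

/-- The piecewise linear map displacing every lattice vertex by `δ`. -/
def plMap (n : ℕ) (δ : Tor n → Plane) (z : Plane) : Plane :=
  z + hexInterp (fun v => δ (torProj n v)) (latCoord n z)

theorem plMap_up {n : ℕ} (hn : n ≠ 0) (δ : Tor n → Plane) {z : Plane} {v : ℤ × ℤ} {x y : ℝ}
    (hx : 0 ≤ x) (hy : 0 ≤ y) (hxy : x + y ≤ 1) (h : latCoord n z = latCast v + (x, y)) :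
    plMap n δ z = latPos n v + δ (torProj n v) +
      (x • edgeVec (latA n) (latB n) δ (torProj n v) 0 +
        y • edgeVec (latA n) (latB n) δ (torProj n v) 1) := by
  rw [plMap, h, hexInterp_up _ _ hx hy hxy, latPos_eq, eq_of_latCoord_eq hn h]
  have e0 : torProj n (v + (1, 0)) = torProj n v +
    torDir n 0 := by rw [map_add]; simp [torDir, hexDir]
  have e1 : torProj n (v + (0, 1)) = torProj n v +
    torDir n 1 := by rw [map_add]; simp [torDir, hexDir]
  have h0 : hexDir (latA n) (latB n) 0 = latA n := rfl
  have h1 : hexDir (latA n) (latB n) 1 = latB n := rfl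
  rw [e0, e1]
  simp only [edgeVec, h0, h1, Prod.fst_add, Prod.snd_add]
  module

theorem plMap_down {n : ℕ} (hn : n ≠ 0) (δ : Tor n → Plane) {z : Plane} {v : ℤ × ℤ} {x y : ℝ}
    (hx : 0 ≤ x) (hy : 0 ≤ y) (hxy : x + y ≤ 1) (h : latCoord n z = latCast v - (x, y)) :
    plMap n δ z = latPos n v + δ (torProj n v) +
      (x • edgeVec (latA n) (latB n) δ (torProj n v) 3 +
        y • edgeVec (latA n) (latB n) δ (torProj n v) 4) := by
  rw [plMap, h, hexInterp_down _ _ hx hy hxy, latPos_eq, eq_of_latCoord_eq hn h]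
  have e0 : torProj n (v - (1, 0)) = torProj n v +
    torDir n 3 := by rw [map_sub]; simp [torDir, hexDir, sub_eq_add_neg]
  have e1 : torProj n (v - (0, 1)) = torProj n v +
    torDir n 4 := by rw [map_sub]; simp [torDir, hexDir, sub_eq_add_neg]
  have h0 : hexDir (latA n) (latB n) 3 = -latA n := rfl
  have h1 : hexDir (latA n) (latB n) 4 = -latB n := rfl
  rw [e0, e1]
  simp only [edgeVec, h0, h1, Prod.fst_sub, Prod.snd_sub]
  module

theorem abs_pdet_le (u v : Plane) : |pdet u v| ≤ 2 * ‖u‖ * ‖v‖ := by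
  have h1 : |u.1| ≤ ‖u‖ := norm_fst_le u
  have h2 : |u.2| ≤ ‖u‖ := norm_snd_le u
  have h3 : |v.1| ≤ ‖v‖ := norm_fst_le v
  have h4 : |v.2| ≤ ‖v‖ := norm_snd_le v
  rw [pdet]
  refine (abs_sub _ _).trans ?_
  rw [abs_mul, abs_mul]
  nlinarith [abs_nonneg u.1, abs_nonneg u.2, abs_nonneg v.1, abs_nonneg v.2]

theorem cramer_bound {E E' : Plane} {d C x y : ℝ} (hd : 0 < d) (hdet : d ≤ pdet E E')
    (hE : ‖E‖ ≤ C) (hE' : ‖E'‖ ≤ C) : |x| ≤ 2 * C / d * ‖x • E + y • E'‖ ∧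
      |y| ≤ 2 * C / d * ‖x • E + y • E'‖ := by
  set w := x • E + y • E' with hw
  have e1 : pdet w E' = x * pdet E E' := by simp [hw, pdet]; ring
  have e2 : pdet E w = y * pdet E E' := by simp [hw, pdet]; ring
  have h1 := abs_pdet_le w E'
  have h2 := abs_pdet_le E w
  rw [e1, abs_mul, abs_of_pos (hd.trans_le hdet)] at h1
  rw [e2, abs_mul, abs_of_pos (hd.trans_le hdet)] at h2
  have hw0 := norm_nonneg w
  constructor
  · rw [div_mul_eq_mul_div, le_div_iff₀ hd]
    calc |x| * d ≤ |x| * pdet E E' := mul_le_mul_of_nonneg_left hdet (abs_nonneg _)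
      _ ≤ 2 * ‖w‖ * ‖E'‖ := h1
      _ ≤ 2 * ‖w‖ * C := by gcongr
      _ = _ := by ring
  · rw [div_mul_eq_mul_div, le_div_iff₀ hd]
    calc |y| * d ≤ |y| * pdet E E' := mul_le_mul_of_nonneg_left hdet (abs_nonneg _)
      _ ≤ 2 * ‖E‖ * ‖w‖ := h2
      _ ≤ 2 * C * ‖w‖ := by gcongr

theorem norm_latA_le (n : ℕ) : ‖latA n‖ ≤ 1 := by
  rw [Prod.norm_def, max_le_iff]
  simp only [latA, Real.norm_eq_abs, abs_zero, zero_le_one, and_true]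
  rw [abs_of_nonneg (by positivity)]
  rcases n.eq_zero_or_pos with rfl | h
  · simp
  · have : (1 : ℝ) ≤ n := by exact_mod_cast h
    exact (div_le_one (by linarith)).2 this

theorem norm_latB_le (n : ℕ) : ‖latB n‖ ≤ 1 := by
  rw [Prod.norm_def, max_le_iff]
  simp only [latB, Real.norm_eq_abs]
  rw [abs_of_nonneg (by positivity), abs_of_nonneg (by positivity)]
  rcases n.eq_zero_or_pos with rfl | h
  · simp
  · have : (1 : ℝ) ≤ n := by exact_mod_cast h
    exact ⟨(div_le_one (by linarith)).2 (by linarith), (div_le_one (by linarith)).2 this⟩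

/-- A closed lattice triangle, pointing upwards or downwards. -/
def latTri (n : ℕ) (i : (ℤ × ℤ) × Bool) : Set Plane :=
  {z | if i.2 then (latCast i.1).1 ≤ (latCoord n z).1 ∧ (latCast i.1).2 ≤ (latCoord n z).2 ∧
      (latCoord n z).1 + (latCoord n z).2 ≤ (latCast i.1).1 + (latCast i.1).2 + 1
    else (latCoord n z).1 ≤ (latCast i.1).1 ∧ (latCoord n z).2 ≤ (latCast i.1).2 ∧
      (latCast i.1).1 + (latCast i.1).2 - 1 ≤ (latCoord n z).1 + (latCoord n z).2}

theorem isClosed_latTri (n : ℕ) (i : (ℤ × ℤ) × Bool) : IsClosed (latTri n i) := by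
  have h1 : Continuous fun z => (latCoord n z).1 := continuous_fst.comp (continuous_latCoord n)
  have h2 : Continuous fun z => (latCoord n z).2 := continuous_snd.comp (continuous_latCoord n)
  rcases i with ⟨v, _ | _⟩
  · simp only [latTri, Bool.false_eq_true, if_false]
    exact (isClosed_le h1 continuous_const).inter ((isClosed_le h2 continuous_const).inter
      (isClosed_le continuous_const (h1.add h2)))
  · simp only [latTri, if_true]
    exact (isClosed_le continuous_const h1).inter ((isClosed_le continuous_const h2).inter
      (isClosed_le (h1.add h2) continuous_const))

theorem exists_mem_latTri (n : ℕ) (z : Plane) : ∃ i, z ∈ latTri n i := by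
  obtain ⟨v, x, y, hx, hy, hxy, h | h⟩ := exists_triangle (latCoord n z)
  · refine ⟨(v, true), ?_⟩
    simp only [latTri, mem_ofPred_eq, h, if_true, Prod.fst_add, Prod.snd_add]
    refine ⟨?_, ?_, ?_⟩ <;> linarith
  · refine ⟨(v, false), ?_⟩
    simp only [latTri, mem_ofPred_eq, h, Bool.false_eq_true, if_false, Prod.fst_sub, Prod.snd_sub]
    refine ⟨?_, ?_, ?_⟩ <;> linarith

theorem locallyFinite_latTri (n : ℕ) : LocallyFinite (latTri n) := by
  intro z
  set c := latCoord n z with hc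
  refine ⟨latCoord n ⁻¹' Metric.ball c 1,
    (continuous_latCoord n).continuousAt.preimage_mem_nhds (Metric.ball_mem_nhds _ one_pos), ?_⟩
  refine (((Set.finite_Icc (⌊c.1⌋ - 3) (⌊c.1⌋ + 4)).prod
      (Set.finite_Icc (⌊c.2⌋ - 3) (⌊c.2⌋ + 4))).prod (Set.finite_univ (α := Bool))).subset ?_
  rintro ⟨v, b⟩ ⟨z', h1, h2⟩
  rw [mem_preimage, mem_ball_iff_norm] at h2
  set c' := latCoord n z'
  have h6 : |c'.1 - c.1| < 1 := (norm_fst_le (c' - c)).trans_lt h2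
  have h7 : |c'.2 - c.2| < 1 := (norm_snd_le (c' - c)).trans_lt h2
  rw [abs_lt] at h6 h7
  have f1 := Int.floor_le c.1
  have f2 := Int.lt_floor_add_one c.1
  have f3 := Int.floor_le c.2
  have f4 := Int.lt_floor_add_one c.2
  rcases b with _ | _
  · simp only [latTri, mem_ofPred_eq, Bool.false_eq_true, if_false, latCast] at h1
    obtain ⟨a1, a2, a3⟩ := h1
    refine ⟨⟨⟨?_, ?_⟩, ?_, ?_⟩, mem_univ _⟩
    all_goals
      rw [← Int.cast_le (R := ℝ)]
      push_cast
      linarith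
  · simp only [latTri, mem_ofPred_eq, if_true, latCast] at h1
    obtain ⟨a1, a2, a3⟩ := h1
    refine ⟨⟨⟨?_, ?_⟩, ?_, ?_⟩, mem_univ _⟩
    all_goals
      rw [← Int.cast_le (R := ℝ)]
      push_cast
      linarith

theorem plMap_expands {n : ℕ} (hn : n ≠ 0) {δ : Tor n → Plane} {d C : ℝ} (hd : 0 < d)
    (hdet : ∀ a k, d ≤ pdet (edgeVec (latA n) (latB n) δ a k)
      (edgeVec (latA n) (latB n) δ a (k + 1)))
    (hC : ∀ a k, ‖edgeVec (latA n) (latB n) δ a k‖ ≤ C) {i : (ℤ × ℤ) × Bool} {z z' : Plane}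
    (hz : z ∈ latTri n i) (hz' : z' ∈ latTri n i) :
    ‖z - z'‖ ≤ 4 * C / d * ‖plMap n δ z - plMap n δ z'‖ := by
  obtain ⟨v, b⟩ := i
  have key : ∀ (x y : ℝ) (k : Fin 6),
      z - z' = x • latA n + y • latB n ∨ z - z' = -(x • latA n + y • latB n) →
      plMap n δ z - plMap n δ z' = x • edgeVec (latA n) (latB n) δ (torProj n v) k +
        y • edgeVec (latA n) (latB n) δ (torProj n v) (k + 1) →
      ‖z - z'‖ ≤ 4 * C / d * ‖plMap n δ z - plMap n δ z'‖ := by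
    intro x y k h1 h2
    have h3 : ‖z - z'‖ ≤ |x| + |y| := by
      have : ‖z - z'‖ = ‖x • latA n + y • latB n‖ := by
        rcases h1 with h1 | h1 <;> rw [h1]
        exact norm_neg _
      rw [this]
      refine (norm_add_le _ _).trans ?_
      rw [norm_smul, norm_smul, Real.norm_eq_abs, Real.norm_eq_abs]
      exact add_le_add (mul_le_of_le_one_right (abs_nonneg _) (norm_latA_le n))
        (mul_le_of_le_one_right (abs_nonneg _) (norm_latB_le n))
    obtain ⟨h4, h5⟩ := cramer_bound (x := x) (y := y) hd (hdet (torProj n v) k) (hC _ _) (hC _ _)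
    rw [h2]
    refine h3.trans ((add_le_add h4 h5).trans_eq ?_)
    ring
  have hz0 := eq_of_latCoord_eq hn (c := latCoord n z) rfl
  have hz0' := eq_of_latCoord_eq hn (c := latCoord n z') rfl
  rcases b with _ | _
  · simp only [latTri, mem_ofPred_eq, Bool.false_eq_true, if_false] at hz hz'
    refine key ((latCoord n z').1 - (latCoord n z).1) ((latCoord n z').2 - (latCoord n z).2) 3
      (Or.inr ?_) ?_
    · nth_rw 1 [hz0, hz0']
      module
    · rw [plMap_down hn δ (v := v) (x := (latCast v).1 - (latCoord n z).1)
        (y := (latCast v).2 - (latCoord n z).2) (by linarith) (by linarith) (by linarith)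
        (by ext <;> simp), plMap_down hn δ (z := z') (v := v)
          (x := (latCast v).1 - (latCoord n z').1)
        (y := (latCast v).2 - (latCoord n z').2) (by linarith) (by linarith) (by linarith)
        (by ext <;> simp)]
      have : (3 : Fin 6) + 1 = 4 := rfl
      rw [this]
      module
  · simp only [latTri, mem_ofPred_eq, if_true] at hz hz'
    refine key ((latCoord n z).1 - (latCoord n z').1) ((latCoord n z).2 - (latCoord n z').2) 0
      (Or.inl ?_) ?_
    · nth_rw 1 [hz0, hz0']
      module
    · rw [plMap_up hn δ (v := v) (x := (latCoord n z).1 - (latCast v).1)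
        (y := (latCoord n z).2 - (latCast v).2) (by linarith) (by linarith) (by linarith)
        (by ext <;> simp), plMap_up hn δ (z := z') (v := v) (x := (latCoord n z').1 - (latCast v).1)
        (y := (latCoord n z').2 - (latCast v).2) (by linarith) (by linarith) (by linarith)
        (by ext <;> simp)]
      have : (0 : Fin 6) + 1 = 1 := rfl
      rw [this]
      module

/-- A path which is Lipschitz on each piece of a locally finite closed cover is Lipschitz. -/
theorem norm_sub_le_of_closed_cover {ι : Type*} {E : Type*} [NormedAddCommGroup E] {S : ι → Set E}
    (hS : ∀ i, IsClosed (S i)) (hlf : LocallyFinite S) (hcov : ∀ z, ∃ i, z ∈ S i) {h : ℝ → E}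
    (hh : Continuous h) {K : ℝ}
    (hK : ∀ i t t', h t ∈ S i → h t' ∈ S i → ‖h t - h t'‖ ≤ K * |t - t'|) :
    ‖h 1 - h 0‖ ≤ K := by
  have : Icc (0 : ℝ) 1 ⊆ {t | ‖h t - h 0‖ ≤ K * t} := by
    refine IsClosed.Icc_subset_of_forall_exists_gt ?_ (by simp) ?_
    · exact (isClosed_le (hh.sub continuous_const).norm (continuous_const.mul continuous_id)).inter
        isClosed_Icc
    · rintro t ⟨ht, ht0, ht1⟩ t₁ ht₁
      obtain ⟨V, hV, hfin⟩ := hlf (h t)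
      have hev : ∀ᶠ t' in 𝓝[>] t, h t' ∈ V :=
        nhdsWithin_le_nhds (hh.continuousAt.preimage_mem_nhds hV)
      have hex : ∃ i, ∃ᶠ t' in 𝓝[>] t, h t' ∈ S i := by
        by_contra! hcon
        have := (eventually_all_finite hfin).2 fun i _ => hcon i
        obtain ⟨t', h1, h2⟩ := (hev.and this).exists
        obtain ⟨i, hi⟩ := hcov (h t')
        exact h2 i ⟨h t', hi, h1⟩ hi
      obtain ⟨i, hi⟩ := hex
      have hti : h t ∈ S i := by
        have h1 : Tendsto h (𝓝[>] t) (𝓝 (h t)) := hh.continuousAt.mono_left nhdsWithin_le_nhds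
        exact (hS i).mem_of_frequently_of_tendsto hi h1
      obtain ⟨t', h1, h2⟩ := (hi.and_eventually (Ioc_mem_nhdsGT ht₁)).exists
      refine ⟨t', ?_, h2⟩
      have h3 := hK i t' t h1 hti
      rw [abs_of_pos (sub_pos.2 h2.1)] at h3
      have h4 := norm_sub_le_norm_sub_add_norm_sub (h t') (h t) (h 0)
      have ht : ‖h t - h 0‖ ≤ K * t := ht
      show ‖h t' - h 0‖ ≤ K * t'
      linarith
  simpa using this (right_mem_Icc.2 zero_le_one)

theorem bijective_add_of_lipschitz {E : Type*} [NormedAddCommGroup E] [CompleteSpace E]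
    {f g D : E → E} {K ε : ℝ} (hgf : ∀ z, g (f z) = z) (hfg : ∀ z, f (g z) = z)
    (hg : ∀ z z', ‖g z - g z'‖ ≤ K * ‖z - z'‖) (hD : ∀ z z', ‖D z - D z'‖ ≤ ε * ‖z - z'‖)
    (hε : 0 ≤ ε) (hK : 0 ≤ K) (h : ε * K < 1) : (fun z => f z + D z).Bijective := by
  have hc : ∀ w, ContractingWith ⟨ε * K, mul_nonneg hε hK⟩ fun z => w - D (g z) := by
    intro w
    refine ⟨by exact_mod_cast h, LipschitzWith.of_dist_le_mul fun z z' => ?_⟩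
    rw [dist_eq_norm, dist_eq_norm, sub_sub_sub_cancel_left]
    calc ‖D (g z') - D (g z)‖ ≤ ε * ‖g z' - g z‖ := hD _ _
      _ ≤ ε * (K * ‖z' - z‖) := by gcongr; exact hg _ _
      _ = _ := by rw [norm_sub_rev, ← mul_assoc]; rfl
  constructor
  · intro z z' hzz
    have h1 : ∀ x, f z + D z = f x + D x → Function.IsFixedPt (fun y => (f z + D z) - D (g y))
      (f x) := by
      intro x hx
      simp [Function.IsFixedPt, hgf, hx]
    have := (hc (f z + D z)).fixedPoint_unique' (h1 z rfl) (h1 z' hzz)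
    rw [← hgf z, this, hgf]
  · intro w
    have h1 := (hc w).fixedPoint_isFixedPt
    refine ⟨g ((hc w).fixedPoint), ?_⟩
    simp only [hfg]
    nth_rw 1 [← h1]
    simp

theorem norm_plMap_sub_le {n : ℕ} {δ : Tor n → Plane} {C : ℝ} (hC : ∀ a, ‖δ a‖ ≤ C) (z : Plane) :
    ‖plMap n δ z - z‖ ≤ C := by
  simpa [plMap] using norm_hexInterp_le (fun v => hC (torProj n v)) (latCoord n z)

theorem continuous_plMap {Y : Type*} [TopologicalSpace Y] {n : ℕ} {δ : Y → Tor n → Plane}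
    (hδ : ∀ a, Continuous fun s => δ s a) : Continuous fun p : Y × Plane => plMap n (δ p.1) p.2 :=
      by
  refine continuous_snd.add ?_
  exact (continuous_hexInterp (f := fun s v => δ s (torProj n v)) fun v => hδ _).comp
    (continuous_fst.prodMk ((continuous_latCoord n).comp continuous_snd))

theorem plMap_sub {n : ℕ} (δ δ' : Tor n → Plane) (z : Plane) :
    plMap n δ' z = plMap n δ z + hexInterp (fun v => (δ' - δ) (torProj n v)) (latCoord n z) := by
  obtain ⟨s, -, hs⟩ := exists_hexHat_support (latCoord n z)
  rw [plMap, plMap, hexInterp_eq_sum hs, hexInterp_eq_sum hs, hexInterp_eq_sum hs, add_assoc,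
    ← Finset.sum_add_distrib]
  congr 1
  refine Finset.sum_congr rfl fun v _ => ?_
  rw [Pi.sub_apply]
  module

theorem plMap_inverse_lipschitz {n : ℕ} (hn : n ≠ 0) [Finite (Tor n)] {δ : Tor n → Plane} {d C : ℝ}
    (hd : 0 < d)
    (hdet : ∀ a k, d ≤ pdet (edgeVec (latA n) (latB n) δ a k)
      (edgeVec (latA n) (latB n) δ a (k + 1)))
    (hC : ∀ a k, ‖edgeVec (latA n) (latB n) δ a k‖ ≤ C) {g : Plane → Plane}
    (hgf : ∀ z, g (plMap n δ z) = z) (hfg : ∀ z, plMap n δ (g z) = z) (z z' : Plane) :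
    ‖g z - g z'‖ ≤ 4 * C / d * ‖z - z'‖ := by
  obtain ⟨B, hB⟩ := (Set.finite_range fun a => ‖δ a‖).bddAbove
  have hB' : ∀ a, ‖δ a‖ ≤ B := fun a => hB ⟨a, rfl⟩
  have hg : Continuous g := by
    have := continuous_family_inverse (A := Unit) (F := fun p => plMap n δ p.2)
      (G := fun p => g p.2) (C := B)
    have := this ((continuous_plMap (Y := Unit) (δ := fun _ => δ) fun a => continuous_const))
      (fun _ z => norm_plMap_sub_le hB' z) (fun _ z => hgf z) (fun _ z => hfg z)
    exact this.comp (continuous_const (y := ()).prodMk continuous_id)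
  have h := norm_sub_le_of_closed_cover (isClosed_latTri n) (locallyFinite_latTri n)
    (exists_mem_latTri n) (h := fun t : ℝ => g (z' + t • (z - z'))) (by fun_prop)
    (K := 4 * C / d * ‖z - z'‖) ?_
  · simpa using h
  · intro i t t' ht ht'
    refine (plMap_expands hn hd hdet hC ht ht').trans_eq ?_
    rw [hfg, hfg, add_sub_add_left_eq_sub, ← sub_smul, norm_smul, Real.norm_eq_abs]
    ring

theorem plMap_bijective {n : ℕ} (hn : n ≠ 0) {δ : unitInterval → Tor n → Plane}
    (hδ : ∀ a, Continuous fun s => δ s a) (h1 : ∀ a, δ 1 a = 0)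
    (hdet : ∀ s a k, 0 < pdet (edgeVec (latA n) (latB n) (δ s) a k)
      (edgeVec (latA n) (latB n) (δ s) a (k + 1))) (s : unitInterval) :
    (plMap n (δ s)).Bijective := by
  have : NeZero (2 * n) := ⟨by omega⟩
  have hE : ∀ a k, Continuous fun s => edgeVec (latA n) (latB n) (δ s) a k := by
    intro a k
    unfold edgeVec
    exact (continuous_const.add (hδ _)).sub (hδ _)
  have hD : ∀ a k, Continuous fun s => pdet (edgeVec (latA n) (latB n) (δ s) a k)
      (edgeVec (latA n) (latB n) (δ s) a (k + 1)) := by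
    intro a k
    have e1 := hE a k
    have e2 := hE a (k + 1)
    unfold pdet
    fun_prop
  have hd : ∃ d > 0, ∀ s a k, d ≤ pdet (edgeVec (latA n) (latB n) (δ s) a k)
      (edgeVec (latA n) (latB n) (δ s) a (k + 1)) := by
    have : ∀ p : Tor n × Fin 6, ∃ d > 0, ∀ s, d ≤ pdet (edgeVec (latA n) (latB n) (δ s) p.1 p.2)
        (edgeVec (latA n) (latB n) (δ s) p.1 (p.2 + 1)) := by
      intro p
      obtain ⟨s, -, hs⟩ := isCompact_univ.exists_isMinOn univ_nonempty (hD p.1 p.2).continuousOn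
      exact ⟨_, hdet s p.1 p.2, fun s' => hs (mem_univ s')⟩
    choose d hd hd' using this
    obtain ⟨p, hp⟩ := Finite.exists_min d
    exact ⟨d p, hd p, fun s a k => (hp (a, k)).trans (hd' (a, k) s)⟩
  have hC : ∃ C, 0 ≤ C ∧ ∀ s a k, ‖edgeVec (latA n) (latB n) (δ s) a k‖ ≤ C := by
    have : ∀ p : Tor n × Fin 6, ∃ d, ∀ s, ‖edgeVec (latA n) (latB n) (δ s) p.1 p.2‖ ≤ d := by
      intro p
      obtain ⟨s, -, hs⟩ := isCompact_univ.exists_isMaxOn univ_nonempty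
        (hE p.1 p.2).norm.continuousOn
      exact ⟨_, fun s' => hs (mem_univ s')⟩
    choose d hd using this
    obtain ⟨p, hp⟩ := Finite.exists_max d
    exact ⟨d p, (norm_nonneg _).trans (hd p 0), fun s a k => (hd (a, k) s).trans (hp (a, k))⟩
  obtain ⟨d, hd0, hd⟩ := hd
  obtain ⟨C, hC0, hC⟩ := hC
  have hstep : ∀ s s', (∀ a, ‖(δ s' - δ s) a‖ ≤ 1 / (12 * (2 * n) * (4 * C / d) + 1)) →
      (plMap n (δ s)).Bijective → (plMap n (δ s')).Bijective := by
    intro s s' hss hb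
    set K := 4 * C / d
    have hK : 0 ≤ K := by positivity
    have hn0 : (0 : ℝ) ≤ n := n.cast_nonneg
    obtain ⟨g, hgf, hfg⟩ := Function.bijective_iff_has_inverse.1 hb
    have hlip := plMap_inverse_lipschitz hn hd0 (hd s) (hC s) hgf hfg
    set η := 1 / (12 * (2 * n) * K + 1)
    have := bijective_add_of_lipschitz
      (D := fun z => hexInterp (fun v => (δ s' - δ s) (torProj n v)) (latCoord n z))
      hgf hfg hlip (ε := 12 * η * (2 * n)) ?_ (by positivity) hK ?_
    · convert this using 1
      funext z
      exact plMap_sub _ _ z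
    · intro z z'
      refine (norm_hexInterp_sub_le (fun v => hss (torProj n v)) _ _).trans ?_
      calc _ ≤ 12 * η * (2 * n * ‖z - z'‖) := by
            gcongr
            exact norm_latCoord_sub_le n z z'
        _ = _ := by ring
    · have h0 : 0 < 12 * (2 * n) * K + 1 := by positivity
      have : 12 * η * (2 * n) * K = 12 * (2 * n) * K / (12 * (2 * n) * K + 1) := by
        simp only [η]; ring
      rw [this, div_lt_one h0]
      linarith
  have hloc : IsLocallyConstant fun s => (plMap n (δ s)).Bijective := by
    rw [IsLocallyConstant.iff_eventually_eq]
    intro s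
    have hpos : 0 < 1 / (12 * (2 * n) * (4 * C / d) + 1) := by positivity
    have : ∀ a, ∀ᶠ s' in 𝓝 s, ‖δ s' a - δ s a‖ < 1 / (12 * (2 * n) * (4 * C / d) + 1) := by
      intro a
      simpa only [dist_eq_norm] using Metric.tendsto_nhds.1 ((hδ a).tendsto s) _ hpos
    filter_upwards [eventually_all.2 this] with s' hs'
    refine propext ⟨hstep s' s fun a => ?_, hstep s s' fun a => (hs' a).le⟩
    rw [Pi.sub_apply, norm_sub_rev]
    exact (hs' a).le
  have h1' : (plMap n (δ 1)).Bijective := by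
    have : plMap n (δ 1) = id := by
      funext z
      simp [plMap, h1, hexInterp]
    rw [this]
    exact Function.bijective_id
  have := hloc.apply_eq_of_isPreconnected isPreconnected_univ (mem_univ s) (mem_univ 1)
  exact this.mpr h1'

theorem plMap_eq_self {n : ℕ} (hn : 2 ≤ n) {δ : Tor n → Plane} (h : ∀ a ∈ fixedRow n, δ a = 0)
    {z : Plane} (hz : |z.2| = 1) : plMap n δ z = z := by
  obtain ⟨s, -, hs⟩ := exists_hexHat_support (latCoord n z)
  rw [plMap, hexInterp_eq_sum hs, add_eq_left]
  refine Finset.sum_eq_zero fun v _ => ?_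
  by_cases hv : hexHat (latCoord n z - latCast v) = 0
  · rw [hv, zero_smul]
  · rw [← ne_eq, hexHat_ne_zero, hexNorm_lt_iff] at hv
    have h2 := hv.2.1
    simp only [latCoord, latCast, Prod.snd_sub, abs_lt] at h2
    have hv2 : v.2 = n ∨ v.2 = -n := by
      rcases (abs_eq zero_le_one).1 hz with h3 | h3
      · left
        rw [h3, mul_one] at h2
        have a1 : (n : ℤ) < v.2 + 1 := by
          rw [← Int.cast_lt (R := ℝ)]; push_cast; linarith
        have a2 : v.2 < n + 1 := by
          rw [← Int.cast_lt (R := ℝ)]; push_cast; linarith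
        omega
      · right
        rw [h3] at h2
        have a1 : -(n : ℤ) < v.2 + 1 := by
          rw [← Int.cast_lt (R := ℝ)]; push_cast; linarith
        have a2 : v.2 < -n + 1 := by
          rw [← Int.cast_lt (R := ℝ)]; push_cast; linarith
        omega
    rw [h _ ((torProj_mem_fixedRow hn (by omega) (by omega)).2 hv2), smul_zero]

theorem hexNorm_latDeck {n : ℕ} {σ : ℤ} (hσ : σ = 1 ∨ σ = -1) (z : Plane) (v : ℤ × ℤ) :
    hexNorm (latCoord n (deck σ z) - latCast (latDeck n σ v)) =
      hexNorm (latCoord n z - latCast v) := by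
  rcases hσ with rfl | rfl
  · congr 1
    ext <;> simp [latCoord, deck, latCast, latDeck]
    ring
  · have : latCoord n (deck (-1) z) - latCast (latDeck n (-1) v) =
      ((latCoord n z - latCast v).1 + (latCoord n z - latCast v).2,
        -(latCoord n z - latCast v).2) := by
      ext <;> simp [latCoord, deck, latCast, latDeck] <;> ring
    rw [this]
    simp only [hexNorm, abs_neg]
    rw [add_neg_cancel_right, max_right_comm, max_comm |_| |_|, max_right_comm, max_comm]

theorem bijective_latDeck {n : ℕ} {σ : ℤ} (hσ : σ = 1 ∨ σ = -1) : (latDeck n σ).Bijective := by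
  constructor
  · intro v w hvw
    have := congrArg (latDeck n σ) hvw
    rw [latDeck_latDeck hσ, latDeck_latDeck hσ] at this
    exact add_right_cancel this
  · intro v
    refine ⟨latDeck n σ (v - (2 * (n : ℤ), 0)), ?_⟩
    rw [latDeck_latDeck hσ, sub_add_cancel]

theorem plMap_deck {n : ℕ} {σ : ℤ} (hσ : σ = 1 ∨ σ = -1) {δ : Tor n → Plane}
    (h : ∀ a, δ (torDeck n σ a) = ((δ a).1, σ * (δ a).2)) (z : Plane) :
    plMap n δ (deck σ z) = deck σ (plMap n δ z) := by
  have hhat : ∀ v, hexHat (latCoord n (deck σ z) - latCast (latDeck n σ v)) =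
      hexHat (latCoord n z - latCast v) := fun v => by simp only [hexHat, hexNorm_latDeck hσ]
  obtain ⟨s, -, hs⟩ := exists_hexHat_support (latCoord n z)
  have hsum : hexInterp (fun v => δ (torProj n v)) (latCoord n (deck σ z)) =
      ∑ v ∈ s, hexHat (latCoord n z - latCast v) • δ (torDeck n σ (torProj n v)) := by
    rw [hexInterp, ← finsum_comp _ (bijective_latDeck (n := n) hσ)]
    simp only [hhat, torProj_latDeck hσ]
    exact finsum_eq_sum_of_support_subset _ fun v hv => hs v fun h => hv (by simp [h])
  rw [plMap, plMap, hsum, hexInterp_eq_sum hs]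
  ext
  · simp [deck, h, Prod.fst_sum]; ring
  · simp [deck, h, Prod.snd_sum, mul_add, Finset.mul_sum]
    refine Finset.sum_congr rfl fun v _ => by ring

theorem plMap_fst_bound {n : ℕ} (hn : n ≠ 0) {δ : Tor n → Plane} {C : ℝ} {z : Plane}
    (h : ∀ v, hexNorm (latCoord n z - latCast v) < 1 → |(latPos n v).1 + (δ (torProj n v)).1| ≤ C) :
    |(plMap n δ z).1| ≤ C := by
  obtain ⟨s, -, hs⟩ := exists_hexHat_support (latCoord n z)
  have hz : z = ∑ v ∈ s, hexHat (latCoord n z - latCast v) • latPos n v := by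
    have h1 := hexInterp_latCast (latCoord n z)
    rw [hexInterp_eq_sum hs] at h1
    have h2 := eq_of_latCoord_eq hn h1.symm
    nth_rw 1 [h2]
    simp only [latPos_eq, Prod.fst_sum, Prod.snd_sum, Finset.sum_smul, smul_add, smul_smul,
      Prod.smul_fst, Prod.smul_snd, smul_eq_mul, Finset.sum_add_distrib]
  have h3 : (plMap n δ z).1 = ∑ v ∈ s, hexHat (latCoord n z - latCast v) *
      ((latPos n v).1 + (δ (torProj n v)).1) := by
    rw [plMap, hexInterp_eq_sum hs, Prod.fst_add, congrArg Prod.fst hz]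
    simp [Prod.fst_sum, mul_add, Finset.sum_add_distrib]
  rw [h3]
  refine (Finset.abs_sum_le_sum_abs _ _).trans ?_
  calc _ ≤ ∑ v ∈ s, hexHat (latCoord n z - latCast v) * C := by
        refine Finset.sum_le_sum fun v _ => ?_
        rw [abs_mul, abs_of_nonneg (hexHat_nonneg _)]
        rcases eq_or_ne (hexHat (latCoord n z - latCast v)) 0 with h0 | h0
        · simp [h0]
        · exact mul_le_mul_of_nonneg_left (h v (hexHat_ne_zero.1 h0)) (hexHat_nonneg _)
    _ = C := by rw [← Finset.sum_mul, sum_hexHat hs, one_mul]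

/-- A family of homeomorphisms starting at the identity and fixing two lines preserves the sides. -/
theorem abs_snd_lt_one_iff {f : unitInterval → Plane → Plane} (hf : ∀ z, Continuous fun s => f s z)
    (hinj : ∀ s, (f s).Injective) (h1 : ∀ z, f 1 z = z) (hfix : ∀ s z, |z.2| = 1 → f s z = z)
    (s : unitInterval) {z : Plane} (hz : |z.2| ≠ 1) :
    |(f s z).2| < 1 ↔ |z.2| < 1 := by
  have hne : ∀ s, |(f s z).2| ≠ 1 := by
    intro s h
    have h2 := hinj s (hfix s _ h)
    rw [h2] at h
    exact hz h
  have hc : Continuous fun s => |(f s z).2| := (continuous_snd.comp (hf z)).abs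
  have hp := (isPreconnected_univ (α := unitInterval)).intermediate_value (mem_univ s) (mem_univ 1)
    hc.continuousOn
  have hp' := (isPreconnected_univ (α := unitInterval)).intermediate_value (mem_univ 1) (mem_univ s)
    hc.continuousOn
  simp only [h1] at hp hp'
  constructor
  · intro h
    by_contra! hcon
    obtain ⟨s', -, hs'⟩ := hp ⟨h.le, hcon⟩
    exact hne s' hs'
  · intro h
    by_contra! hcon
    obtain ⟨s', -, hs'⟩ := hp' ⟨h.le, hcon⟩
    exact hne s' hs'

/-- Cutting off a family of homeomorphisms fixing the lines `y = ± 1` outside the strip. -/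
theorem iso_of_cut {σ : ℤ} (hσ : σ = 1 ∨ σ = -1) {f : unitInterval → Plane → Plane}
    (hf : Continuous fun p : unitInterval × Plane => f p.1 p.2)
    (hb : ∀ s, (f s).Bijective) (h1 : ∀ z, f 1 z = z) (hfix : ∀ s z, |z.2| = 1 → f s z = z)
    (hd : ∀ s z, f s (deck σ z) = deck σ (f s z)) {C : ℝ} (hC : ∀ s z, ‖f s z - z‖ ≤ C) :
    Iso (deck σ) univ (𝓟 {z | 1 ≤ |z.2|}) fun z => if |z.2| ≤ 1 then f 0 z else z := by
  have hside := fun s z => abs_snd_lt_one_iff (f := f) (fun z =>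
    hf.comp (continuous_id.prodMk continuous_const))
    (fun s => (hb s).1) h1 hfix s (z := z)
  have hdeck : ∀ z : Plane, |(deck σ z).2| = |z.2| := by
    intro z
    rcases hσ with rfl | rfl <;> simp [deck]
  refine ⟨fun p => if |p.2.2| ≤ 1 then f (unitInterval.symm p.1) p.2 else p.2, ?_, ?_, ⟨C, ?_⟩, ?_,
    by simp, ?_, ?_, ?_⟩
  · refine Continuous.if_le ?_ continuous_snd (by fun_prop) continuous_const ?_
    · exact hf.comp (f := fun p : unitInterval × Plane => (unitInterval.symm p.1, p.2))
        (by fun_prop)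
    · intro p hp
      exact hfix _ _ hp
  · intro t
    set s := unitInterval.symm t
    have hle : ∀ z : Plane, |(if |z.2| ≤ 1 then f s z else z).2| ≤ 1 ↔ |z.2| ≤ 1 := by
      intro z
      by_cases h : |z.2| ≤ 1
      · simp only [h, if_true, iff_true]
        rcases h.eq_or_lt with h | h
        · rw [hfix s z h, h]
        · exact ((hside s z h.ne).2 h).le
      · simp [h]
    constructor
    · intro z z' hzz
      simp only at hzz
      have e := hle z
      rw [hzz, hle z'] at e
      by_cases h : |z.2| ≤ 1
      · rw [if_pos h, if_pos (e.2 h)] at hzz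
        exact (hb s).1 hzz
      · rw [if_neg h, if_neg (fun h' => h (e.1 h'))] at hzz
        exact hzz
    · intro w
      by_cases h : |w.2| ≤ 1
      · rcases h.eq_or_lt with h1 | h1
        · exact ⟨w, by simpa [h] using hfix s w h1⟩
        · obtain ⟨z, hz⟩ := (hb s).2 w
          have hz1 : |z.2| < 1 := by
            by_cases h2 : |z.2| = 1
            · rw [hfix s z h2] at hz
              rw [hz] at h2
              exact absurd h2 h1.ne
            · exact (hside s z h2).1 (by rwa [hz])
          exact ⟨z, by simp [hz1.le, ← hz]; rfl⟩
      · exact ⟨w, by simp [h]⟩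
  · intro t z
    simp only
    split_ifs with h
    · exact hC _ _
    · rw [sub_self, norm_zero]
      exact (norm_nonneg _).trans (hC 1 z)
  · intro t z
    simp only [hdeck]
    split_ifs with h
    · exact hd _ _
    · rfl
  · rw [eventually_principal]
    intro z hz t
    simp only
    split_ifs with h
    · exact hfix _ _ (le_antisymm h hz)
    · rfl
  · intro z
    simp [h1]
  · intro z
    simp

theorem exists_straightening {n : ℕ} {σ : ℤ} {N : ℤ → Set (ℤ × ℤ)} (hN : ArcTrace n σ N)
    (hσ : σ = 1 ∨ σ = -1) (hn : 2 ≤ n) : ∃ f : Plane → Plane,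
      Iso (deck σ) univ (𝓟 {z | 1 ≤ |z.2|}) f ∧
      ∀ z, |z.2| ≤ 1 → (∀ v, hexNorm (latCoord n z - latCast v) < 1 → v ∈ N 0) → |(f z).1| ≤
        3 / n := by
  obtain ⟨δ, hδ, h1, h0, hd, hdet, hb⟩ := exists_tutte_family hN hσ hn
  have : NeZero (2 * n) := ⟨by omega⟩
  have hn0 : n ≠ 0 := by omega
  have hC : ∃ C, ∀ s a, ‖δ s a‖ ≤ C := by
    have : ∀ a, ∃ d, ∀ s, ‖δ s a‖ ≤ d := by
      intro p
      obtain ⟨s, -, hs⟩ := isCompact_univ.exists_isMaxOn univ_nonempty (hδ p).norm.continuousOn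
      exact ⟨_, fun s' => hs (mem_univ s')⟩
    choose d hd using this
    obtain ⟨p, hp⟩ := Finite.exists_max d
    exact ⟨d p, fun s a => (hd a s).trans (hp a)⟩
  obtain ⟨C, hC⟩ := hC
  refine ⟨_, iso_of_cut hσ (f := fun s => plMap n (δ s)) (continuous_plMap hδ)
    (plMap_bijective hn0 hδ h1 hdet) (fun z => ?_) (fun s z => plMap_eq_self hn (h0 s))
    (fun s => plMap_deck hσ (hd s)) (fun s => norm_plMap_sub_le (hC s)), ?_⟩
  · simp [plMap, h1, hexInterp]
  · intro z hz hv
    simp only [hz, if_true]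
    exact plMap_fst_bound hn0 fun v hv' => hb v (hv v hv')

theorem deck_deck {σ : ℤ} (hσ : σ = 1 ∨ σ = -1) (z : Plane) : deck σ (deck σ z) = z + (2, 0) := by
  rcases hσ with rfl | rfl <;> ext <;> simp [deck] <;> ring

theorem deck_injective {σ : ℤ} (hσ : σ = 1 ∨ σ = -1) : (deck σ).Injective := by
  intro z w h
  have := congrArg (deck σ) h
  rw [deck_deck hσ, deck_deck hσ] at this
  exact add_right_cancel this

theorem abs_deck_snd {σ : ℤ} (hσ : σ = 1 ∨ σ = -1) (z : Plane) : |(deck σ z).2| = |z.2| := by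
  rcases hσ with rfl | rfl <;> simp [deck]

/-- The vertices whose open stars meet a set. -/
def starTrace (n : ℕ) (B : Set Plane) : Set (ℤ × ℤ) :=
    {v | ∃ z ∈ B, hexNorm (latCoord n z - latCast v) < 1}

/-- The image of a vertical arc. -/
def arcImage (H : Plane → Plane) (m : ℤ) : Set Plane := H '' {z | z.1 = m ∧ |z.2| ≤ 1}

theorem exists_hexNorm_lt (c : Plane) : ∃ v, hexNorm (c - latCast v) < 1 := by
  obtain ⟨s, -, hs⟩ := exists_hexHat_support c
  by_contra! h
  have := sum_hexHat hs
  rw [Finset.sum_eq_zero fun v _ => by rw [← not_ne_iff, hexHat_ne_zero]; exact (h v).not_gt] at this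
  exact zero_ne_one this

/-- Two lattice vertices with intersecting open stars are equal or adjacent. -/
theorem eq_or_adj_of_hexNorm_lt {c : Plane} {v w : ℤ × ℤ} (hv : hexNorm (c - latCast v) < 1)
    (hw : hexNorm (c - latCast w) < 1) : w = v ∨ ∃ k, w = v + latDir k := by
  rw [hexNorm_lt_iff] at hv hw
  obtain ⟨a1, a2, a3⟩ := hv
  obtain ⟨b1, b2, b3⟩ := hw
  simp only [latCast, Prod.fst_sub, Prod.snd_sub, abs_lt] at a1 a2 a3 b1 b2 b3
  have h1 : w.1 - v.1 < 2 := by rw [← Int.cast_lt (R := ℝ)]; push_cast; linarith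
  have h2 : -2 < w.1 - v.1 := by rw [← Int.cast_lt (R := ℝ)]; push_cast; linarith
  have h3 : w.2 - v.2 < 2 := by rw [← Int.cast_lt (R := ℝ)]; push_cast; linarith
  have h4 : -2 < w.2 - v.2 := by rw [← Int.cast_lt (R := ℝ)]; push_cast; linarith
  have h5 : w.1 - v.1 + (w.2 - v.2) < 2 := by rw [← Int.cast_lt (R := ℝ)]; push_cast; linarith
  have h6 : -2 < w.1 - v.1 + (w.2 - v.2) := by rw [← Int.cast_lt (R := ℝ)]; push_cast; linarith
  obtain ⟨w1, w2⟩ := w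
  obtain ⟨v1, v2⟩ := v
  simp only at h1 h2 h3 h4 h5 h6
  have hA : w1 - v1 = -1 ∨ w1 - v1 = 0 ∨ w1 - v1 = 1 := by omega
  have hB : w2 - v2 = -1 ∨ w2 - v2 = 0 ∨ w2 - v2 = 1 := by omega
  have key : ∀ k : Fin 6, (w1 - v1, w2 - v2) = latDir k → (w1, w2) = (v1, v2) + latDir k := by
    intro k hk
    rw [← hk]
    ext <;> simp
  rcases hA with hA | hA | hA <;> rcases hB with hB | hB | hB
  · omega
  · exact Or.inr ⟨3, key 3 (by rw [hA, hB]; rfl)⟩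
  · exact Or.inr ⟨2, key 2 (by rw [hA, hB]; rfl)⟩
  · exact Or.inr ⟨4, key 4 (by rw [hA, hB]; rfl)⟩
  · left; ext <;> simp <;> omega
  · exact Or.inr ⟨1, key 1 (by rw [hA, hB]; rfl)⟩
  · exact Or.inr ⟨5, key 5 (by rw [hA, hB]; rfl)⟩
  · exact Or.inr ⟨0, key 0 (by rw [hA, hB]; rfl)⟩
  · omega

theorem norm_sub_lt_of_latCoord {n : ℕ} (hn : n ≠ 0) {z z' : Plane} {v : ℤ × ℤ}
    (h : hexNorm (latCoord n z - latCast v) < 1) (h' : hexNorm (latCoord n z' - latCast v) < 1) :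
    ‖z - z'‖ < 4 / n := by
  have hn0 : (0 : ℝ) < n := by exact_mod_cast hn.bot_lt
  rw [hexNorm_lt_iff] at h h'
  obtain ⟨a1, a2, -⟩ := h
  obtain ⟨b1, b2, -⟩ := h'
  simp only [latCoord, latCast, Prod.fst_sub, Prod.snd_sub, abs_lt] at a1 a2 b1 b2
  rw [Prod.norm_def, max_lt_iff, Real.norm_eq_abs, Real.norm_eq_abs, abs_lt, abs_lt,
    lt_div_iff₀ hn0,
    lt_div_iff₀ hn0, ← neg_div, div_lt_iff₀ hn0, div_lt_iff₀ hn0]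
  simp only [Prod.fst_sub, Prod.snd_sub]
  refine ⟨⟨?_, ?_⟩, ?_, ?_⟩ <;> nlinarith

section

variable {σ : ℤ} (hσ : σ = 1 ∨ σ = -1) (H : Plane ≃ₜ Plane) (hd : ∀ z, H (deck σ z) = deck σ (H z))

include hσ hd

theorem deck_mem_arcImage (m : ℤ) (z : Plane) : deck σ z ∈ arcImage H (m + 1) ↔ z ∈ arcImage H m :=
    by
  constructor
  · rintro ⟨w, ⟨h1, h2⟩, h3⟩
    refine ⟨H.symm z, ?_, by simp⟩
    have h4 : deck σ (H.symm z) = w := by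
      apply H.injective
      rw [hd, h3, H.apply_symm_apply]
    rw [← h4] at h1 h2
    refine ⟨?_, by rwa [abs_deck_snd hσ] at h2⟩
    simpa [deck] using h1
  · rintro ⟨w, ⟨h1, h2⟩, rfl⟩
    refine ⟨deck σ w, ⟨?_, by rwa [abs_deck_snd hσ]⟩, hd w⟩
    simp [deck, h1]

theorem latDeck_mem_starTrace {n : ℕ} (m : ℤ) (v : ℤ × ℤ) :
    latDeck n σ v ∈ starTrace n (arcImage H (m + 1)) ↔ v ∈ starTrace n (arcImage H m) := by
  constructor
  · rintro ⟨z, hz, h⟩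
    have : ∃ z', deck σ z' = z := by
      refine ⟨deck σ (z - (2, 0)), ?_⟩
      rw [deck_deck hσ, sub_add_cancel]
    obtain ⟨z', rfl⟩ := this
    exact ⟨z', (deck_mem_arcImage hσ H hd m z').1 hz, by rwa [hexNorm_latDeck hσ] at h⟩
  · rintro ⟨z, hz, h⟩
    exact ⟨deck σ z, (deck_mem_arcImage hσ H hd m z).2 hz, by rwa [hexNorm_latDeck hσ]⟩

theorem exists_arcTrace (hid : ∀ z, 1 / 2 ≤ |z.2| → H z = z) : ∃ n₀ : ℕ, ∀ n ≥ n₀,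
    ArcTrace n σ fun m => starTrace n (arcImage H m) := by
  have hcomp : ∀ m, IsCompact (arcImage H m) := by
    intro m
    have : {z : Plane | z.1 = m ∧ |z.2| ≤ 1} = {(m : ℝ)} ×ˢ Icc (-1) 1 := by
      ext z
      simp [_root_.abs_le]
    rw [arcImage, this]
    exact (isCompact_singleton.prod isCompact_Icc).image H.continuous
  have hsnd : ∀ m, ∀ z ∈ arcImage H m, |z.2| ≤ 1 := by
    rintro m _ ⟨w, ⟨-, hw⟩, rfl⟩
    by_contra! h
    have := H.injective (hid (H w) (by linarith))
    rw [this] at h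
    linarith
  obtain ⟨d, hd0, hdd⟩ : ∃ d > 0, ∀ m', ∀ z ∈ arcImage H 0, ∀ z' ∈ arcImage H m', ‖z - z'‖ < d →
    m' = 0 := by
    have hc : IsCompact (Metric.cthickening 1 (arcImage H 0)) := (hcomp 0).cthickening
    have hu := hc.uniformContinuousOn_of_continuous H.symm.continuous.continuousOn
    rw [Metric.uniformContinuousOn_iff] at hu
    obtain ⟨d, hd0, hd1⟩ := hu 1 one_pos
    refine ⟨min d 1, lt_min hd0 one_pos, fun m' z hz z' hz' h => ?_⟩
    rw [lt_min_iff] at h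
    have hzt : z ∈ Metric.cthickening 1 (arcImage H 0) := Metric.self_subset_cthickening _ hz
    have hzt' : z' ∈ Metric.cthickening 1 (arcImage H 0) :=
      Metric.mem_cthickening_of_dist_le z' z 1 _ hz (by rw [dist_comm, dist_eq_norm]; exact h.2.le)
    have := hd1 z hzt z' hzt' (by rw [dist_eq_norm]; exact h.1)
    obtain ⟨w, ⟨hw, -⟩, rfl⟩ := hz
    obtain ⟨w', ⟨hw', -⟩, rfl⟩ := hz'
    rw [H.symm_apply_apply, H.symm_apply_apply, dist_eq_norm] at this
    have h3 := (norm_fst_le (w - w')).trans_lt this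
    rw [Prod.fst_sub, hw, hw', Int.cast_zero, zero_sub, norm_neg, Real.norm_eq_abs, abs_lt] at h3
    have h4 : m' < 1 := by rw [← Int.cast_lt (R := ℝ)]; push_cast; linarith
    have h5 : -1 < m' := by rw [← Int.cast_lt (R := ℝ)]; push_cast; linarith
    omega
  obtain ⟨n₀, hn₀⟩ := exists_nat_gt (4 / d)
  refine ⟨max 2 n₀, fun n hn => ?_⟩
  have hn2 : 2 ≤ n := (le_max_left _ _).trans hn
  have hn2' : (2 : ℝ) ≤ n := by exact_mod_cast hn2
  have hnn : n ≠ 0 := by omega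
  have hnd : 4 / (n : ℝ) < d := by
    have : (n₀ : ℝ) ≤ n := by exact_mod_cast (le_max_right _ _).trans hn
    rw [div_lt_iff₀ (by linarith)]
    rw [div_lt_iff₀ hd0] at hn₀
    nlinarith
  have hsnd' : ∀ m, ∀ v ∈ starTrace n (arcImage H m), |(v.2 : ℝ)| < n + 1 := by
    rintro m v ⟨z, hz, hv⟩
    have h1 := hsnd m z hz
    rw [hexNorm_lt_iff] at hv
    have h2 := hv.2.1
    simp only [latCoord, latCast, Prod.snd_sub, abs_lt] at h2
    rw [_root_.abs_le] at h1
    rw [abs_lt]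
    constructor <;> nlinarith
  refine ⟨?_, ?_, ?_, ?_, latDeck_mem_starTrace hσ H hd, ?_, ?_⟩
  · obtain ⟨R, hR⟩ := ((hcomp 0).image (continuous_latCoord n)).isBounded.exists_norm_le
    refine ((Set.finite_Icc (⌊-R⌋ - 2) (⌊R⌋ + 3)).prod
      (Set.finite_Icc (⌊-R⌋ - 2) (⌊R⌋ + 3))).subset ?_
    rintro v ⟨z, hz, hv⟩
    have h0 := hR _ ⟨z, hz, rfl⟩
    rw [hexNorm_lt_iff] at hv
    obtain ⟨h4, h5, -⟩ := hv
    simp only [latCast, Prod.fst_sub, Prod.snd_sub, abs_lt] at h4 h5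
    have h6 : |(latCoord n z).1| ≤ R := (norm_fst_le (latCoord n z)).trans h0
    have h7 : |(latCoord n z).2| ≤ R := (norm_snd_le (latCoord n z)).trans h0
    rw [_root_.abs_le] at h6 h7
    have f1 := Int.floor_le (-R)
    have f2 := Int.lt_floor_add_one R
    refine ⟨⟨?_, ?_⟩, ?_, ?_⟩
    all_goals
      rw [← Int.cast_le (R := ℝ)]
      push_cast
      linarith
  · intro m v hv
    have h1 := hsnd' m v hv
    rw [abs_lt] at h1
    have : -(n : ℤ) - 1 < v.2 := by rw [← Int.cast_lt (R := ℝ)]; push_cast; linarith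
    omega
  · intro m v hv
    have h1 := hsnd' m v hv
    rw [abs_lt] at h1
    have : v.2 < (n : ℤ) + 1 := by rw [← Int.cast_lt (R := ℝ)]; push_cast; linarith
    omega
  · have hstep : ∀ m, (∀ m' v, v ∈ starTrace n (arcImage H m) → v ∈ starTrace n (arcImage H m') →
      m = m') ↔
        ∀ m' v, v ∈ starTrace n (arcImage H (m + 1)) → v ∈ starTrace n (arcImage H m') → m + 1 =
          m' := by
      intro m
      constructor
      · intro h m' v hv hv'
        obtain ⟨v, rfl⟩ := (bijective_latDeck (n := n) hσ).2 v
        rw [latDeck_mem_starTrace hσ H hd] at hv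
        rw [← sub_add_cancel m' 1, latDeck_mem_starTrace hσ H hd] at hv'
        have := h _ v hv hv'
        omega
      · intro h m' v hv hv'
        rw [← latDeck_mem_starTrace hσ H hd] at hv hv'
        have := h _ _ hv hv'
        omega
    intro m
    induction m using Int.induction_on with
    | zero =>
      rintro m' v ⟨z, hz, hv⟩ ⟨z', hz', hv'⟩
      exact (hdd m' z hz z' hz' ((norm_sub_lt_of_latCoord hnn hv hv').trans hnd)).symm
    | succ i ih => exact (hstep _).1 ih
    | pred i ih => exact (hstep _).2 (by rwa [sub_add_cancel])
  · rintro m B ⟨v, ⟨_, ⟨w, ⟨hw1, hw2⟩, rfl⟩, hv⟩, hvB⟩ hB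
    have hmem : ∀ y ∈ Icc (-1 : ℝ) 1, H (m, y) ∈ arcImage H m := fun y hy =>
      ⟨((m : ℝ), y), ⟨rfl, _root_.abs_le.2 hy⟩, rfl⟩
    have hcont : ∀ v, Continuous fun y : ℝ => hexNorm (latCoord n (H ((m : ℝ), y)) - latCast v) :=
      by
      intro v
      refine continuous_hexNorm.comp
        (Continuous.sub ((continuous_latCoord n).comp ?_) continuous_const)
      exact H.continuous.comp (continuous_const.prodMk continuous_id)
    have hopen : ∀ v, IsOpen {y : ℝ | hexNorm (latCoord n (H ((m : ℝ), y)) - latCast v) < 1} :=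
      fun v => isOpen_lt (hcont v) continuous_const
    have hclique : ∀ y ∈ Icc (-1 : ℝ) 1, ∀ u u', hexNorm (latCoord n (H ((m : ℝ), y)) - latCast u) <
      1 →
        hexNorm (latCoord n (H ((m : ℝ), y)) - latCast u') < 1 → u ∈ B → u' ∈ B := by
      intro y hy u u' hu hu' huB
      rcases eq_or_adj_of_hexNorm_lt hu hu' with rfl | ⟨k, rfl⟩
      · exact huB
      · exact hB u ⟨_, hmem y hy, hu⟩ huB k ⟨_, hmem y hy, hu'⟩
    let U : Set ℝ := ⋃ v ∈ B, {y : ℝ | hexNorm (latCoord n (H ((m : ℝ), y)) - latCast v) < 1}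
    let V : Set ℝ := ⋃ v ∈ Bᶜ, {y : ℝ | hexNorm (latCoord n (H ((m : ℝ), y)) - latCast v) < 1}
    have hU : IsOpen U := isOpen_biUnion fun v _ => hopen v
    have hV : IsOpen V := isOpen_biUnion fun v _ => hopen v
    have hUV : Icc (-1 : ℝ) 1 ⊆ U ∪ V := by
      intro y hy
      obtain ⟨v, hv⟩ := exists_hexNorm_lt (latCoord n (H ((m : ℝ), y)))
      by_cases h : v ∈ B
      · exact Or.inl (mem_biUnion h hv)
      · exact Or.inr (mem_biUnion h hv)
    have hsub : Icc (-1 : ℝ) 1 ⊆ U := by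
      by_contra hcon
      rw [not_subset] at hcon
      obtain ⟨y, hy, hyU⟩ := hcon
      obtain ⟨y', hy', h1, h2⟩ := isPreconnected_Icc U V hU hV hUV
        ⟨w.2, _root_.abs_le.1 hw2, mem_biUnion hvB (by rw [mem_ofPred_eq, ← hw1]; exact hv)⟩
        ⟨y, hy, (hUV hy).resolve_left hyU⟩
      simp only [U, V, mem_iUnion, exists_prop, mem_ofPred_eq, mem_compl_iff] at h1 h2
      obtain ⟨u, hu, hu1⟩ := h1
      obtain ⟨u', hu', hu1'⟩ := h2
      exact hu' (hclique y' hy' u u' hu1 hu1' hu)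
    have h1 : (1 : ℝ) ∈ Icc (-1 : ℝ) 1 := by simp
    have h2 := hsub h1
    simp only [U, mem_iUnion, exists_prop, mem_ofPred_eq] at h2
    obtain ⟨u, hu, hu1⟩ := h2
    refine ⟨u, ⟨_, hmem 1 h1, hu1⟩, hu, Or.inl ?_⟩
    rw [hid _ (by norm_num), hexNorm_lt_iff] at hu1
    have h2 := hu1.2.1
    simp only [latCoord, latCast, Prod.snd_sub, abs_lt] at h2
    have a1 : u.2 < (n : ℤ) + 1 := by rw [← Int.cast_lt (R := ℝ)]; push_cast; linarith
    have a2 : (n : ℤ) - 1 < u.2 := by rw [← Int.cast_lt (R := ℝ)]; push_cast; linarith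
    omega
  · rintro v ⟨_, ⟨w, ⟨hw1, hw2⟩, rfl⟩, hv⟩ hrow
    have hn0 : (0 : ℝ) < n := by linarith
    have h1 := hv
    rw [hexNorm_lt_iff] at hv
    obtain ⟨a1, a2, -⟩ := hv
    simp only [latCoord, latCast, Prod.fst_sub, Prod.snd_sub, abs_lt] at a1 a2
    have h2 : 1 / 2 ≤ |(H w).2| := by
      rcases hrow with h | h
      · rw [h] at a2
        refine le_trans ?_ (le_abs_self _)
        push_cast at a2
        nlinarith
      · rw [h] at a2
        refine le_trans ?_ (neg_le_abs _)
        push_cast at a2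
        nlinarith
    have h3 := H.injective (hid _ h2)
    rw [h3, hw1] at a1
    rw [h3] at a2
    simp only [latPos]
    rw [abs_div, abs_of_pos hn0]
    refine div_le_div_of_nonneg_right ?_ hn0.le
    push_cast at a1
    rw [_root_.abs_le]
    constructor <;> linarith

end

/-- The iterates of the deck transformation. -/
def deckPow (σ k : ℤ) (z : Plane) : Plane := (z.1 + k, (σ : ℝ) ^ k * z.2)

theorem continuous_deckPow (σ k : ℤ) : Continuous (deckPow σ k) := by
  unfold deckPow; fun_prop

theorem deckPow_zero (σ : ℤ) (z : Plane) : deckPow σ 0 z = z := by simp [deckPow]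

section deckPow

variable {σ : ℤ} (hσ : σ = 1 ∨ σ = -1)

include hσ

theorem deckPow_add (k l : ℤ) (z : Plane) : deckPow σ (k + l) z = deckPow σ k (deckPow σ l z) := by
  have : (σ : ℝ) ≠ 0 := by rcases hσ with rfl | rfl <;> simp
  ext
  · simp [deckPow]; ring
  · simp only [deckPow, zpow_add₀ this]; ring

omit hσ in
theorem deckPow_one (z : Plane) : deckPow σ 1 z = deck σ z := by simp [deckPow, deck]

theorem abs_deckPow_snd (k : ℤ) (z : Plane) : |(deckPow σ k z).2| = |z.2| := by
  simp only [deckPow, abs_mul, abs_zpow]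
  have : |(σ : ℝ)| = 1 := by rcases hσ with rfl | rfl <;> simp
  rw [this, one_zpow, one_mul]

theorem deckPow_neg_deckPow (k : ℤ) (z : Plane) : deckPow σ (-k) (deckPow σ k z) = z := by
  rw [← deckPow_add hσ, neg_add_cancel, deckPow_zero]

theorem deckPow_deckPow_neg (k : ℤ) (z : Plane) : deckPow σ k (deckPow σ (-k) z) = z := by
  rw [← deckPow_add hσ, add_neg_cancel, deckPow_zero]

theorem norm_deckPow_sub (k : ℤ) (z w : Plane) : ‖deckPow σ k z - deckPow σ k w‖ = ‖z - w‖ := by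
  have : |(σ : ℝ)| = 1 := by rcases hσ with rfl | rfl <;> simp
  have h : |(σ : ℝ) ^ k| = 1 := by rw [abs_zpow, this, one_zpow]
  simp only [Prod.norm_def, deckPow, Prod.fst_sub, Prod.snd_sub, Real.norm_eq_abs, ← mul_sub,
    abs_mul, h,
    one_mul, add_sub_add_right_eq_sub]

theorem deckPow_comm {h : Plane → Plane} (hd : ∀ z, h (deck σ z) = deck σ (h z)) (k : ℤ) (z : Plane) :
    h (deckPow σ k z) = deckPow σ k (h z) := by
  induction k using Int.induction_on generalizing z with
  | zero => simp [deckPow_zero]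
  | succ i ih => rw [deckPow_add hσ, deckPow_one, ih, hd, ← deckPow_one, ← deckPow_add hσ]
  | pred i ih =>
    apply deck_injective hσ
    rw [← hd, ← deckPow_one, ← deckPow_one, ← deckPow_add hσ, ← deckPow_add hσ, add_sub_cancel, ih]

end deckPow

/-- The index of the vertical strip of width one, centred at the points of `c + ℤ`, containing a
point. -/
def cellIdx (c : ℝ) (z : Plane) : ℤ := ⌊z.1 - c + 1 / 2⌋

/-- The periodization of a map supported in the strip of width one centred at `c`. -/
def periodize (σ : ℤ) (c : ℝ) (g : Plane → Plane) (z : Plane) : Plane :=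
  deckPow σ (cellIdx c z) (g (deckPow σ (-cellIdx c z) z))

/-- The outside of an open strip. -/
def cellOut (c : ℝ) : Set Plane := {z | 1 / 2 ≤ |z.1 - c|}

theorem cellIdx_deckPow (σ : ℤ) (c : ℝ) (k : ℤ) (z : Plane) :
    cellIdx c (deckPow σ k z) = cellIdx c z + k := by
  rw [cellIdx, cellIdx, ← Int.floor_add_intCast]
  congr 1
  simp only [deckPow]
  ring

theorem cellIdx_eq_zero_of_notMem {c : ℝ} {z : Plane} (hz : z ∉ cellOut c) : cellIdx c z = 0 := by
  simp only [cellOut, mem_ofPred_eq, not_le, abs_lt] at hz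
  rw [cellIdx, Int.floor_eq_zero_iff]
  constructor <;> linarith

theorem cellIdx_deckPow_neg (σ : ℤ) (c : ℝ) (z : Plane) :
    cellIdx c (deckPow σ (-cellIdx c z) z) = 0 := by
  rw [cellIdx_deckPow, add_neg_cancel]

section Periodize

variable {σ : ℤ} (hσ : σ = 1 ∨ σ = -1) {c : ℝ}

include hσ

omit hσ in
theorem periodize_eq_of_cellIdx (g : Plane → Plane) {z : Plane} (h : cellIdx c z = 0) :
    periodize σ c g z = g z := by
  rw [periodize, h, deckPow_zero, neg_zero, deckPow_zero]

theorem periodize_deckPow (g : Plane → Plane) (k : ℤ) (z : Plane) :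
    periodize σ c g (deckPow σ k z) = deckPow σ k (periodize σ c g z) := by
  rw [periodize, periodize, cellIdx_deckPow, ← deckPow_add hσ, ← deckPow_add hσ]
  congr 1
  · ring
  · congr 2; ring

theorem periodize_deck (g : Plane → Plane) (z : Plane) :
    periodize σ c g (deck σ z) = deck σ (periodize σ c g z) := by
  rw [← deckPow_one, periodize_deckPow hσ, deckPow_one]

omit hσ in
theorem cellIdx_periodize {g : Plane → Plane} (hg : g.Injective) (hid : ∀ z ∈ cellOut c, g z = z)
    (z : Plane) : cellIdx c (periodize σ c g z) = cellIdx c z := by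
  rw [periodize, cellIdx_deckPow]
  suffices h : ∀ w, cellIdx c w = 0 → cellIdx c (g w) = 0 by
    rw [h _ (cellIdx_deckPow_neg σ c z), zero_add]
  intro w hw
  by_cases h : g w ∈ cellOut c
  · rw [hg (hid _ h), hw]
  · exact cellIdx_eq_zero_of_notMem h

theorem periodize_periodize {g h : Plane → Plane} (hg : g.Injective) (hid : ∀ z ∈ cellOut c, g z =
    z)
    (z : Plane) : periodize σ c h (periodize σ c g z) = periodize σ c (h ∘ g) z := by
  nth_rw 1 [periodize]
  rw [cellIdx_periodize hg hid]
  simp only [periodize, Function.comp, deckPow_neg_deckPow hσ]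

theorem periodize_of_cell {g h : Plane → Plane} (hh : ∀ z, h (deck σ z) = deck σ (h z))
    (hg : ∀ z, cellIdx c z = 0 → g z = h z) (z : Plane) : periodize σ c g z = h z := by
  rw [periodize, hg _ (cellIdx_deckPow_neg σ c z), deckPow_comm hσ hh, deckPow_deckPow_neg hσ]

theorem continuous_periodize {Y : Type*} [TopologicalSpace Y] {g : Y × Plane → Plane}
    (hg : Continuous g) (hid : ∀ t, ∀ z ∈ cellOut c, g (t, z) = z) :
    Continuous fun p : Y × Plane => periodize σ c (fun z => g (p.1, z)) p.2 := by
  let S : ℤ → Set (Y × Plane) := fun k =>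
    {p | (k : ℝ) ≤ p.2.1 - c + 1 / 2 ∧ p.2.1 - c + 1 / 2 ≤ k + 1}
  have hlf : LocallyFinite S := by
    rintro ⟨t, z⟩
    refine ⟨univ ×ˢ (Metric.ball z.1 1 ×ˢ univ), prod_mem_nhds univ_mem
      (prod_mem_nhds (Metric.ball_mem_nhds _ one_pos) univ_mem), ?_⟩
    refine (Set.finite_Icc (⌊z.1 - c⌋ - 3) (⌊z.1 - c⌋ + 3)).subset ?_
    rintro k ⟨⟨t', z'⟩, ⟨h1, h2⟩, -, h3, -⟩
    rw [Metric.mem_ball, Real.dist_eq, abs_lt] at h3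
    simp only at h1 h2 h3
    have f1 := Int.floor_le (z.1 - c)
    have f2 := Int.lt_floor_add_one (z.1 - c)
    constructor
    all_goals
      rw [← Int.cast_le (R := ℝ)]
      push_cast
      linarith
  refine hlf.continuous ?_ ?_ ?_
  · rw [eq_univ_iff_forall]
    rintro ⟨t, z⟩
    rw [mem_iUnion]
    exact ⟨_, Int.floor_le _, (Int.lt_floor_add_one _).le⟩
  · intro k
    have h0 : Continuous fun p : Y × Plane => p.2.1 - c + 1 / 2 := by fun_prop
    exact (isClosed_le continuous_const h0).inter (isClosed_le h0 continuous_const)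
  · intro k
    have h1 : Continuous fun p : Y × Plane => deckPow σ k (g (p.1, deckPow σ (-k) p.2)) := by
      refine (continuous_deckPow σ k).comp (hg.comp ?_)
      exact continuous_fst.prodMk ((continuous_deckPow σ _).comp continuous_snd)
    refine h1.continuousOn.congr ?_
    rintro ⟨t, z⟩ ⟨h2, h3⟩
    simp only at h2 h3 ⊢
    rcases h3.lt_or_eq with h3 | h3
    · have : cellIdx c z = k := by rw [cellIdx, Int.floor_eq_iff]; exact ⟨h2, h3⟩
      rw [periodize, this]
    · have h4 : cellIdx c z = k + 1 := by
        rw [cellIdx, h3]; simp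
      have e1 : deckPow σ (-k) z ∈ cellOut c := by
        simp only [cellOut, mem_ofPred_eq, deckPow]
        refine le_trans ?_ (le_abs_self _)
        push_cast
        linarith
      have e2 : deckPow σ (-(k + 1)) z ∈ cellOut c := by
        simp only [cellOut, mem_ofPred_eq, deckPow]
        refine le_trans ?_ (neg_le_abs _)
        push_cast
        linarith
      rw [periodize, h4, hid _ _ e1, hid _ _ e2, deckPow_deckPow_neg hσ, deckPow_deckPow_neg hσ]

theorem periodize_bijective {g : Plane → Plane} (hg : g.Bijective) (hid : ∀ z ∈ cellOut c, g z = z) :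
    (periodize σ c g).Bijective := by
  obtain ⟨h, hhg, hgh⟩ := Function.bijective_iff_has_inverse.1 hg
  have hid' : ∀ z ∈ cellOut c, h z = z := fun z hz => by rw [← hid z hz, hhg, hid z hz]
  have hp : ∀ z, periodize σ c id z = z := fun z => by rw [periodize, id, deckPow_deckPow_neg hσ]
  refine Function.bijective_iff_has_inverse.2 ⟨periodize σ c h, fun z => ?_, fun z => ?_⟩
  · rw [periodize_periodize hσ hg.1 hid, show h ∘ g = id from funext hhg, hp]
  · rw [periodize_periodize hσ hgh.injective hid', show g ∘ h = id from funext hgh, hp]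

end Periodize

/-- The Alexander trick towards the point `p`. -/
def alexander (p : Plane) (g : Plane → Plane) (t : ℝ) (z : Plane) : Plane :=
  z + t • (g (p + t⁻¹ • (z - p)) - (p + t⁻¹ • (z - p)))

theorem alexander_zero (p : Plane) (g : Plane → Plane) (z : Plane) : alexander p g 0 z = z := by
  simp [alexander]

theorem alexander_one (p : Plane) (g : Plane → Plane) (z : Plane) : alexander p g 1 z = g z := by
  simp [alexander]

theorem alexander_of_ne {p : Plane} {g : Plane → Plane} {t : ℝ} (ht : t ≠ 0) (z : Plane) :
    alexander p g t z = p + t • (g (p + t⁻¹ • (z - p)) - p) := by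
  rw [alexander, smul_sub, smul_add, smul_smul, mul_inv_cancel₀ ht, smul_sub]
  module

theorem continuous_alexander {p : Plane} {g : Plane → Plane} (hg : Continuous g) {C : ℝ}
    (hC : ∀ z, ‖g z - z‖ ≤ C) : Continuous fun q : ℝ × Plane => alexander p g q.1 q.2 := by
  refine continuous_snd.add ?_
  rw [continuous_iff_continuousAt]
  rintro ⟨t, z⟩
  by_cases ht : t = 0
  · subst ht
    rw [ContinuousAt, zero_smul, tendsto_zero_iff_norm_tendsto_zero]
    have h1 : Tendsto (fun q : ℝ × Plane => |q.1| * C) (𝓝 (0, z)) (𝓝 0) := by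
      have : Continuous fun q : ℝ × Plane => |q.1| * C := by fun_prop
      simpa using this.tendsto (0, z)
    refine squeeze_zero (fun _ => norm_nonneg _) (fun q => ?_) h1
    rw [norm_smul, Real.norm_eq_abs]
    exact mul_le_mul_of_nonneg_left (hC _) (abs_nonneg _)
  · have h1 : ContinuousAt (fun q : ℝ × Plane => p + q.1⁻¹ • (q.2 - p)) (t, z) :=
      continuousAt_const.add ((continuousAt_fst.inv₀ ht).smul
        (continuousAt_snd.sub continuousAt_const))
    exact continuousAt_fst.smul
      ((ContinuousAt.comp (f := fun q : ℝ × Plane => p + q.1⁻¹ • (q.2 - p))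
      hg.continuousAt h1).sub h1)

theorem alexander_bijective {p : Plane} {g : Plane → Plane} (hg : g.Bijective) (t : ℝ) :
    (alexander p g t).Bijective := by
  by_cases ht : t = 0
  · subst ht
    rw [show alexander p g 0 = id from funext fun z => alexander_zero p g z]
    exact Function.bijective_id
  · obtain ⟨h, hhg, hgh⟩ := Function.bijective_iff_has_inverse.1 hg
    refine Function.bijective_iff_has_inverse.2 ⟨alexander p h t, fun z => ?_, fun z => ?_⟩
    · rw [alexander_of_ne ht, alexander_of_ne ht, add_sub_cancel_left, smul_smul,
        inv_mul_cancel₀ ht,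
        one_smul, add_sub_cancel, hhg, add_sub_cancel_left, smul_smul, mul_inv_cancel₀ ht, one_smul,
        add_sub_cancel]
    · rw [alexander_of_ne ht, alexander_of_ne ht, add_sub_cancel_left, smul_smul,
        inv_mul_cancel₀ ht,
        one_smul, add_sub_cancel, hgh, add_sub_cancel_left, smul_smul, mul_inv_cancel₀ ht, one_smul,
        add_sub_cancel]

theorem norm_alexander_sub_le {p : Plane} {g : Plane → Plane} {C : ℝ} (hC : ∀ z, ‖g z - z‖ ≤ C)
    {t : ℝ} (h0 : 0 ≤ t) (h1 : t ≤ 1) (z : Plane) : ‖alexander p g t z - z‖ ≤ C := by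
  rw [alexander, add_sub_cancel_left, norm_smul, Real.norm_eq_abs, abs_of_nonneg h0]
  exact (mul_le_of_le_one_left (norm_nonneg _) h1).trans (hC _)

theorem alexander_eq_self {p : Plane} {g : Plane → Plane} {E : Set Plane} (hE : ∀ z ∈ E, g z = z)
    (hstar : ∀ z ∈ E, ∀ r : ℝ, 1 ≤ r → p + r • (z - p) ∈ E) {t : ℝ} (h0 : 0 ≤ t) (h1 : t ≤ 1)
    {z : Plane} (hz : z ∈ E) : alexander p g t z = z := by
  rcases h0.eq_or_lt with h | h
  · rw [← h, alexander_zero]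
  · rw [alexander, hE _ (hstar z hz _ ((one_le_inv₀ h).2 h1)), sub_self, smul_zero, add_zero]

/-- Periodizations of homeomorphisms supported in a rectangle are isotopic to the identity. -/
theorem iso_periodize {σ : ℤ} (hσ : σ = 1 ∨ σ = -1) {c : ℝ} {g : Plane → Plane} (hg : Continuous g)
    (hb : g.Bijective) {C : ℝ} (hC : ∀ z, ‖g z - z‖ ≤ C) (hid : ∀ z ∈ cellOut c, g z = z)
    (hid' : ∀ z : Plane, 1 ≤ |z.2| → g z = z) :
    Iso (deck σ) univ (𝓟 {z | 1 ≤ |z.2|}) (periodize σ c g) := by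
  set p : Plane := (c, 0)
  have hA := (continuous_alexander (p := p) hg hC).comp
    (continuous_subtype_val.prodMap continuous_id : Continuous fun q : unitInterval × Plane => _)
  have hout : ∀ t : unitInterval, ∀ z ∈ cellOut c, alexander p g t z = z := by
    intro t z hz
    refine alexander_eq_self hid (fun z hz r hr => ?_) t.2.1 t.2.2 hz
    simp only [cellOut, mem_ofPred_eq, p, Prod.fst_add, Prod.smul_fst, Prod.fst_sub, smul_eq_mul,
      add_sub_cancel_left, abs_mul, abs_of_nonneg (zero_le_one.trans hr)] at hz ⊢
    nlinarith [abs_nonneg (z.1 - c)]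
  have hout' : ∀ t : unitInterval, ∀ z ∈ {z : Plane | 1 ≤ |z.2|}, alexander p g t z = z := by
    intro t z hz
    refine alexander_eq_self (E := {z : Plane | 1 ≤ |z.2|}) hid' (fun z hz r hr => ?_) t.2.1 t.2.2
      hz
    simp only [mem_ofPred_eq, p, Prod.snd_add, Prod.smul_snd, Prod.snd_sub, smul_eq_mul,
      zero_add, sub_zero, abs_mul, abs_of_nonneg (zero_le_one.trans hr)] at hz ⊢
    nlinarith [abs_nonneg z.2]
  refine ⟨fun q => periodize σ c (alexander p g q.1) q.2,
    continuous_periodize hσ (g := fun q : unitInterval × Plane => alexander p g q.1 q.2) hA hout,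
    fun t => periodize_bijective hσ (alexander_bijective hb t) (hout t), ⟨C, fun t z => ?_⟩,
    fun t z => periodize_deck hσ _ z, by simp, ?_, fun z => ?_, fun z => ?_⟩
  · simp only [periodize]
    have := (norm_deckPow_sub hσ (cellIdx c z) _ _).trans_le
      (norm_alexander_sub_le (p := p) hC t.2.1 t.2.2 (deckPow σ (-cellIdx c z) z))
    rwa [deckPow_deckPow_neg hσ] at this
  · rw [eventually_principal]
    intro z hz t
    simp only [periodize]
    rw [hout' t _ (by rwa [mem_ofPred_eq, abs_deckPow_snd hσ]), deckPow_deckPow_neg hσ]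
  · simp only [periodize, Set.Icc.coe_zero, alexander_zero]
    exact deckPow_deckPow_neg hσ _ _
  · simp only [periodize, Set.Icc.coe_one, alexander_one]

namespace Iso

variable {T : Plane → Plane} {S : Set Plane} {𝓕 : Filter Plane} {f : Plane → Plane}

theorem continuous (hf : Iso T S 𝓕 f) : Continuous f := by
  obtain ⟨F, h1, -, -, -, -, -, -, h8⟩ := hf
  rw [show f = fun z => F (1, z) from funext fun z => (h8 z).symm]
  fun_prop

theorem bijective (hf : Iso T S 𝓕 f) : f.Bijective := by
  obtain ⟨F, -, h2, -, -, -, -, -, h8⟩ := hf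
  rw [show f = fun z => F (1, z) from funext fun z => (h8 z).symm]
  exact h2 1

theorem comm (hf : Iso T S 𝓕 f) (z : Plane) : f (T z) = T (f z) := by
  obtain ⟨F, -, -, -, h4, -, -, -, h8⟩ := hf
  rw [← h8, ← h8, h4]

theorem eventually_eq (hf : Iso T S 𝓕 f) : ∀ᶠ z in 𝓕, f z = z := by
  obtain ⟨F, -, -, -, -, -, h6, -, h8⟩ := hf
  filter_upwards [h6] with z hz
  rw [← h8, hz]

theorem exists_inverse (hf : Iso T S 𝓕 f) :
    ∃ g, Iso T S 𝓕 g ∧ (∀ z, g (f z) = z) ∧ ∀ z, f (g z) = z := by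
  obtain ⟨g, h1, h2⟩ := Function.bijective_iff_has_inverse.1 hf.bijective
  exact ⟨g, hf.symm h1, h1, h2⟩

end Iso

/-- A map commuting with the deck transformation and fixing the outside of the strip `|y| < 1` has
bounded displacement. -/
theorem exists_norm_sub_le {σ : ℤ} (hσ : σ = 1 ∨ σ = -1) {H : Plane → Plane} (hH : Continuous H)
    (hd : ∀ z, H (deck σ z) = deck σ (H z)) (hid : ∀ z : Plane, 1 ≤ |z.2| → H z = z) :
    ∃ C, ∀ z, ‖H z - z‖ ≤ C := by
  obtain ⟨C, hC⟩ := (isCompact_Icc.prod isCompact_Icc : IsCompact (Icc (0 : ℝ) 1 ×ˢ Icc (-1 : ℝ) 1))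
    |>.exists_bound_of_continuousOn (hH.sub continuous_id).continuousOn
  refine ⟨max C 0, fun z => ?_⟩
  rcases le_or_gt 1 |z.2| with h | h
  · rw [hid z h]; simp
  refine le_trans ?_ (le_max_left _ _)
  have h1 := hC (deckPow σ (-⌊z.1⌋) z) ⟨⟨?_, ?_⟩, ?_⟩
  · rw [Pi.sub_apply, id, deckPow_comm hσ hd, norm_deckPow_sub hσ] at h1
    exact h1
  · have := Int.floor_le z.1
    simp only [deckPow]; push_cast; linarith
  · have := Int.lt_floor_add_one z.1
    simp only [deckPow]; push_cast; linarith
  · rw [mem_Icc, ← _root_.abs_le, abs_deckPow_snd hσ]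
    exact h.le

section Squeeze

/-- The factor by which the plane is squeezed radially into the strip `|x| < 1/2`. -/
def squeezeFactor (x : ℝ) : ℝ := max 1 (1 / 2 + 2 * |x|)

/-- The factor of the inverse of the squeezing. -/
def spreadFactor (x : ℝ) : ℝ := max 1 (1 / (2 - 4 * |x|))

/-- The radial embedding of the plane into the strip `|x| < 1/2`. -/
def squeeze (z : Plane) : Plane := (squeezeFactor z.1)⁻¹ • z

/-- The inverse of the squeezing. -/
def spread (z : Plane) : Plane := spreadFactor z.1 • z

theorem one_le_squeezeFactor (x : ℝ) : 1 ≤ squeezeFactor x := le_max_left _ _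

theorem one_le_spreadFactor (x : ℝ) : 1 ≤ spreadFactor x := le_max_left _ _

theorem continuous_squeezeFactor : Continuous squeezeFactor := by
  unfold squeezeFactor; fun_prop

theorem continuous_squeeze : Continuous squeeze := by
  unfold squeeze
  exact ((continuous_squeezeFactor.comp continuous_fst).inv₀
    fun z => (zero_lt_one.trans_le (one_le_squeezeFactor _)).ne').smul continuous_id

theorem squeezeFactor_spread {z : Plane} (hz : |z.1| < 1 / 2) :
    squeezeFactor (spread z).1 = spreadFactor z.1 := by
  have h0 : 0 < 2 - 4 * |z.1| := by linarith
  have h1 := one_le_spreadFactor z.1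
  rw [spread, Prod.smul_fst, smul_eq_mul, squeezeFactor, abs_mul, abs_of_nonneg (by linarith)]
  rcases le_total |z.1| (1 / 4) with h | h
  · have e : spreadFactor z.1 = 1 := by
      rw [spreadFactor, max_eq_left]
      rw [div_le_one h0]; linarith
    rw [e, max_eq_left]; linarith
  · have e : spreadFactor z.1 = 1 / (2 - 4 * |z.1|) := by
      rw [spreadFactor, max_eq_right]
      rw [le_div_iff₀ h0]; linarith
    rw [e, max_eq_right]
    · field_simp; ring
    · rw [div_mul_eq_mul_div, one_mul, ← sub_le_iff_le_add', ← mul_div_assoc, le_div_iff₀ h0]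
      linarith

theorem squeeze_spread {z : Plane} (hz : |z.1| < 1 / 2) : squeeze (spread z) = z := by
  have h1 := one_le_spreadFactor z.1
  rw [squeeze, squeezeFactor_spread hz, spread, smul_smul, inv_mul_cancel₀ (by linarith), one_smul]

theorem abs_squeeze_fst (z : Plane) : |(squeeze z).1| < 1 / 2 := by
  have h1 := one_le_squeezeFactor z.1
  rw [squeeze, Prod.smul_fst, smul_eq_mul, abs_mul, abs_inv, abs_of_nonneg (by linarith),
    inv_mul_lt_iff₀ (by linarith)]
  have := le_max_right 1 (1 / 2 + 2 * |z.1|)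
  rw [← squeezeFactor] at this
  linarith

theorem squeeze_eq_self {z : Plane} (hz : |z.1| ≤ 1 / 4) : squeeze z = z := by
  rw [squeeze, squeezeFactor, max_eq_left (by linarith), inv_one, one_smul]

theorem spread_squeeze (z : Plane) : spread (squeeze z) = z := by
  have h1 := one_le_squeezeFactor z.1
  suffices h : spreadFactor (squeeze z).1 = squeezeFactor z.1 by
    rw [spread, h, squeeze, smul_smul, mul_inv_cancel₀ (by linarith), one_smul]
  have h2 := abs_squeeze_fst z
  rcases le_total |z.1| (1 / 4) with h | h
  · rw [squeeze_eq_self h, spreadFactor, squeezeFactor, max_eq_left, max_eq_left] <;>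
      [linarith; (rw [div_le_one] <;> linarith)]
  · have e : squeezeFactor z.1 = 1 / 2 + 2 * |z.1| := max_eq_right (by linarith)
    have e1 : |(squeeze z).1| = |z.1| / (1 / 2 + 2 * |z.1|) := by
      rw [squeeze, Prod.smul_fst, smul_eq_mul, abs_mul, abs_inv, abs_of_nonneg (by linarith), e,
        inv_mul_eq_div]
    have e2 : 2 - 4 * |(squeeze z).1| = 1 / (1 / 2 + 2 * |z.1|) := by
      rw [e1]; field_simp; ring
    rw [spreadFactor, e2, one_div_one_div, e, max_eq_right (by linarith)]

theorem continuousAt_spread {z : Plane} (hz : |z.1| < 1 / 2) : ContinuousAt spread z := by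
  unfold spread spreadFactor
  refine ContinuousAt.smul (ContinuousAt.comp (g := fun x : ℝ => max 1 x)
    (continuous_const.max continuous_id).continuousAt (ContinuousAt.div continuousAt_const ?_ ?_))
    continuousAt_id
  · have : Continuous fun z : Plane => 2 - 4 * |z.1| := by fun_prop
    exact this.continuousAt (x := z)
  · linarith

/-- The conjugate by the squeezing of a self-map of the plane, extended by the identity. -/
def squeezeConj (h : Plane → Plane) (z : Plane) : Plane :=
  open Classical in if |z.1| < 1 / 2 then squeeze (h (spread z)) else z

theorem squeezeConj_of_lt (h : Plane → Plane) {z : Plane} (hz : |z.1| < 1 / 2) :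
    squeezeConj h z = squeeze (h (spread z)) := if_pos hz

theorem squeezeConj_of_le (h : Plane → Plane) {z : Plane} (hz : 1 / 2 ≤ |z.1|) :
    squeezeConj h z = z := if_neg hz.not_gt

theorem squeezeConj_squeezeConj (h h' : Plane → Plane) (z : Plane) :
    squeezeConj h (squeezeConj h' z) = squeezeConj (h ∘ h') z := by
  rcases lt_or_ge |z.1| (1 / 2) with hz | hz
  · rw [squeezeConj_of_lt h' hz, squeezeConj_of_lt _ (abs_squeeze_fst _), spread_squeeze,
      squeezeConj_of_lt _ hz, Function.comp]
  · rw [squeezeConj_of_le _ hz, squeezeConj_of_le _ hz, squeezeConj_of_le _ hz]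

theorem squeezeConj_bijective {h : Plane → Plane} (hb : h.Bijective) : (squeezeConj h).Bijective :=
    by
  obtain ⟨g, h1, h2⟩ := Function.bijective_iff_has_inverse.1 hb
  have hp : ∀ z, squeezeConj id z = z := fun z => by
    rcases lt_or_ge |z.1| (1 / 2) with hz | hz
    · rw [squeezeConj_of_lt _ hz, id, squeeze_spread hz]
    · rw [squeezeConj_of_le _ hz]
  refine Function.bijective_iff_has_inverse.2 ⟨squeezeConj g, fun z => ?_, fun z => ?_⟩
  · rw [squeezeConj_squeezeConj, show g ∘ h = id from funext h1, hp]
  · rw [squeezeConj_squeezeConj, show h ∘ g = id from funext h2, hp]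

theorem abs_squeezeFactor_sub_le (x y : ℝ) : |squeezeFactor x - squeezeFactor y| ≤ 2 * |x - y| := by
  unfold squeezeFactor
  rw [max_comm 1, max_comm 1]
  refine (abs_max_sub_max_le_abs _ _ _).trans ?_
  have := abs_abs_sub_abs_le x y
  rw [show 1 / 2 + 2 * |x| - (1 / 2 + 2 * |y|) = 2 * (|x| - |y|) by ring, abs_mul, abs_two]
  linarith

variable {h : Plane → Plane}

theorem squeezeConj_eq_self (hid : ∀ z : Plane, 1 ≤ |z.2| → h z = z) {z : Plane} (hz : 1 ≤ |z.2|) :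
    squeezeConj h z = z := by
  rcases lt_or_ge |z.1| (1 / 2) with hz' | hz'
  · rw [squeezeConj_of_lt _ hz', hid, squeeze_spread hz']
    have h1 := one_le_spreadFactor z.1
    rw [spread, Prod.smul_snd, smul_eq_mul, abs_mul, abs_of_nonneg (by linarith)]
    nlinarith
  · exact squeezeConj_of_le _ hz'

theorem norm_squeeze_sub_le {C : ℝ} (hC0 : 0 ≤ C) {w w' : Plane} (hw : ‖w' - w‖ ≤ C)
    (hw' : ‖w‖ ≤ squeezeFactor w.1) :
    ‖squeeze w' - squeeze w‖ ≤ 3 * C * (1 + 2 * C) * (squeezeFactor w.1)⁻¹ := by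
  set l := squeezeFactor w.1 with hl
  set l' := squeezeFactor w'.1 with hl'
  have a1 : 1 ≤ l := one_le_squeezeFactor _
  have a2 : 1 ≤ l' := one_le_squeezeFactor _
  have a3 : |l - l'| ≤ 2 * C := by
    rw [abs_sub_comm]
    refine (abs_squeezeFactor_sub_le _ _).trans ?_
    have := (norm_fst_le (w' - w)).trans hw
    rw [Prod.fst_sub, Real.norm_eq_abs] at this
    linarith
  have e : squeeze w' - squeeze w = l'⁻¹ • (w' - w) + (l'⁻¹ * (l - l') * l⁻¹) • w := by
    have : l'⁻¹ * (l - l') * l⁻¹ = l'⁻¹ - l⁻¹ := by field_simp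
    rw [this, squeeze, squeeze]
    module
  have b1 : ‖squeeze w' - squeeze w‖ ≤ 3 * C * l'⁻¹ := by
    rw [e]
    refine (norm_add_le _ _).trans ?_
    rw [norm_smul, norm_smul, Real.norm_eq_abs, Real.norm_eq_abs, abs_mul, abs_mul, abs_inv,
      abs_inv,
      abs_of_nonneg (by linarith : 0 ≤ l), abs_of_nonneg (by linarith : 0 ≤ l')]
    have c1 : l'⁻¹ * ‖w' - w‖ ≤ l'⁻¹ * C := by gcongr
    have c2 : l'⁻¹ * |l - l'| * l⁻¹ * ‖w‖ ≤ l'⁻¹ * (2 * C) * l⁻¹ * l := by gcongr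
    rw [inv_mul_cancel_right₀ (by linarith)] at c2
    linarith
  refine b1.trans ?_
  rw [mul_assoc (3 * C)]
  refine mul_le_mul_of_nonneg_left ?_ (by linarith)
  rw [← div_eq_mul_inv, inv_eq_one_div, div_le_div_iff₀ (by linarith) (by linarith)]
  have := (abs_sub_le_iff.1 a3).1
  nlinarith

theorem norm_squeezeConj_sub_le {C : ℝ} (hC : ∀ z, ‖h z - z‖ ≤ C)
    (hid : ∀ z : Plane, 1 ≤ |z.2| → h z = z) (z : Plane) :
    ‖squeezeConj h z - z‖ ≤ 3 * C * (1 + 2 * C) * max 0 (2 - 4 * |z.1|) := by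
  have hC0 : 0 ≤ C := (norm_nonneg _).trans (hC 0)
  rcases le_or_gt 1 |z.2| with hz | hz
  · rw [squeezeConj_eq_self hid hz, sub_self, norm_zero]
    positivity
  rcases lt_or_ge |z.1| (1 / 2) with hz' | hz'
  · have hs := squeezeFactor_spread hz'
    have h1 := one_le_spreadFactor z.1
    have := norm_squeeze_sub_le hC0 (hC (spread z)) ?_
    · rw [hs, squeeze_spread hz'] at this
      rw [squeezeConj_of_lt _ hz']
      refine this.trans (mul_le_mul_of_nonneg_left ?_ (by positivity))
      refine le_max_of_le_right ?_
      rw [inv_le_comm₀ (by linarith) (by linarith), inv_eq_one_div]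
      exact le_max_right _ _
    · rw [hs, spread, norm_smul, Real.norm_eq_abs, abs_of_nonneg (by linarith)]
      refine mul_le_of_le_one_right (by linarith) ?_
      rw [Prod.norm_def, Real.norm_eq_abs, Real.norm_eq_abs]
      exact max_le (by linarith) hz.le
  · rw [squeezeConj_of_le _ hz', sub_self, norm_zero]
    positivity

theorem continuous_squeezeConj (hc : Continuous h) {C : ℝ} (hC : ∀ z, ‖h z - z‖ ≤ C)
    (hid : ∀ z : Plane, 1 ≤ |z.2| → h z = z) : Continuous (squeezeConj h) := by
  rw [continuous_iff_continuousAt]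
  intro z
  rcases lt_or_ge |z.1| (1 / 2) with hz | hz
  · have h1 : ContinuousAt (fun z => squeeze (h (spread z))) z :=
      continuous_squeeze.continuousAt.comp (hc.continuousAt.comp (continuousAt_spread hz))
    refine h1.congr ?_
    have h2 : IsOpen {z : Plane | |z.1| < 1 / 2} := isOpen_lt (by fun_prop) continuous_const
    filter_upwards [h2.mem_nhds hz] with w hw
    exact (squeezeConj_of_lt _ hw).symm
  · have h1 : Tendsto (fun z => squeezeConj h z - z) (𝓝 z) (𝓝 0) := by
      rw [tendsto_zero_iff_norm_tendsto_zero]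
      refine squeeze_zero (fun _ => norm_nonneg _) (norm_squeezeConj_sub_le hC hid) ?_
      have h2 : Continuous fun z : Plane =>
        3 * C * (1 + 2 * C) * max 0 (2 - 4 * |z.1|) := by fun_prop
      have := h2.tendsto z
      rwa [max_eq_left (by linarith), mul_zero] at this
    have h2 := h1.add (tendsto_id (α := Plane) (x := 𝓝 z))
    rw [ContinuousAt, squeezeConj_of_le _ hz]
    simpa using h2

end Squeeze

section Core

variable {σ : ℤ} (hσ : σ = 1 ∨ σ = -1)

include hσ

/-- Equivariant homeomorphisms fixing the integral vertical lines are isotopic to the identity. -/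
theorem iso_of_fix_lines {H : Plane → Plane} (hc : Continuous H) (hb : H.Bijective)
    (hd : ∀ z, H (deck σ z) = deck σ (H z)) (hid : ∀ z : Plane, 1 ≤ |z.2| → H z = z)
    (hl : ∀ z : Plane, ∀ k : ℤ, z.1 = k → H z = z) : Iso (deck σ) univ (𝓟 {z | 1 ≤ |z.2|}) H := by
  obtain ⟨C, hC⟩ := exists_norm_sub_le hσ hc hd hid
  have hin : ∀ z : Plane, z.1 ∈ Ioo (0 : ℝ) 1 → (H z).1 ∈ Ioo (0 : ℝ) 1 := by
    have hpre : IsPreconnected ((fun z => (H z).1) '' {z : Plane | z.1 ∈ Ioo (0 : ℝ) 1}) := by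
      refine IsPreconnected.image ?_ _ (continuous_fst.comp hc).continuousOn
      exact ((convex_Ioo (0 : ℝ) 1).linear_preimage (LinearMap.fst ℝ ℝ ℝ)).isPreconnected
    have hmid : (1 / 2 : ℝ) ∈ (fun z => (H z).1) '' {z : Plane | z.1 ∈ Ioo (0 : ℝ) 1} := by
      refine ⟨(1 / 2, 1), by norm_num, ?_⟩
      simp only [hid (1 / 2, 1) (by simp)]
    have hno : ∀ k : ℤ, (k = 0 ∨ k = 1) →
        (k : ℝ) ∉ (fun z => (H z).1) '' {z : Plane | z.1 ∈ Ioo (0 : ℝ) 1} := by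
      rintro k hk ⟨z, hz, hzk⟩
      simp only at hzk
      have := hb.1 (hl _ k hzk)
      rw [this] at hzk
      rw [mem_ofPred_eq, hzk] at hz
      rcases hk with rfl | rfl <;> simp at hz
    intro z hz
    have hz' := mem_image_of_mem (fun z => (H z).1) (show z ∈ {z : Plane | z.1 ∈ Ioo (0 : ℝ) 1} from
      hz)
    constructor
    · by_contra! hle
      exact hno 0 (.inl rfl) (by simpa using hpre.Icc_subset hz' hmid ⟨hle, by norm_num⟩)
    · by_contra! hle
      exact hno 1 (.inr rfl) (by simpa using hpre.Icc_subset hmid hz' ⟨by norm_num, hle⟩)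
  have hout : ∀ z : Plane, z.1 ∉ Ioo (0 : ℝ) 1 → (H z).1 ∉ Ioo (0 : ℝ) 1 := by
    intro z hz hz'
    by_cases hk : ∃ k : ℤ, z.1 = k
    · obtain ⟨k, hk⟩ := hk
      rw [hl _ k hk] at hz'
      exact hz hz'
    · have h1 : (deckPow σ (-⌊z.1⌋) z).1 ∈ Ioo (0 : ℝ) 1 := by
        simp only [deckPow]
        have f1 := (Int.floor_le z.1).lt_of_ne (fun h => hk ⟨_, h.symm⟩)
        have f2 := Int.lt_floor_add_one z.1
        push_cast
        constructor <;> linarith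
      have h2 := hin _ h1
      rw [deckPow_comm hσ hd] at h2
      simp only [deckPow] at h2
      push_cast at h2
      have h0 : ⌊z.1⌋ = 0 := by
        have e1 : (⌊z.1⌋ : ℝ) < 1 := by linarith [h2.1, hz'.2]
        have e2 : (-1 : ℝ) < ⌊z.1⌋ := by linarith [h2.2, hz'.1]
        have e1' : ⌊z.1⌋ < 1 := by exact_mod_cast e1
        have e2' : -1 < ⌊z.1⌋ := by exact_mod_cast e2
        omega
      rw [h0] at h1
      simp [deckPow] at h1
      exact hz h1
  have hcell : ∀ z : Plane, z ∉ cellOut (1 / 2) ↔ z.1 ∈ Ioo (0 : ℝ) 1 := by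
    intro z
    rw [cellOut, mem_ofPred_eq, not_le, abs_lt, mem_Ioo]
    constructor <;> rintro ⟨h1, h2⟩ <;> constructor <;> linarith
  classical
  let g : Plane → Plane := fun z => if |z.1 - 1 / 2| ≤ 1 / 2 then H z else z
  have hedge : ∀ z : Plane, |z.1 - 1 / 2| = 1 / 2 → H z = z := by
    intro z hz
    rcases (abs_eq (by norm_num)).1 hz with h | h
    · exact hl z 1 (by push_cast; linarith)
    · exact hl z 0 (by push_cast; linarith)
  have hgc : Continuous g :=
    Continuous.if_le hc continuous_id (by fun_prop) continuous_const hedge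
  have hgout : ∀ z ∈ cellOut (1 / 2), g z = z := by
    intro z hz
    rw [cellOut, mem_ofPred_eq] at hz
    by_cases h : |z.1 - 1 / 2| ≤ 1 / 2
    · simp only [g, if_pos h]
      exact hedge z (h.antisymm hz)
    · simp only [g, if_neg h]
  have hgin : ∀ z : Plane, |z.1 - 1 / 2| ≤ 1 / 2 → g z = H z := fun z hz => if_pos hz
  have hgin' : ∀ z, z ∉ cellOut (1 / 2) → g z = H z := fun z hz => by
    rw [cellOut, mem_ofPred_eq, not_le] at hz
    exact hgin z hz.le
  have hgb : g.Bijective := by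
    constructor
    · intro z w hzw
      by_cases h1 : z ∈ cellOut (1 / 2) <;> by_cases h2 : w ∈ cellOut (1 / 2)
      · rwa [hgout _ h1, hgout _ h2] at hzw
      · rw [hgout _ h1, hgin' _ h2] at hzw
        rw [hzw] at h1
        exact absurd h1 ((hcell _).2 (hin _ ((hcell _).1 h2)))
      · rw [hgout _ h2, hgin' _ h1] at hzw
        rw [← hzw] at h2
        exact absurd h2 ((hcell _).2 (hin _ ((hcell _).1 h1)))
      · rw [hgin' _ h1, hgin' _ h2] at hzw
        exact hb.1 hzw
    · intro w
      by_cases h1 : w ∈ cellOut (1 / 2)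
      · exact ⟨w, hgout _ h1⟩
      · obtain ⟨z, rfl⟩ := hb.2 w
        refine ⟨z, hgin' z ?_⟩
        rw [hcell]
        by_contra h2
        exact hout z h2 ((hcell _).1 h1)
  have hgC : ∀ z, ‖g z - z‖ ≤ C := by
    intro z
    by_cases h : z ∈ cellOut (1 / 2)
    · rw [hgout _ h, sub_self, norm_zero]
      exact (norm_nonneg _).trans (hC 0)
    · rw [hgin' _ h]; exact hC z
  have hgy : ∀ z : Plane, 1 ≤ |z.2| → g z = z := by
    intro z hz
    by_cases h : z ∈ cellOut (1 / 2)
    · exact hgout _ h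
    · rw [hgin' _ h, hid _ hz]
  have key := iso_periodize hσ hgc hgb hgC hgout hgy
  have : periodize σ (1 / 2) g = H := by
    funext z
    refine periodize_of_cell hσ hd (fun z hz => hgin z ?_) z
    rw [cellIdx, Int.floor_eq_zero_iff] at hz
    rw [_root_.abs_le]
    constructor <;> linarith [hz.1, hz.2]
  rwa [this] at key

/-- Equivariant homeomorphisms of the plane supported in `|y| < 1/2` are equivariantly isotopic to
the identity. -/
theorem iso_core (H : Plane ≃ₜ Plane) (hd : ∀ z, H (deck σ z) = deck σ (H z))
    (hid : ∀ z, 1 / 2 ≤ |z.2| → H z = z) : Iso (deck σ) univ (𝓟 {z | 1 ≤ |z.2|}) H := by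
  obtain ⟨n₀, hn₀⟩ := exists_arcTrace hσ H hd hid
  obtain ⟨n, hn, hn'⟩ : ∃ n, n₀ ≤ n ∧ 12 ≤ n := ⟨max n₀ 12, le_max_left _ _, le_max_right _ _⟩
  obtain ⟨f, hf, hfx⟩ := exists_straightening (hn₀ n hn) hσ (by omega)
  obtain ⟨f', hf', hff, -⟩ := hf.exists_inverse
  have hH1 : ∀ z : Plane, |z.2| ≤ 1 → |(H z).2| ≤ 1 := by
    intro z hz
    by_contra! h
    have := H.injective (hid (H z) (by linarith))
    rw [this] at h
    linarith
  set h : Plane → Plane := f ∘ H with hh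
  have hcont : Continuous h := hf.continuous.comp H.continuous
  have hbij : h.Bijective := hf.bijective.comp H.bijective
  have hdeck : ∀ z, h (deck σ z) = deck σ (h z) := fun z => by
    simp only [hh, Function.comp, hd, hf.comm]
  have hfix : ∀ z : Plane, 1 ≤ |z.2| → h z = z := by
    intro z hz
    have h1 := hf.eventually_eq
    rw [eventually_principal] at h1
    simp only [hh, Function.comp]
    rw [hid z (by linarith), h1 z hz]
  obtain ⟨C, hC⟩ := exists_norm_sub_le hσ hcont hdeck hfix
  have hsmall : ∀ z : Plane, z.1 = 0 → |z.2| ≤ 1 → |(h z).1| ≤ 1 / 4 := by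
    intro z hz hz'
    refine (hfx (H z) (hH1 z hz') fun v hv => ⟨H z, ⟨z, ⟨by simpa using hz, hz'⟩, rfl⟩, hv⟩).trans
      ?_
    rw [div_le_div_iff₀ (by positivity) (by norm_num)]
    have : (12 : ℝ) ≤ n := by exact_mod_cast hn'
    linarith
  have hC0 : 0 ≤ C := (norm_nonneg _).trans (hC 0)
  have hG := iso_periodize hσ (c := 0) (C := 3 * C * (1 + 2 * C) * 2)
    (continuous_squeezeConj hcont hC hfix)
    (squeezeConj_bijective hbij) (fun z => (norm_squeezeConj_sub_le hC hfix z).trans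
      (mul_le_mul_of_nonneg_left (max_le (by norm_num) (by linarith [abs_nonneg z.1]))
        (by positivity)))
    (fun z hz => squeezeConj_of_le _ (by simpa [cellOut] using hz))
    (fun z hz => squeezeConj_eq_self hfix hz)
  set p := periodize σ 0 (squeezeConj h) with hp
  have hline : ∀ z : Plane, ∀ k : ℤ, z.1 = k → p z = h z := by
    have h0 : ∀ z : Plane, z.1 = 0 → p z = h z := by
      intro z hz
      have e : spread z = z := by
        rw [spread, spreadFactor, hz]; norm_num
      rw [hp, periodize_eq_of_cellIdx _ (by rw [cellIdx, hz]; norm_num)]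
      rcases le_total 1 |z.2| with h1 | h1
      · rw [squeezeConj_eq_self hfix h1, hfix _ h1]
      · rw [squeezeConj_of_lt _ (by rw [hz]; norm_num), e, squeeze_eq_self (hsmall z hz h1)]
    intro z k hk
    rw [← deckPow_deckPow_neg hσ k z, deckPow_comm hσ hdeck, deckPow_comm hσ hG.comm, h0]
    simp [deckPow, hk]
  obtain ⟨p', hp', hpp, hpp'⟩ := hG.exists_inverse
  have hlast := iso_of_fix_lines hσ (H := p' ∘ h) (hp'.continuous.comp hcont)
    (hp'.bijective.comp hbij)
    (fun z => by simp only [Function.comp, hdeck, hp'.comm]) (fun z hz => by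
      have h1 := hp'.eventually_eq
      rw [eventually_principal] at h1
      simp only [Function.comp]
      rw [hfix z hz, h1 z hz]) (fun z k hk => by
      simp only [Function.comp]
      rw [← hline z k hk, hpp])
  have := hf'.comp (hG.comp hlast)
  refine (congrArg _ (funext fun z => ?_)).mp this
  simp only [hh, Function.comp, hpp', hff]

end Core

theorem mem_iff_of_eq_self {α : Type*} {S : Set α} {f : α → α} (hf : f.Injective)
    (h : ∀ z ∉ S, f z = z) (z : α) : f z ∈ S ↔ z ∈ S := by
  constructor
  · intro hz
    by_contra h'
    rw [h z h'] at hz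
    exact h' hz
  · intro hz
    by_contra h'
    rw [hf (h _ h')] at h'
    exact h' hz

theorem Iso.of_univ {T : Plane → Plane} {S E : Set Plane} {𝓕 : Filter Plane} {f : Plane → Plane}
    (hf : Iso T univ (𝓟 E) f) (hS : Sᶜ ⊆ E) (hl : 𝓕 ≤ 𝓟 E) : Iso T S 𝓕 f := by
  obtain ⟨F, h1, h2, h3, h4, -, h6, h7⟩ := hf
  rw [eventually_principal] at h6
  exact ⟨F, h1, h2, h3, h4, fun t => mem_iff_of_eq_self (h2 t).1 fun z hz => h6 z (hS hz) t,
    (eventually_principal.2 h6).filter_mono hl, h7⟩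

theorem exists_homeomorph_of_bijective {f : Plane → Plane} (hf : Continuous f) (hb : f.Bijective)
    {C : ℝ}
    (hC : ∀ z, ‖f z - z‖ ≤ C) : ∃ e : Plane ≃ₜ Plane, ⇑e = f := by
  have := continuous_family_inverse (F := fun p : Unit × Plane => f p.2)
    (G := fun p => (Equiv.ofBijective f hb).symm p.2) (by fun_prop) (fun t z => hC z)
    (fun t z => (Equiv.ofBijective f hb).symm_apply_apply z)
    (fun t z => (Equiv.ofBijective f hb).apply_symm_apply z)
  exact ⟨⟨Equiv.ofBijective f hb, hf, this.comp (Continuous.prodMk_right ())⟩, rfl⟩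

/-- An isotopy through conjugates. -/
theorem iso_of_conj {T : Plane → Plane} {S : Set Plane} {𝓕 : Filter Plane} {H : Plane → Plane}
    (hc : Continuous H) (hb : H.Bijective) {C : ℝ} (hC : ∀ z, ‖H z - z‖ ≤ C)
    (hd : ∀ z, H (T z) = T (H z)) {q q' : unitInterval × Plane → Plane} (hq : Continuous q)
    (hq' : Continuous q') (hqq : ∀ t z, q' (t, q (t, z)) = z) (hqq' : ∀ t z, q (t, q' (t, z)) = z)
    (hlip : ∀ t z w, ‖q' (t, z) - q' (t, w)‖ ≤ ‖z - w‖) (hT : ∀ t z, q (t, T z) = T (q (t, z)))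
    (hout : ∀ t, ∀ z ∉ S, H (q (t, z)) = q (t, z))
    (hfix : ∀ᶠ z in 𝓕, ∀ t, H (q (t, z)) = q (t, z)) (h0 : ∀ z, q (0, z) = z)
    (hI : Iso T S 𝓕 fun z => q' (1, H (q (1, z)))) : Iso T S 𝓕 H := by
  have hb' : ∀ t, (fun z => q' (t, H (q (t, z)))).Bijective := by
    intro t
    have b1 : (fun z => q (t, z)).Bijective :=
      Function.bijective_iff_has_inverse.2 ⟨fun z => q' (t, z), hqq t, hqq' t⟩
    have b2 : (fun z => q' (t, z)).Bijective :=
      Function.bijective_iff_has_inverse.2 ⟨fun z => q (t, z), hqq' t, hqq t⟩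
    exact b2.comp (hb.comp b1)
  have hT' : ∀ t z, q' (t, T z) = T (q' (t, z)) := by
    intro t z
    nth_rw 1 [← hqq' t z]
    rw [← hT, hqq]
  have h0' : ∀ z, q' (0, z) = z := fun z => by
    nth_rw 1 [← h0 z]
    rw [hqq]
  have key := Iso.of_path (T := T) (S := S) (𝓕 := 𝓕) (F := fun p => q' (p.1, H (q p))) (by fun_prop)
    hb'
    ⟨C, fun t z => ?_⟩ (fun t z => by simp only [hT, hd, hT'])
    (fun t => mem_iff_of_eq_self (hb' t).1 fun z hz => by rw [hout t z hz, hqq]) ?_ hI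
  · simpa only [h0, h0'] using key
  · have := hlip t (H (q (t, z))) (q (t, z))
    rw [hqq] at this
    exact this.trans (hC _)
  · filter_upwards [hfix] with z hz t
    simp only [hz t, hqq]

/-- An isotopy through horizontal shears. -/
theorem iso_shear {T : Plane → Plane} {S : Set Plane} {𝓕 : Filter Plane} {W : Plane → ℝ}
    (hW : Continuous W) {C : ℝ} (hC : ∀ z, |W z| ≤ C) (hmono : ∀ y, StrictMono fun x =>
      x + W (x, y))
    (hT : ∀ z : Plane, ∀ t : ℝ, T (z.1 + t * W z, z.2) = ((T z).1 + t * W (T z), (T z).2))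
    (hS : ∀ x x' y, (x, y) ∈ S ↔ (x', y) ∈ S) (hfix : ∀ᶠ z in 𝓕, W z = 0) :
    Iso T S 𝓕 fun z => (z.1 + W z, z.2) := by
  have hC0 : 0 ≤ C := (abs_nonneg _).trans (hC 0)
  refine ⟨fun p => (p.2.1 + p.1 * W p.2, p.2.2), by fun_prop, fun t => ?_, ⟨C, fun t z => ?_⟩,
    fun t z => (hT z t).symm, fun t z => hS _ _ _, ?_, by simp, by simp⟩
  · have hm : ∀ y, StrictMono fun x => x + t * W (x, y) := by
      intro y x x' hx
      have e : ∀ x, x + t * W (x, y) = (1 - t) * x + t * (x + W (x, y)) := fun x => by ring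
      simp only [e]
      have h1 := hmono y hx
      simp only at h1
      rcases t.2.1.eq_or_lt with h | h
      · rw [← h]; linarith
      · have := mul_lt_mul_of_pos_left h1 h
        have := mul_le_mul_of_nonneg_left hx.le (sub_nonneg.2 t.2.2)
        linarith
    have hs : ∀ y, Function.Surjective fun x => x + t * W (x, y) := by
      intro y
      have hb : ∀ x, |(t : ℝ) * W (x, y)| ≤ C := fun x => by
        rw [abs_mul, abs_of_nonneg t.2.1]
        exact (mul_le_of_le_one_left (abs_nonneg _) t.2.2).trans (hC _)
      refine Continuous.surjective (by fun_prop) ?_ ?_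
      · refine tendsto_atTop_mono (fun x => ?_) (tendsto_atTop_add_const_right _ (-C) tendsto_id)
        have := neg_le_of_abs_le (hb x)
        simp only [id]; linarith
      · refine tendsto_atBot_mono (fun x => ?_) (tendsto_atBot_add_const_right _ C tendsto_id)
        have := le_of_abs_le (hb x)
        simp only [id]; linarith
    constructor
    · rintro ⟨x, y⟩ ⟨x', y'⟩ h
      obtain ⟨h1, rfl⟩ := Prod.ext_iff.1 h
      simpa using (hm y).injective h1
    · rintro ⟨x, y⟩
      obtain ⟨x', hx'⟩ := hs y x
      exact ⟨(x', y), Prod.ext hx' rfl⟩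
  · rw [Prod.norm_def]
    refine max_le ?_ (by simpa using hC0)
    simp only [Prod.fst_sub, add_sub_cancel_left, Real.norm_eq_abs, abs_mul, abs_of_nonneg t.2.1]
    exact (mul_le_of_le_one_left (abs_nonneg _) t.2.2).trans (hC _)
  · filter_upwards [hfix] with z hz t
    simp only [hz, mul_zero, add_zero]

/-- A continuous injective self-map of the line with bounded displacement is increasing. -/
theorem strictMono_of_bounded {g : ℝ → ℝ} (hg : Continuous g) (hi : g.Injective) {C : ℝ}
    (hC : ∀ x, |g x - x| ≤ C) : StrictMono g := by
  refine (hg.strictMono_of_inj hi).resolve_right fun h => ?_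
  have hC0 : 0 ≤ C := (abs_nonneg _).trans (hC 0)
  have h1 := h (show (0 : ℝ) < 2 * C + 1 by linarith)
  have h2 := neg_le_of_abs_le (hC (2 * C + 1))
  have h3 := le_of_abs_le (hC 0)
  linarith

/-- A convex combination of the identity and strictly increasing functions. -/
theorem strictMono_convex {g h : ℝ → ℝ} (hg : StrictMono g) (hh : StrictMono h) {a b : ℝ}
    (ha : 0 ≤ a)
    (hb : 0 ≤ b) (hab : a + b ≤ 1) : StrictMono fun x => x + (a * (g x - x) + b * (h x - x)) := by
  intro x y hxy
  have e : ∀ x, x + (a * (g x - x) + b * (h x - x)) = (1 - (a + b)) * x + a * g x + b * h x :=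
    fun x => by ring
  simp only [e]
  have h1 := hg hxy
  have h2 := hh hxy
  have h3 := mul_le_mul_of_nonneg_left h1.le ha
  have h4 := mul_le_mul_of_nonneg_left h2.le hb
  have h5 := mul_le_mul_of_nonneg_left hxy.le (sub_nonneg.2 hab)
  by_contra! h6
  rcases ha.eq_or_lt with h | h
  · rcases hb.eq_or_lt with h' | h'
    · rw [← h, ← h'] at h6; linarith
    · have := mul_lt_mul_of_pos_left h2 h'
      linarith
  · have := mul_lt_mul_of_pos_left h1 h
    linarith

/-- A cutoff function. -/
def ramp (y : ℝ) : ℝ := max 0 (min 1 (y - 1))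

theorem continuous_ramp : Continuous ramp := by unfold ramp; fun_prop

theorem ramp_nonneg (y : ℝ) : 0 ≤ ramp y := le_max_left _ _

theorem ramp_le_one (y : ℝ) : ramp y ≤ 1 := max_le zero_le_one (min_le_left _ _)

theorem ramp_of_le {y : ℝ} (hy : y ≤ 1) : ramp y = 0 :=
  max_eq_left ((min_le_right _ _).trans (by linarith))

theorem ramp_of_ge {y : ℝ} (hy : 2 ≤ y) : ramp y = 1 := by
  rw [ramp, min_eq_left (by linarith), max_eq_right zero_le_one]

theorem eventually_conj_eq_self {H : Plane → Plane} {K : Set Plane}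
    {q : unitInterval × Plane → Plane}
    (hq : Continuous q) (h : ∀ z ∈ K, ∀ t, ∀ᶠ w in 𝓝 (q (t, z)), H w = w) :
    ∀ᶠ z in 𝓝ˢ K, ∀ t, H (q (t, z)) = q (t, z) := by
  rw [eventually_nhdsSet_iff_forall]
  intro z hz
  have := isCompact_univ.eventually_forall_of_forall_eventually (x₀ := z)
    (P := fun z t => H (q (t, z)) = q (t, z)) (K := (univ : Set unitInterval)) (fun t _ => ?_)
  · simpa using this
  · have hc : Continuous fun p : Plane × unitInterval => q (p.2, p.1) := by fun_prop
    exact (hc.tendsto (z, t)).eventually (h z hz t)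

/-- Equivariant homeomorphisms of the strip `|y| ≤ 2` fixing a neighbourhood of a subset of the
boundary are equivariantly isotopic to the identity. -/
theorem iso_strip {σ : ℤ} (hσ : σ = 1 ∨ σ = -1) (H : Plane ≃ₜ Plane)
    (hd : ∀ z, H (deck σ z) = deck σ (H z)) (hup : ∀ x y, 2 ≤ y → H (x, y) = ((H (x, 2)).1, y))
    (hdown : ∀ x y, y ≤ -2 → H (x, y) = ((H (x, -2)).1, y)) {K : Set Plane}
    (hK : ∀ z ∈ K, |z.2| = 2) (hfix : ∀ᶠ z in 𝓝ˢ K, H z = z) :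
    Iso (deck σ) {z | |z.2| ≤ 2} (𝓝ˢ K) H := by
  obtain ⟨C, hC⟩ : ∃ C, ∀ z, ‖H z - z‖ ≤ C := by
    obtain ⟨C, hC⟩ := (isCompact_Icc.prod isCompact_Icc : IsCompact
      (Icc (0 : ℝ) 1 ×ˢ Icc (-2 : ℝ) 2))
      |>.exists_bound_of_continuousOn (H.continuous.sub continuous_id).continuousOn
    have h1 : ∀ z : Plane, |z.2| ≤ 2 → ‖H z - z‖ ≤ C := by
      intro z hz
      have h1 := hC (deckPow σ (-⌊z.1⌋) z) ⟨⟨?_, ?_⟩, ?_⟩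
      · rw [Pi.sub_apply, id, deckPow_comm hσ hd, norm_deckPow_sub hσ] at h1
        exact h1
      · have := Int.floor_le z.1
        simp only [deckPow]; push_cast; linarith
      · have := Int.lt_floor_add_one z.1
        simp only [deckPow]; push_cast; linarith
      · rw [mem_Icc, ← _root_.abs_le, abs_deckPow_snd hσ]
        exact hz
    refine ⟨C, fun z => ?_⟩
    obtain ⟨x, y⟩ := z
    rcases le_total 2 y with h | h
    · have := h1 (x, 2) (by simp)
      rw [hup x 2 le_rfl] at this
      rw [hup x y h]
      simpa using this
    rcases le_total y (-2) with h' | h'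
    · have := h1 (x, -2) (by simp)
      rw [hdown x _ le_rfl] at this
      rw [hdown x y h']
      simpa using this
    · exact h1 (x, y) (_root_.abs_le.2 ⟨h', h⟩)
  have hC0 : 0 ≤ C := (norm_nonneg _).trans (hC 0)
  have hx : ∀ x y, |(H (x, y)).1 - x| ≤ C := fun x y => (norm_fst_le _).trans (hC (x, y))
  set g : ℝ → ℝ := fun x => (H (x, 2)).1 with hg
  set g' : ℝ → ℝ := fun x => (H (x, -2)).1 with hg'
  have hgm : StrictMono g := by
    refine strictMono_of_bounded (by fun_prop) (fun x x' h => ?_) (fun x => hx x 2)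
    have : H (x, 2) = H (x', 2) := by rw [hup x 2 le_rfl, hup x' 2 le_rfl]; exact Prod.ext h rfl
    simpa using H.injective this
  have hgm' : StrictMono g' := by
    refine strictMono_of_bounded (by fun_prop) (fun x x' h => ?_) (fun x => hx x (-2))
    have : H (x, -2) = H (x', -2) := by
      rw [hdown x (-2) le_rfl, hdown x' (-2) le_rfl]; exact Prod.ext h rfl
    simpa using H.injective this
  set W : Plane → ℝ := fun z => ramp z.2 * (g z.1 - z.1) + ramp (-z.2) * (g' z.1 - z.1) with hW
  have hramp : ∀ y, ramp y + ramp (-y) ≤ 1 := by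
    intro y
    rcases le_total y 0 with h | h
    · rw [ramp_of_le (by linarith), zero_add]; exact ramp_le_one _
    · rw [ramp_of_le (y := -y) (by linarith), add_zero]; exact ramp_le_one _
  have hWc : Continuous W := by
    have := continuous_ramp
    fun_prop
  have hΨ : Iso (deck σ) {z | |z.2| ≤ 2} (𝓝ˢ K) fun z => (z.1 + W z, z.2) := by
    refine iso_shear hWc (C := C) (fun z => ?_)
      (fun y => strictMono_convex hgm hgm' (ramp_nonneg _) (ramp_nonneg _) (hramp y)) ?_
        (fun _ _ _ => Iff.rfl) ?_
    · refine (abs_add_le _ _).trans ?_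
      rw [abs_mul, abs_mul, abs_of_nonneg (ramp_nonneg _), abs_of_nonneg (ramp_nonneg _)]
      have h1 := mul_le_mul_of_nonneg_left (hx z.1 2) (ramp_nonneg z.2)
      have h2 := mul_le_mul_of_nonneg_left (hx z.1 (-2)) (ramp_nonneg (-z.2))
      have h3 := mul_le_mul_of_nonneg_right (hramp z.2) hC0
      linarith
    · intro z t
      have e1 := congrArg Prod.fst (hd (z.1, 2))
      have e2 := congrArg Prod.fst (hd (z.1, -2))
      simp only [deck] at e1 e2
      rcases hσ with rfl | rfl
      · simp only [Int.cast_one, one_mul] at e1 e2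
        ext
        · simp only [hW, hg, hg', deck, Int.cast_one, one_mul, e1, e2]; ring
        · simp [deck]
      · simp only [Int.cast_neg, Int.cast_one, neg_mul, one_mul, neg_neg] at e1 e2
        ext
        · simp only [hW, hg, hg', deck, Int.cast_neg, Int.cast_one, neg_mul, one_mul, neg_neg, e1,
            e2]; ring
        · simp [deck]
    · rw [eventually_nhdsSet_iff_forall] at hfix ⊢
      rintro ⟨x, y⟩ hz
      have h1 := hfix _ hz
      rcases (abs_eq (by norm_num)).1 (hK _ hz) with h2 | h2
      · simp only at h2
        subst h2
        have c1 : Tendsto (fun z : Plane => (z.1, (2 : ℝ))) (𝓝 (x, 2)) (𝓝 (x, 2)) :=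
          Continuous.tendsto (by fun_prop) (x, (2 : ℝ))
        have o1 : ∀ᶠ z : Plane in 𝓝 (x, 2), 0 < z.2 :=
          (isOpen_lt continuous_const continuous_snd).mem_nhds (by simp)
        filter_upwards [c1.eventually h1, o1] with z hz hz'
        simp only [hW, hg, hz, sub_self, mul_zero, ramp_of_le (show -z.2 ≤ 1 by linarith), zero_mul,
          add_zero]
      · simp only at h2
        subst h2
        have c1 : Tendsto (fun z : Plane => (z.1, (-2 : ℝ))) (𝓝 (x, -2)) (𝓝 (x, -2)) :=
          Continuous.tendsto (by fun_prop) (x, (-2 : ℝ))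
        have o1 : ∀ᶠ z : Plane in 𝓝 (x, -2), z.2 < 0 :=
          (isOpen_lt continuous_snd continuous_const).mem_nhds (by simp)
        filter_upwards [c1.eventually h1, o1] with z hz hz'
        simp only [hW, hg', hz, sub_self, mul_zero, ramp_of_le (show z.2 ≤ 1 by linarith), zero_mul,
          add_zero]
  obtain ⟨Φ, hΦ, hΦ1, hΦ2⟩ := hΨ.exists_inverse
  have hout : ∀ z : Plane, 2 ≤ |z.2| → H (Φ z) = z := by
    intro z hz
    have h1 := hΦ2 z
    have h2 : (Φ z).2 = z.2 := (Prod.ext_iff.1 h1).2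
    nth_rw 2 [← h1]
    rcases le_abs.1 hz with h | h
    · have := hup (Φ z).1 (Φ z).2 (by rwa [h2])
      rw [Prod.mk.eta] at this
      rw [this, hW]
      ext
      · simp only [h2, ramp_of_ge h, ramp_of_le (show -z.2 ≤ 1 by linarith), hg]; ring
      · rfl
    · have := hdown (Φ z).1 (Φ z).2 (by rw [h2]; linarith)
      rw [Prod.mk.eta] at this
      rw [this, hW]
      ext
      · simp only [h2, ramp_of_ge h, ramp_of_le (show z.2 ≤ 1 by linarith), hg']; ring
      · rfl
  have hc : Continuous fun z => H (Φ z) := H.continuous.comp hΦ.continuous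
  have hb : (fun z => H (Φ z)).Bijective := H.bijective.comp hΦ.bijective
  have hd' : ∀ z, H (Φ (deck σ z)) = deck σ (H (Φ z)) := fun z => by rw [hΦ.comm, hd]
  obtain ⟨D, hD⟩ : ∃ D, ∀ z, ‖H (Φ z) - z‖ ≤ D := by
    obtain ⟨F, -, -, ⟨D, h3⟩, -, -, -, -, h8⟩ := hΦ
    refine ⟨C + D, fun z => ?_⟩
    calc ‖H (Φ z) - z‖ = ‖(H (Φ z) - Φ z) + (Φ z - z)‖ := by congr 1; abel
      _ ≤ _ := norm_add_le_of_le (hC _) (by rw [← h8]; exact h3 1 z)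
  have hfix' : ∀ᶠ z in 𝓝ˢ K, H (Φ z) = z := by
    filter_upwards [hfix, hΦ.eventually_eq] with z h1 h2
    rw [h2, h1]
  have hpos : ∀ t : unitInterval, (0 : ℝ) < 1 + 3 * t := fun t => by linarith [t.2.1]
  have hpos' : ∀ t : unitInterval, (1 : ℝ) ≤ 1 + 3 * t := fun t => by linarith [t.2.1]
  have hnear : ∀ z : Plane, 2 < |z.2| → ∀ᶠ w in 𝓝 z, H (Φ w) = w := by
    intro z hz
    have : IsOpen {z : Plane | 2 < |z.2|} := isOpen_lt continuous_const (by fun_prop)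
    filter_upwards [this.mem_nhds hz] with w hw
    exact hout w (show 2 < |w.2| from hw).le
  have h4 : Iso (deck σ) {z | |z.2| ≤ 2} (𝓝ˢ K) fun z => H (Φ z) := by
    refine iso_of_conj hc hb hD hd' (q := fun p => (p.2.1, (1 + 3 * p.1) * p.2.2))
      (q' := fun p => (p.2.1, (1 + 3 * (p.1 : ℝ))⁻¹ * p.2.2)) (by fun_prop)
      (by
        have : Continuous fun p : unitInterval × Plane => (1 + 3 * (p.1 : ℝ))⁻¹ :=
          Continuous.inv₀ (by fun_prop) fun p => (hpos p.1).ne'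
        fun_prop)
      (fun t z => by ext <;> simp [(hpos t).ne']) (fun t z => by ext <;> simp [(hpos t).ne'])
      (fun t z w => ?_) (fun t z => by ext <;> simp [deck]; ring) (fun t z hz => hout _ ?_)
      (eventually_conj_eq_self (H := fun z => H (Φ z))
        (q := fun p => (p.2.1, (1 + 3 * p.1) * p.2.2)) (by fun_prop) fun z hz t => ?_) (by simp) ?_
    · rw [Prod.norm_def, Prod.norm_def]
      refine max_le_max le_rfl ?_
      simp only [Prod.snd_sub, Real.norm_eq_abs, ← mul_sub, abs_mul, abs_inv, abs_of_pos (hpos t)]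
      exact mul_le_of_le_one_left (abs_nonneg _) (inv_le_one_of_one_le₀ (hpos' t))
    · simp only [mem_ofPred_eq, not_le, abs_mul, abs_of_pos (hpos t)] at hz ⊢
      nlinarith [hpos' t]
    · rcases t.2.1.eq_or_lt with h | h
      · simp only [← h, mul_zero, add_zero, one_mul, Prod.mk.eta]
        exact (eventually_nhdsSet_iff_forall.1 hfix') z hz
      · refine hnear _ ?_
        simp only [abs_mul, abs_of_pos (hpos t), hK z hz]
        linarith
    · set G : Plane → Plane := fun z =>
        ((H (Φ (z.1, 4 * z.2))).1, 4⁻¹ * (H (Φ (z.1, 4 * z.2))).2) with hG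
      have hGc : Continuous G := by
        have : Continuous fun z : Plane => H (Φ (z.1, 4 * z.2)) :=
          hc.comp (g := fun z => H (Φ z)) (f := fun z : Plane => (z.1, 4 * z.2)) (by fun_prop)
        exact (continuous_fst.comp this).prodMk (continuous_const.mul (continuous_snd.comp this))
      have hGb : G.Bijective := by
        have b1 : (fun z : Plane => ((z.1, 4 * z.2) : Plane)).Bijective :=
          Function.bijective_iff_has_inverse.2 ⟨fun z => (z.1, 4⁻¹ * z.2),
            fun z => by simp, fun z => by simp⟩
        have b2 : (fun z : Plane => ((z.1, 4⁻¹ * z.2) : Plane)).Bijective :=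
          Function.bijective_iff_has_inverse.2 ⟨fun z => (z.1, 4 * z.2),
            fun z => by simp, fun z => by simp⟩
        exact b2.comp (hb.comp b1)
      have hGD : ∀ z, ‖G z - z‖ ≤ D := by
        intro z
        refine le_trans ?_ (hD (z.1, 4 * z.2))
        rw [Prod.norm_def, Prod.norm_def]
        refine max_le_max le_rfl ?_
        simp only [Prod.snd_sub, Real.norm_eq_abs, hG]
        rw [show 4⁻¹ * (H (Φ (z.1, 4 * z.2))).2 - z.2 =
          4⁻¹ * ((H (Φ (z.1, 4 * z.2))).2 - 4 * z.2) by ring,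
          abs_mul, abs_inv, abs_of_pos (by norm_num : (0 : ℝ) < 4)]
        linarith [abs_nonneg ((H (Φ (z.1, 4 * z.2))).2 - 4 * z.2)]
      obtain ⟨e, he⟩ := exists_homeomorph_of_bijective hGc hGb hGD
      have hcore := iso_core hσ e (fun z => ?_) (fun z hz => ?_)
      · rw [he] at hcore
        have e4 : (1 : ℝ) + 3 * ((1 : unitInterval) : ℝ) = 4 := by norm_num
        simp only [e4]
        refine hcore.of_univ (fun z hz => ?_) ?_
        · simp only [mem_compl_iff, mem_ofPred_eq, not_le] at hz ⊢
          linarith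
        · rw [le_principal_iff, mem_nhdsSet_iff_forall]
          intro z hz
          have : IsOpen {z : Plane | 1 < |z.2|} := isOpen_lt continuous_const (by fun_prop)
          filter_upwards [this.mem_nhds (show 1 < |z.2| by rw [hK z hz]; norm_num)] with w hw
          exact (show 1 < |w.2| from hw).le
      · rw [he]
        have := hd' (z.1, 4 * z.2)
        simp only [deck] at this
        simp only [hG, deck]
        rw [show 4 * ((σ : ℝ) * z.2) = σ * (4 * z.2) by ring, this]
        ext <;> simp; ring
      · rw [he]
        simp only [hG]
        rw [hout _ (by simp only [abs_mul, abs_of_pos (by norm_num : (0 : ℝ) < 4)]; linarith)]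
        simp
  have := h4.comp hΨ
  refine (congrArg _ (funext fun z => ?_)).mp this
  simp only [Function.comp]
  exact congrArg H (hΦ1 z)

/-- The Alexander trick as an isotopy. -/
theorem iso_alexander {S : Set Plane} {𝓕 : Filter Plane} {p : Plane} {g : Plane → Plane}
    (hg : Continuous g) (hb : g.Bijective) {C : ℝ} (hC : ∀ z, ‖g z - z‖ ≤ C) {E : Set Plane}
    (hE : ∀ z ∈ E, g z = z) (hstar : ∀ z ∈ E, ∀ r : ℝ, 1 ≤ r → p + r • (z - p) ∈ E) (hS : Sᶜ ⊆ E)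
    (hF : 𝓕 ≤ 𝓟 E) : Iso id S 𝓕 g := by
  refine Iso.of_univ (E := E) ?_ hS hF
  have hA := (continuous_alexander (p := p) hg hC).comp
    (continuous_subtype_val.prodMap continuous_id : Continuous fun q : unitInterval × Plane => _)
  exact ⟨fun q => alexander p g q.1 q.2, hA, fun t => alexander_bijective hb t,
    ⟨C, fun t z => norm_alexander_sub_le hC t.2.1 t.2.2 _⟩, fun t z => rfl, by simp,
    eventually_principal.2 fun z hz t => alexander_eq_self hE hstar t.2.1 t.2.2 hz,
    fun z => by simp [alexander_zero], fun z => by simp [alexander_one]⟩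

/-- Compactly supported homeomorphisms of the half-plane fixing a neighbourhood of a subset of the
boundary are isotopic to the identity. -/
theorem iso_halfplane (H : Plane ≃ₜ Plane) (hdown : ∀ x y, y ≤ 0 → H (x, y) = ((H (x, 0)).1, y))
    {K : Set Plane} (hK : ∀ z ∈ K, z.2 = 0) (hfix : ∀ᶠ z in 𝓝ˢ K, H z = z) {R : ℝ}
    (hR : ∀ z : Plane, 0 ≤ z.2 → R ≤ ‖z‖ → H z = z) :
    ∃ r, Iso id {z | 0 ≤ z.2} (𝓝ˢ K ⊔ 𝓟 {z | 0 ≤ z.2 ∧ r ≤ ‖z‖}) H := by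
  obtain ⟨C, hC⟩ : ∃ C, ∀ z, ‖H z - z‖ ≤ C := by
    obtain ⟨C, hC⟩ := (isCompact_closedBall (0 : Plane) R)
      |>.exists_bound_of_continuousOn (H.continuous.sub continuous_id).continuousOn
    have h1 : ∀ z : Plane, 0 ≤ z.2 → ‖H z - z‖ ≤ max C 0 := by
      intro z hz
      rcases le_total R ‖z‖ with h | h
      · rw [hR z hz h]; simp
      · exact (hC z (by simpa using h)).trans (le_max_left _ _)
    refine ⟨max C 0, fun z => ?_⟩
    obtain ⟨x, y⟩ := z
    rcases le_total 0 y with h | h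
    · exact h1 _ h
    · have := h1 (x, 0) le_rfl
      rw [hdown x 0 le_rfl] at this
      rw [hdown x y h]
      simpa using this
  have hC0 : 0 ≤ C := (norm_nonneg _).trans (hC 0)
  set g : ℝ → ℝ := fun x => (H (x, 0)).1 with hg
  have hx : ∀ x, |g x - x| ≤ C := fun x => (norm_fst_le _).trans (hC (x, 0))
  have hgm : StrictMono g := by
    refine strictMono_of_bounded (by fun_prop) (fun x x' h => ?_) hx
    have : H (x, 0) = H (x', 0) := by rw [hdown x 0 le_rfl, hdown x' 0 le_rfl]; exact Prod.ext h rfl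
    simpa using H.injective this
  set r : ℝ := |R| + 6 with hr
  have hRr : R + 6 ≤ r := by linarith [le_abs_self R]
  have hr0 : 6 ≤ r := by linarith [abs_nonneg R]
  refine ⟨r, ?_⟩
  set W : Plane → ℝ := fun z => ramp (2 - z.2) * (g z.1 - z.1) + 0 * (z.1 - z.1) with hW
  have hWc : Continuous W := by
    have := continuous_ramp
    fun_prop
  have hΨ : Iso id {z | 0 ≤ z.2} (𝓝ˢ K ⊔ 𝓟 {z | 0 ≤ z.2 ∧ r - 4 ≤ ‖z‖}) fun z => (z.1 + W z, z.2) :=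
    by
    refine iso_shear hWc (C := C) (fun z => ?_)
      (fun y => strictMono_convex hgm strictMono_id (ramp_nonneg _) le_rfl
        (by simpa using ramp_le_one (2 - y)))
      (fun _ _ => rfl) (fun _ _ _ => Iff.rfl) ?_
    · simp only [hW, zero_mul, add_zero, abs_mul, abs_of_nonneg (ramp_nonneg _)]
      exact (mul_le_of_le_one_left (abs_nonneg _) (ramp_le_one _)).trans (hx _)
    · rw [eventually_sup, eventually_principal]
      constructor
      · rw [eventually_nhdsSet_iff_forall] at hfix ⊢
        rintro ⟨x, y⟩ hz
        have h1 := hfix _ hz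
        obtain rfl : y = 0 := hK _ hz
        have c1 : Tendsto (fun z : Plane => (z.1, (0 : ℝ))) (𝓝 (x, 0)) (𝓝 (x, 0)) :=
          Continuous.tendsto (by fun_prop) (x, (0 : ℝ))
        filter_upwards [c1.eventually h1] with z hz
        simp only [hW, hg, hz, sub_self, mul_zero, add_zero]
      · rintro ⟨x, y⟩ ⟨h1, h2⟩
        simp only at h1 h2
        rw [Prod.norm_def, le_max_iff] at h2
        rcases h2 with h2 | h2
        · have : H (x, 0) = (x, 0) := hR _ le_rfl (by
            rw [Prod.norm_def]
            exact le_max_of_le_left (by simp only at h2 ⊢; linarith))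
          simp only [hW, hg, this, sub_self, mul_zero, add_zero]
        · simp only [Real.norm_eq_abs, abs_of_nonneg h1] at h2
          simp only [hW, ramp_of_le (show 2 - y ≤ 1 by linarith), zero_mul, add_zero]
  obtain ⟨Φ, hΦ, hΦ1, hΦ2⟩ := hΨ.exists_inverse
  have hout : ∀ z : Plane, z.2 ≤ 0 → H (Φ z) = z := by
    intro z hz
    have h1 := hΦ2 z
    have h2 : (Φ z).2 = z.2 := (Prod.ext_iff.1 h1).2
    nth_rw 2 [← h1]
    have := hdown (Φ z).1 (Φ z).2 (by rwa [h2])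
    rw [Prod.mk.eta] at this
    rw [this, hW]
    ext
    · simp only [h2, ramp_of_ge (show 2 ≤ 2 - z.2 by linarith), hg]; ring
    · rfl
  have hc : Continuous fun z => H (Φ z) := H.continuous.comp hΦ.continuous
  have hb : (fun z => H (Φ z)).Bijective := H.bijective.comp hΦ.bijective
  obtain ⟨D, hD⟩ : ∃ D, ∀ z, ‖H (Φ z) - z‖ ≤ D := by
    obtain ⟨F, -, -, ⟨D, h3⟩, -, -, -, -, h8⟩ := hΦ
    refine ⟨C + D, fun z => ?_⟩
    calc ‖H (Φ z) - z‖ = ‖(H (Φ z) - Φ z) + (Φ z - z)‖ := by congr 1; abel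
      _ ≤ _ := norm_add_le_of_le (hC _) (by rw [← h8]; exact h3 1 z)
  have hΦe := hΦ.eventually_eq
  rw [eventually_sup, eventually_principal] at hΦe
  have hfix' : ∀ᶠ z in 𝓝ˢ K, H (Φ z) = z := by
    filter_upwards [hfix, hΦe.1] with z h1 h2
    rw [h2, h1]
  have hfar : ∀ z : Plane, r - 4 ≤ ‖z‖ → H (Φ z) = z := by
    intro z hz
    rcases le_total z.2 0 with h | h
    · exact hout z h
    · rw [hΦe.2 z ⟨h, hz⟩, hR z h (by linarith)]
  have hnear : ∀ z : Plane, z.2 < 0 → ∀ᶠ w in 𝓝 z, H (Φ w) = w := by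
    intro z hz
    have : IsOpen {z : Plane | z.2 < 0} := isOpen_lt (by fun_prop) continuous_const
    filter_upwards [this.mem_nhds hz] with w hw
    exact hout w (show w.2 < 0 from hw).le
  have hnorm : ∀ (t : ℝ) (z : Plane), 0 ≤ t → t ≤ 1 → ‖z‖ - 1 ≤ ‖z - (0, t)‖ := by
    intro t z h0 h1
    have h2 : ‖((0, t) : Plane)‖ ≤ 1 := by
      rw [Prod.norm_def]; simp [abs_of_nonneg h0, h1]
    have := norm_sub_norm_le z (0, t)
    linarith
  have h4 : Iso id {z | 0 ≤ z.2} (𝓝ˢ K ⊔ 𝓟 {z | 0 ≤ z.2 ∧ r ≤ ‖z‖}) fun z => H (Φ z) := by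
    refine iso_of_conj hc hb hD (fun _ => rfl) (q := fun p => p.2 - (0, (p.1 : ℝ)))
      (q' := fun p => p.2 + (0, (p.1 : ℝ))) (by fun_prop) (by fun_prop)
      (fun t z => by simp) (fun t z => by simp) (fun t z w => by simp) (fun t z => rfl)
      (fun t z hz => hout _ ?_) ?_ (fun z => by simp) ?_
    · simp only [mem_ofPred_eq, not_le, Prod.snd_sub] at hz ⊢
      linarith [t.2.1]
    · rw [eventually_sup, eventually_principal]
      constructor
      · refine eventually_conj_eq_self (H := fun z => H (Φ z))
          (q := fun p => p.2 - (0, (p.1 : ℝ))) (by fun_prop) fun z hz t => ?_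
        rcases t.2.1.eq_or_lt with h | h
        · simp only [← h, Prod.mk_zero_zero, sub_zero]
          exact (eventually_nhdsSet_iff_forall.1 hfix') z hz
        · refine hnear _ ?_
          simp only [Prod.snd_sub, hK z hz]
          linarith
      · intro z hz t
        exact hfar _ (by linarith [hnorm t z t.2.1 t.2.2, hz.2])
    · simp only [Set.Icc.coe_one]
      set G : Plane → Plane := fun z => H (Φ (z - (0, 1))) + (0, 1) with hG
      refine iso_alexander (p := (0, 1)) (C := D)
        (E := {z | z.2 ≤ 1} ∪ {z | r - 1 ≤ ‖z - (0, 1)‖}) (g := G) ?_ ?_ ?_ ?_ ?_ ?_ ?_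
      · exact (hc.comp (g := fun z => H (Φ z)) (continuous_id.sub continuous_const)).add
          continuous_const
      · exact (Equiv.addRight ((0, 1) : Plane)).bijective.comp
          (hb.comp (Equiv.subRight ((0, 1) : Plane)).bijective)
      · intro z
        have := hD (z - (0, 1))
        rwa [← sub_add, sub_add_eq_add_sub] at this
      · rintro z (hz | hz)
        · simp only [hG]
          rw [hout _ (by simp only [mem_ofPred_eq] at hz; simpa using hz), sub_add_cancel]
        · simp only [mem_ofPred_eq] at hz
          simp only [hG]
          rw [hfar _ (by linarith), sub_add_cancel]
      · rintro z (hz | hz) a ha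
        · left
          simp only [mem_ofPred_eq, Prod.snd_add, Prod.smul_snd, Prod.snd_sub, smul_eq_mul] at hz ⊢
          nlinarith
        · right
          simp only [mem_ofPred_eq, add_sub_cancel_left, norm_smul, Real.norm_eq_abs,
            abs_of_nonneg (zero_le_one.trans ha)] at hz ⊢
          exact hz.trans (le_mul_of_one_le_left (norm_nonneg _) ha)
      · intro z hz
        simp only [mem_compl_iff, mem_ofPred_eq, not_le] at hz
        left
        simp only [mem_ofPred_eq]
        linarith
      · refine sup_le ?_ (principal_mono.2 fun z hz => ?_)
        · rw [le_principal_iff, mem_nhdsSet_iff_forall]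
          intro z hz
          have : IsOpen {z : Plane | z.2 < 1} := isOpen_lt (by fun_prop) continuous_const
          filter_upwards [this.mem_nhds (show z.2 < 1 by rw [hK z hz]; norm_num)] with w hw
          exact .inl (show w.2 < 1 from hw).le
        · right
          simp only [mem_ofPred_eq] at hz ⊢
          linarith [hnorm 1 z zero_le_one le_rfl]
  have hsub : {z : Plane | 0 ≤ z.2 ∧ r ≤ ‖z‖} ⊆ {z | 0 ≤ z.2 ∧ r - 4 ≤ ‖z‖} :=
    fun z hz => ⟨hz.1, by linarith [hz.2]⟩
  have := h4.comp (hΨ.mono (sup_le_sup_left (principal_mono.2 hsub) _))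
  refine (congrArg _ (funext fun z => ?_)).mp this
  simp only [Function.comp]
  exact congrArg H (hΦ1 z)

/-- Maps out of a contractible space lift through covering maps. -/
theorem exists_lift_of_contraction {A E B : Type*} [TopologicalSpace A] [TopologicalSpace E]
    [TopologicalSpace B] {p : E → B} (hp : IsCoveringMap p) {c : unitInterval × A → A}
    (hc : Continuous c) {a₀ : A} (h0 : ∀ a, c (0, a) = a₀) (h1 : ∀ a, c (1, a) = a)
    (ha₀ : ∀ t, c (t, a₀) = a₀) {f : A → B} (hf : Continuous f) {e₀ : E} (he₀ : p e₀ = f a₀) :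
    ∃ g : A → E, Continuous g ∧ (∀ a, p (g a) = f a) ∧ g a₀ = e₀ := by
  let H : C(unitInterval × A, B) := ⟨fun q => f (c q), hf.comp hc⟩
  have hH : ∀ a, H (0, a) = p (ContinuousMap.const A e₀ a) := fun a => by
    simp [H, h0, he₀]
  let G := hp.liftHomotopy H (ContinuousMap.const A e₀) hH
  have hG : ∀ q, p (G q) = f (c q) := fun q => congrFun (hp.liftHomotopy_lifts H _ hH) q
  have hG0 : ∀ a, G (0, a) = e₀ := fun a => hp.liftHomotopy_zero H _ hH a
  refine ⟨fun a => G (1, a), by fun_prop, fun a => by rw [hG, h1], ?_⟩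
  rw [← hG0 a₀]
  exact hp.const_of_comp (g := fun t => G (t, a₀)) (by fun_prop)
    (fun t t' => by simp only [hG, ha₀]) 1 0

/-- Maps out of a star-shaped subset of the plane lift through covering maps. -/
theorem exists_lift_of_starConvex {A : Set Plane} {E B : Type*} [TopologicalSpace E]
    [TopologicalSpace B] {p : E → B} (hp : IsCoveringMap p) {a₀ : Plane} (ha₀ : a₀ ∈ A)
    (hA : StarConvex ℝ a₀ A) {f : A → B} (hf : Continuous f) {e₀ : E} (he₀ : p e₀ = f ⟨a₀, ha₀⟩) :
    ∃ g : A → E, Continuous g ∧ (∀ a, p (g a) = f a) ∧ g ⟨a₀, ha₀⟩ = e₀ := by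
  have hmem : ∀ q : unitInterval × A, (1 - (q.1 : ℝ)) • a₀ + (q.1 : ℝ) • (q.2 : Plane) ∈ A :=
    fun q =>
    hA q.2.2 (sub_nonneg.2 q.1.2.2) q.1.2.1 (by ring)
  refine exists_lift_of_contraction hp (c := fun q => ⟨_, hmem q⟩) (by fun_prop)
    (fun a => ?_) (fun a => ?_) (fun t => ?_) hf he₀
  · ext1; simp
  · ext1; simp
  · ext1; simp [← add_smul]

/-- The plane as the complex numbers. -/
def planeToComplex (z : Plane) : ℂ := ⟨z.1, z.2⟩

theorem continuous_planeToComplex : Continuous planeToComplex := by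
  have : planeToComplex = fun z : Plane => (z.1 : ℂ) + z.2 * Complex.I := by
    funext z; simp [planeToComplex, Complex.ext_iff]
  rw [this]; fun_prop

theorem planeToComplex_eq_zero {z : Plane} : planeToComplex z = 0 ↔ z = 0 := by
  simp [planeToComplex, Complex.ext_iff, Prod.ext_iff]

/-- A homeomorphism of a closed convex set with interior points maps boundary points to boundary points. -/
theorem notMem_interior_of_homeomorph {S : Set Plane} (hS : Convex ℝ S) (hi : (interior S).Nonempty)
    (φ : S ≃ₜ S) {z : S} (hz : (z : Plane) ∉ interior S) : (φ z : Plane) ∉ interior S := by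
  intro hw
  obtain ⟨c, hc⟩ := hi
  set A : Set Plane := S \ {(z : Plane)} with hA
  have hcA : c ∈ A := ⟨interior_subset hc, fun h => hz (by rw [← mem_singleton_iff.1 h]; exact hc)⟩
  have hstar : StarConvex ℝ c A := by
    intro u hu a b ha hb hab
    refine ⟨hS (interior_subset hc) hu.1 ha hb hab, fun h => ?_⟩
    rw [mem_singleton_iff] at h
    rcases ha.eq_or_lt with rfl | ha
    · have : b = 1 := by linarith
      subst this
      exact hu.2 (by simpa using h)
    · rw [← h] at hz
      exact hz (hS.combo_interior_self_mem_interior hc hu.1 ha hb hab)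
  have hne : ∀ u : A, planeToComplex ((φ ⟨u, u.2.1⟩ : Plane) - φ z) ≠ 0 := fun u h => by
    rw [planeToComplex_eq_zero, sub_eq_zero] at h
    have := φ.injective (Subtype.ext h)
    exact u.2.2 (congrArg Subtype.val this)
  have hcont : Continuous fun u : A =>
      (⟨planeToComplex ((φ ⟨u, u.2.1⟩ : Plane) - φ z), hne u⟩ : {z : ℂ // z ≠ 0}) := by
    refine Continuous.subtype_mk (continuous_planeToComplex.comp ?_) _
    refine (continuous_subtype_val.comp (φ.continuous.comp ?_)).sub continuous_const
    exact Continuous.subtype_mk continuous_subtype_val _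
  obtain ⟨ℓ, hℓc, hℓ, -⟩ := exists_lift_of_starConvex Complex.isCoveringMap_exp hcA hstar hcont
    (e₀ := Complex.log (planeToComplex ((φ ⟨c, hcA.1⟩ : Plane) - φ z)))
    (Subtype.ext (Complex.exp_log (hne ⟨c, hcA⟩)))
  obtain ⟨r, hr, hball⟩ := Metric.nhds_basis_closedBall.mem_iff.1 (mem_interior_iff_mem_nhds.1 hw)
  have hmem : ∀ θ : ℝ, (φ z : Plane) + (r * Real.cos θ, r * Real.sin θ) ∈ S := fun θ => by
    apply hball
    rw [Metric.mem_closedBall, dist_eq_norm, add_sub_cancel_left, Prod.norm_def, Real.norm_eq_abs,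
      Real.norm_eq_abs, abs_mul, abs_mul, abs_of_pos hr]
    exact max_le (mul_le_of_le_one_right hr.le (Real.abs_cos_le_one θ))
      (mul_le_of_le_one_right hr.le (Real.abs_sin_le_one θ))
  have hval : ∀ θ : ℝ, planeToComplex ((r * Real.cos θ, r * Real.sin θ) : Plane)
      = r * Complex.exp (θ * Complex.I) := fun θ => by
    rw [Complex.exp_mul_I, ← Complex.ofReal_cos, ← Complex.ofReal_sin]
    apply Complex.ext <;> simp [planeToComplex, -Complex.ofReal_cos, -Complex.ofReal_sin]
  have hu : ∀ θ : ℝ, (φ.symm ⟨_, hmem θ⟩ : Plane) ∈ A := fun θ => by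
    refine ⟨Subtype.coe_prop _, fun h => ?_⟩
    have h2 : φ.symm ⟨_, hmem θ⟩ = z := Subtype.ext h
    have h3 := congrArg (fun u => (φ u : Plane)) h2
    simp only [Homeomorph.apply_symm_apply] at h3
    have h4 : planeToComplex ((r * Real.cos θ, r * Real.sin θ) : Plane) = 0 :=
      planeToComplex_eq_zero.2 (by simpa using h3)
    rw [hval] at h4
    simp [hr.ne', Complex.exp_ne_zero] at h4
  set g : ℝ → ℂ := fun θ => ℓ ⟨_, hu θ⟩ - θ * Complex.I with hg
  have hgc : Continuous g := by
    refine (hℓc.comp (Continuous.subtype_mk (continuous_subtype_val.comp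
      (φ.symm.continuous.comp (Continuous.subtype_mk ?_ _))) _)).sub (by fun_prop)
    fun_prop
  have hge : ∀ θ, Complex.exp (g θ) = r := fun θ => by
    have h1 := congrArg Subtype.val (hℓ ⟨_, hu θ⟩)
    simp only [Subtype.coe_eta, Homeomorph.apply_symm_apply, add_sub_cancel_left, hval] at h1
    rw [hg]
    simp only
    rw [Complex.exp_sub, h1, mul_div_assoc, div_self (Complex.exp_ne_zero _), mul_one]
  have hconst := Complex.isCoveringMap_exp.const_of_comp hgc
    (fun a b => Subtype.ext (by simp only [hge])) 0 (2 * Real.pi)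
  have : (φ z : Plane) + (r * Real.cos 0, r * Real.sin 0)
      = (φ z : Plane) + (r * Real.cos (2 * Real.pi), r * Real.sin (2 * Real.pi)) := by simp
  have h5 : ℓ ⟨_, hu 0⟩ = ℓ ⟨_, hu (2 * Real.pi)⟩ := by simp only [this]
  simp only [hg, h5] at hconst
  have h6 : ((2 * Real.pi : ℝ) : ℂ) * Complex.I = 0 := by
    have := sub_right_inj.1 hconst
    rw [← this]; simp
  simp [Real.pi_ne_zero] at h6

/-- The closed strip covering the annulus and the Möbius band. -/
abbrev strip : Set Plane := {z | |z.2| ≤ 2}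

theorem convex_strip : Convex ℝ strip := by
  have : strip = Prod.snd ⁻¹' Icc (-2 : ℝ) 2 := by ext z; simp [abs_le]
  rw [this]
  exact (convex_Icc _ _).is_linear_preimage (IsLinearMap.mk (fun _ _ => rfl) fun _ _ => rfl)

theorem interior_strip : interior strip = {z | |z.2| < 2} := by
  have : strip = Prod.snd ⁻¹' Icc (-2 : ℝ) 2 := by ext z; simp [_root_.abs_le]
  rw [this, ← isOpenMap_snd.preimage_interior_eq_interior_preimage continuous_snd, interior_Icc]
  ext z; simp [abs_lt]

instance : PreconnectedSpace strip :=
  isPreconnected_iff_preconnectedSpace.1 convex_strip.isPreconnected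

section

variable {σ : ℤ} (hσ : σ = 1 ∨ σ = -1)

/-- The deck transformations of the strip. -/
def stripDeck (k : ℤ) (z : strip) : strip :=
  ⟨deckPow σ k z, (abs_deckPow_snd hσ k z).trans_le z.2⟩

theorem continuous_stripDeck (k : ℤ) : Continuous (stripDeck hσ k) :=
  Continuous.subtype_mk ((continuous_deckPow σ k).comp continuous_subtype_val) _

theorem stripDeck_add (k l : ℤ) (z : strip) :
    stripDeck hσ (k + l) z = stripDeck hσ k (stripDeck hσ l z) :=
  Subtype.ext (deckPow_add hσ k l z)

theorem stripDeck_zero (z : strip) : stripDeck hσ 0 z = z := Subtype.ext (deckPow_zero σ z)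

theorem stripDeck_injective_left {k l : ℤ} {z : strip} (h : stripDeck hσ k z = stripDeck hσ l z) : k
    = l := by
  have := congrArg (fun u : strip => (u : Plane).1) h
  simpa [stripDeck, deckPow] using this

variable {X : Type*} [TopologicalSpace X] {q : strip → X}

theorem isAddQuotientCoveringMap_strip (hq : IsQuotientMap q)
    (hfib : ∀ z w, q z = q w ↔ ∃ k, stripDeck hσ k w = z) :
    IsCoveringMap q ∧ IsOpenMap q := by
  let : AddAction ℤ strip :=
    { vadd := stripDeck hσ
      zero_vadd := stripDeck_zero hσ
      add_vadd := stripDeck_add hσ }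
  have hc : IsAddQuotientCoveringMap q ℤ :=
    { toIsQuotientMap := hq
      continuous_const_vadd := continuous_stripDeck hσ
      apply_eq_iff_mem_orbit := fun {z w} => by
        rw [hfib]; rfl
      disjoint := fun e => by
        refine ⟨{w | |(w : Plane).1 - (e : Plane).1| < 1 / 2}, ?_, ?_⟩
        · refine IsOpen.mem_nhds (isOpen_lt (by fun_prop) (by fun_prop)) (by simp)
        · rintro k ⟨_, ⟨w, hw, rfl⟩, hw'⟩
          have h1 : |(w : Plane).1 - (e : Plane).1| < 1 / 2 := hw
          have h2 : |(w : Plane).1 + k - (e : Plane).1| < 1 / 2 := hw'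
          rw [abs_lt] at h1 h2
          have h3 : (-1 : ℝ) < k := by linarith
          have h4 : (k : ℝ) < 1 := by linarith
          have h5 : -1 < k := by exact_mod_cast h3
          have h6 : k < 1 := by exact_mod_cast h4
          omega }
  exact ⟨hc.isCoveringMap, hc.isOpenQuotientMap.isOpenMap⟩

theorem exists_strip_lift (hc : IsCoveringMap q) (h : X ≃ₜ X) {p : strip} (hp : h (q p) = q p) :
    ∃ H : strip ≃ₜ strip, (∀ z, q (H z) = h (q z)) ∧ H p = p := by
  have key : ∀ h : X ≃ₜ X, h (q p) = q p → ∃ H : strip → strip, Continuous H ∧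
      (∀ z, q (H z) = h (q z)) ∧ H p = p := fun h hp =>
    exists_lift_of_starConvex hc p.2 (convex_strip.starConvex p.2)
      (f := fun z => h (q z)) (h.continuous.comp hc.continuous) hp.symm
  obtain ⟨H, hH, hqH, hHp⟩ := key h hp
  obtain ⟨G, hG, hqG, hGp⟩ := key h.symm (by rw [← hp, h.symm_apply_apply, hp])
  have h1 : G ∘ H = id := hc.eq_of_comp_eq (hG.comp hH) continuous_id
    (funext fun z => by simp [hqG, hqH]) p (by simp [hHp, hGp])
  have h2 : H ∘ G = id := hc.eq_of_comp_eq (hH.comp hG) continuous_id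
    (funext fun z => by simp [hqG, hqH]) p (by simp [hHp, hGp])
  exact ⟨⟨⟨H, G, congrFun h1, congrFun h2⟩, hH, hG⟩, hqH, hHp⟩

theorem exists_stripDeck_comm (hc : IsCoveringMap q)
    (hfib : ∀ z w, q z = q w ↔ ∃ k, stripDeck hσ k w = z) {h : X → X} {H : strip → strip}
      (hH : Continuous H)
    (hqH : ∀ z, q (H z) = h (q z)) (j : ℤ) :
    ∃ k, ∀ z, H (stripDeck hσ j z) = stripDeck hσ k (H z) := by
  have hq : ∀ k z, q (stripDeck hσ k z) = q z := fun k z => (hfib _ _).2 ⟨k, rfl⟩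
  let p : strip := ⟨0, by simp⟩
  obtain ⟨k, hk⟩ := (hfib (H (stripDeck hσ j p)) (H p)).1 (by rw [hqH, hqH, hq])
  exact ⟨k, congrFun (hc.eq_of_comp_eq (hH.comp (continuous_stripDeck hσ j))
    ((continuous_stripDeck hσ k).comp hH) (funext fun z => by simp [hqH, hq]) p hk.symm)⟩

theorem eventually_lift_eq_self (hc : IsCoveringMap q) {h : X → X} {H : strip → strip}
    (hH : Continuous H)
    (hqH : ∀ z, q (H z) = h (q z)) {z : strip} (hz : H z = z) (hh : ∀ᶠ x in 𝓝 (q z), h x = x) :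
    ∀ᶠ w in 𝓝 z, H w = w := by
  obtain ⟨U, hU, hzU, hinj⟩ := hc.isLocalHomeomorph.isLocallyInjective z
  have h1 : ∀ᶠ w in 𝓝 z, H w ∈ U := hH.continuousAt.eventually
    (by rw [hz]; exact hU.mem_nhds hzU)
  filter_upwards [h1, hU.mem_nhds hzU, hc.continuous.continuousAt.eventually hh] with w h1 h2 h3
  exact hinj h1 h2 (by rw [hqH, h3])

end

section

variable {σ : ℤ} (hσ : σ = 1 ∨ σ = -1)

theorem eq_of_abs_eq_two {f : ℝ → ℝ} (hf : Continuous f) (h2 : ∀ x, |f x| = 2) (x y : ℝ) : f x =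
    f y := by
  have key : ∀ x y, f x = 2 → f y = -2 → False := fun x y hx hy => by
    obtain ⟨w, hw⟩ := mem_range_of_exists_le_of_exists_ge hf ⟨y, by rw [hy]; norm_num⟩
      (⟨x, by rw [hx]; norm_num⟩ : ∃ b, (0 : ℝ) ≤ f b)
    have := h2 w
    rw [hw] at this; norm_num at this
  rcases eq_or_eq_neg_of_abs_eq (h2 x) with hx | hx <;>
    rcases eq_or_eq_neg_of_abs_eq (h2 y) with hy | hy
  · rw [hx, hy]
  · exact (key x y hx hy).elim
  · exact (key y x hy hx).elim
  · rw [hx, hy]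

/-- The points of a boundary line of the strip. -/
def linePt {s : ℝ} (hs : |s| = 2) (x : ℝ) : strip := ⟨(x, s), hs.le⟩

theorem continuous_linePt {s : ℝ} (hs : |s| = 2) : Continuous (linePt hs) :=
  Continuous.subtype_mk (by fun_prop) _

theorem linePt_eq {s : ℝ} (hs : |s| = 2) {z : strip} (hz : (z : Plane).2 = s) :
    linePt hs (z : Plane).1 = z := Subtype.ext (Prod.ext rfl hz.symm)

theorem abs_snd_strip_homeomorph (H : strip ≃ₜ strip) {z : strip} (hz : |(z : Plane).2| = 2) :
    |(H z : Plane).2| = 2 := by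
  have h1 : ((H z : Plane)) ∉ interior strip :=
    notMem_interior_of_homeomorph convex_strip (by rw [interior_strip]; exact ⟨0, by simp⟩) H
      (by rw [interior_strip]; simp [hz])
  rw [interior_strip] at h1
  exact le_antisymm (H z).2 (not_lt.1 h1)

theorem snd_strip_homeomorph (H : strip ≃ₜ strip) {p : strip} (hp : |(p : Plane).2| = 2)
    (hHp : H p = p)
    {z : strip} (hz : |(z : Plane).2| = 2) : (H z : Plane).2 = (z : Plane).2 := by
  have hline : ∀ (H : strip ≃ₜ strip) {s : ℝ} (hs : |s| = 2) (x y : ℝ),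
      (H (linePt hs x) : Plane).2 = (H (linePt hs y) : Plane).2 := fun H s hs x y =>
    eq_of_abs_eq_two (f := fun x => (H (linePt hs x) : Plane).2)
      (continuous_snd.comp (continuous_subtype_val.comp (H.continuous.comp (continuous_linePt hs))))
      (fun x => abs_snd_strip_homeomorph H hs) x y
  have hsame : ∀ (H : strip ≃ₜ strip), H p = p → ∀ z : strip, (z : Plane).2 = (p : Plane).2 →
      (H z : Plane).2 = (p : Plane).2 := fun H hHp z hz => by
    have := hline H hp (z : Plane).1 (p : Plane).1
    rwa [linePt_eq hp hz, linePt_eq hp rfl, hHp] at this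
  by_cases h : (z : Plane).2 = (p : Plane).2
  · rw [hsame H hHp z h, h]
  · have h1 : (H z : Plane).2 ≠ (p : Plane).2 := fun h' => by
      have := hsame H.symm (by rw [H.symm_apply_eq, hHp]) (H z) h'
      rw [H.symm_apply_apply] at this
      exact h this
    have h2 := abs_snd_strip_homeomorph H hz
    rcases eq_or_eq_neg_of_abs_eq hp with ha | ha <;> rcases eq_or_eq_neg_of_abs_eq hz with hb |
      hb <;>
      rcases eq_or_eq_neg_of_abs_eq h2 with hc | hc <;> simp_all

theorem stripDeck_comm_zpow {H : strip → strip} {k : ℤ}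
    (hk : ∀ z, H (stripDeck hσ 1 z) = stripDeck hσ k (H z)) (l : ℤ) (z : strip) :
    H (stripDeck hσ l z) = stripDeck hσ (k * l) (H z) := by
  have hneg : ∀ z, H (stripDeck hσ (-1) z) = stripDeck hσ (-k) (H z) := fun z => by
    have := hk (stripDeck hσ (-1) z)
    rw [← stripDeck_add, add_neg_cancel, stripDeck_zero] at this
    rw [this, ← stripDeck_add, neg_add_cancel, stripDeck_zero]
  induction l using Int.induction_on generalizing z with
  | zero => rw [mul_zero, stripDeck_zero, stripDeck_zero]
  | succ l ih => rw [stripDeck_add, ih, hk, ← stripDeck_add, mul_add, mul_one]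
  | pred l ih => rw [sub_eq_add_neg, stripDeck_add, ih, hneg, ← stripDeck_add]; congr 1; ring

theorem strictMono_line (H : strip ≃ₜ strip) {p : strip} (hp : |(p : Plane).2| = 2) (hHp : H p = p)
    (hid : ∀ᶠ z in 𝓝 p, H z = z) : StrictMono fun x => (H (linePt hp x) : Plane).1 := by
  have hc : Continuous fun x => (H (linePt hp x) : Plane).1 :=
    continuous_fst.comp (continuous_subtype_val.comp (H.continuous.comp (continuous_linePt hp)))
  have hi : Function.Injective fun x => (H (linePt hp x) : Plane).1 := fun x y hxy => by
    have h1 : ∀ x, (H (linePt hp x) : Plane).2 = (p : Plane).2 := fun x =>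
      snd_strip_homeomorph H hp hHp (z := linePt hp x) hp
    have h2 : H (linePt hp x) = H (linePt hp y) := Subtype.ext (Prod.ext hxy (by rw [h1, h1]))
    exact congrArg (fun u : strip => (u : Plane).1) (H.injective h2)
  refine (hc.strictMono_of_inj hi).resolve_right fun ha => ?_
  have h3 : ∀ᶠ x in 𝓝 (p : Plane).1, H (linePt hp x) = linePt hp x :=
    (continuous_linePt hp).continuousAt.eventually (by rwa [linePt_eq hp rfl])
  obtain ⟨x, hx, hpx⟩ := ((h3.filter_mono nhdsWithin_le_nhds).and self_mem_nhdsWithin :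
    ∀ᶠ x in 𝓝[>] (p : Plane).1, _).exists
  have := ha hpx
  simp only [hx, linePt_eq hp rfl, hHp] at this
  exact lt_asymm this hpx

variable {X : Type*} [TopologicalSpace X] {q : strip → X}

theorem strip_lift_comm (hc : IsCoveringMap q)
    (hfib : ∀ z w, q z = q w ↔ ∃ k, stripDeck hσ k w = z) {h : X ≃ₜ X} {H : strip ≃ₜ strip}
    (hqH : ∀ z, q (H z) = h (q z)) {p : strip} (hp : |(p : Plane).2| = 2) (hHp : H p = p)
    (hid : ∀ᶠ z in 𝓝 p, H z = z) (j : ℤ) (z : strip) :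
    H (stripDeck hσ j z) = stripDeck hσ j (H z) := by
  obtain ⟨k, hk⟩ := exists_stripDeck_comm hσ hc hfib H.continuous hqH 1
  obtain ⟨l, hl⟩ := exists_stripDeck_comm hσ hc hfib H.symm.continuous (h := h.symm)
    (fun z => by rw [Homeomorph.eq_symm_apply, ← hqH, H.apply_symm_apply]) 1
  have hkl : k * l = 1 := by
    have h1 := congrArg H (hl p)
    rw [H.apply_symm_apply, stripDeck_comm_zpow hσ hk, H.apply_symm_apply] at h1
    exact (stripDeck_injective_left hσ h1).symm
  have hmono := strictMono_line H hp hHp hid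
  rcases Int.eq_one_or_neg_one_of_mul_eq_one hkl with rfl | rfl
  · rw [stripDeck_comm_zpow hσ hk, one_mul]
  · exfalso
    have h2 := stripDeck_comm_zpow hσ hk 2 p
    have h3 : stripDeck hσ 2 p = linePt hp ((p : Plane).1 + 2) := by
      rcases hσ with rfl | rfl <;> simp [stripDeck, deckPow, linePt]
    rw [h3, hHp] at h2
    have h4 := hmono (show (p : Plane).1 < (p : Plane).1 + 2 by linarith)
    simp only [h2, linePt_eq hp rfl, hHp] at h4
    simp [stripDeck, deckPow] at h4
    linarith

theorem strip_lift_eq_self (hc : IsCoveringMap q)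
    (hfib : ∀ z w, q z = q w ↔ ∃ k, stripDeck hσ k w = z) {h : X ≃ₜ X} {H : strip ≃ₜ strip}
    (hqH : ∀ z, q (H z) = h (q z)) {p : strip} (hp : |(p : Plane).2| = 2) (hHp : H p = p)
    (hid : ∀ᶠ z in 𝓝 p, H z = z) {z : strip} (hz : |(z : Plane).2| = 2)
    (hzp : σ = 1 → (z : Plane).2 = (p : Plane).2) (hhz : h (q z) = q z) : H z = z := by
  have hcomm := strip_lift_comm hσ hc hfib hqH hp hHp hid
  have hmono := strictMono_line H hp hHp hid
  have hq : ∀ k z, q (stripDeck hσ k z) = q z := fun k z => (hfib _ _).2 ⟨k, rfl⟩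
  have hline : ∀ z : strip, (z : Plane).2 = (p : Plane).2 → h (q z) = q z → H z = z := by
    intro z hz hhz
    obtain ⟨e, he0, heσ, he⟩ : ∃ e : ℤ, 0 < e ∧ (∀ m : ℤ, (σ : ℝ) ^ (e * m) = 1) ∧
        ∀ j : ℤ, |j| < e → (σ : ℝ) ^ j = 1 → j = 0 := by
      rcases hσ with rfl | rfl
      · refine ⟨1, by norm_num, by simp, fun j hj _ => by rw [abs_lt] at hj; omega⟩
      · refine ⟨2, by norm_num, fun m => by simp [zpow_mul], fun j hj hj1 => ?_⟩
        rw [abs_lt] at hj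
        have : j = -1 ∨ j = 0 ∨ j = 1 := by omega
        rcases this with rfl | rfl | rfl
        · norm_num at hj1
        · rfl
        · norm_num at hj1
    obtain ⟨j, hj⟩ := (hfib (H z) z).1 (by rw [hqH, hhz])
    have he0' : (0 : ℝ) < e := by exact_mod_cast he0
    have htr : ∀ (m : ℤ) (w : strip), (w : Plane).2 = (p : Plane).2 →
        stripDeck hσ (e * m) w = linePt hp ((w : Plane).1 + e * m) := fun m w hw => by
      refine Subtype.ext (Prod.ext ?_ ?_)
      · simp [stripDeck, deckPow, linePt]
      · simp [stripDeck, deckPow, linePt, heσ, hw]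
    have hs : (σ : ℝ) ^ j = 1 := by
      have h1 := snd_strip_homeomorph H hp hHp (z := z) (by rw [hz]; exact hp)
      rw [← hj] at h1
      have h2 : (z : Plane).2 ≠ 0 := fun h0 => by rw [← hz, h0] at hp; norm_num at hp
      exact mul_right_cancel₀ h2 (h1.trans (one_mul _).symm)
    set m : ℤ := ⌊((z : Plane).1 - (p : Plane).1) / e⌋ with hm
    have hm1 : (m : ℝ) * e ≤ (z : Plane).1 - (p : Plane).1 := (le_div_iff₀ he0').1 (Int.floor_le _)
    have hm2 : (z : Plane).1 - (p : Plane).1 < (m + 1) * e :=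
      (div_lt_iff₀ he0').1 (Int.lt_floor_add_one _)
    have hga : (H (linePt hp ((z : Plane).1 + e * (-m : ℤ))) : Plane).1 = (z : Plane).1 +
      j - e * m := by
      rw [← htr _ _ hz, hcomm, ← hj]
      simp [stripDeck, deckPow]; ring
    have hgb : (H (linePt hp (p : Plane).1) : Plane).1 = (p : Plane).1 := by
      rw [linePt_eq hp rfl, hHp]
    have hgc : (H (linePt hp ((p : Plane).1 + e * (1 : ℤ))) : Plane).1 = (p : Plane).1 + e := by
      rw [← htr _ _ rfl, hcomm, hHp]
      simp [stripDeck, deckPow]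
    have h1 := hmono.monotone (show (p : Plane).1 ≤ (z : Plane).1 +
      e * (-m : ℤ) by push_cast; linarith)
    have h2 := hmono (show (z : Plane).1 + e * (-m : ℤ) < (p : Plane).1 + e * (1 : ℤ) by
      push_cast; linarith)
    simp only [hga, hgb, hgc] at h1 h2
    have h3 : |(j : ℝ)| < e := abs_lt.2 ⟨by linarith, by linarith⟩
    have h4 : j = 0 := he j (by exact_mod_cast h3) hs
    rw [← hj, h4, stripDeck_zero]
  by_cases hzp' : (z : Plane).2 = (p : Plane).2
  · exact hline z hzp' hhz
  · have hσ' : σ = -1 := hσ.resolve_left fun h1 => hzp' (hzp h1)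
    have h5 : (z : Plane).2 = -(p : Plane).2 := by
      rcases abs_eq_abs.1 (hz.trans hp.symm) with h | h
      · exact absurd h hzp'
      · exact h
    have h6 := hline (stripDeck hσ 1 z) (by subst hσ'; simp [stripDeck, deckPow, h5])
      (by rw [hq, hhz])
    rw [hcomm] at h6
    have h7 := congrArg (stripDeck hσ (-1)) h6
    rwa [← stripDeck_add, ← stripDeck_add, neg_add_cancel, stripDeck_zero, stripDeck_zero] at h7

end

/-- A compactly supported homeomorphism of `X \ K` extends by the identity to `X`. -/
theorem exists_extension_of_mem_Hc {X M : Type*} [TopologicalSpace X] [T2Space X]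
    [TopologicalSpace M]
    {K : Set X} (hK : IsClosed K) (e : M ≃ₜ {x // x ∉ K}) {h : M ≃ₜ M} (hh : h ∈ Hc M) :
    ∃ g : X ≃ₜ X, (∀ m, g (e m) = e (h m)) ∧ ∀ᶠ x in 𝓝ˢ K, g x = x := by
  classical
  set A : Set X := (fun m => (e m : X)) '' closure {x | h x ≠ x} with hA
  have hAc : IsClosed A := (IsCompact.image hh (continuous_subtype_val.comp e.continuous)).isClosed
  have hAK : K ⊆ Aᶜ := by
    rintro x hx ⟨m, -, rfl⟩
    exact (e m).2 hx
  let E : (M ≃ₜ M) → X → X := fun f x => if hx : x ∈ K then x else e (f (e.symm ⟨x, hx⟩))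
  have hE : ∀ f m, E f (e m) = e (f m) := fun f m => by simp [E, (e m).2]
  have hEid : ∀ f : M ≃ₜ M, (∀ m, h m = m → f m = m) → ∀ x ∈ Aᶜ, E f x = x := fun f hf x hx => by
    by_cases hxK : x ∈ K
    · simp [E, hxK]
    · have h1 : x = e (e.symm ⟨x, hxK⟩) := by simp
      rw [h1, hE, hf]
      by_contra h2
      exact hx ⟨_, subset_closure h2, by simp⟩
  have hEc : ∀ f : M ≃ₜ M, (∀ m, h m = m → f m = m) → Continuous (E f) := fun f hf => by
    rw [continuous_iff_continuousAt]
    intro x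
    by_cases hxA : x ∈ Aᶜ
    · refine continuousAt_id.congr ?_
      filter_upwards [hAc.isOpen_compl.mem_nhds hxA] with y hy
      exact (hEid f hf y hy).symm
    · have hxK : x ∉ K := fun hx => hxA (hAK hx)
      have h1 : ContinuousOn (E f) Kᶜ := by
        rw [continuousOn_iff_continuous_domRestrict]
        have : Kᶜ.domRestrict (E f) = fun x : {x // x ∉ K} => (e (f (e.symm x)) : X) := by
          funext x
          have := hE f (e.symm x)
          rwa [e.apply_symm_apply] at this
        rw [this]
        fun_prop
      exact h1.continuousAt (hK.isOpen_compl.mem_nhds hxK)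
  have hEE : ∀ f g : M ≃ₜ M, (∀ m, f (g m) = m) → ∀ x, E f (E g x) = x := fun f g hfg x => by
    by_cases hxK : x ∈ K
    · simp [E, hxK]
    · have h1 : x = e (e.symm ⟨x, hxK⟩) := by simp
      rw [h1, hE, hE, hfg]
  refine ⟨⟨⟨E h, E h.symm, hEE _ _ h.symm_apply_apply, hEE _ _ h.apply_symm_apply⟩,
    hEc _ fun _ => id, hEc _ fun m hm => by rw [h.symm_apply_eq, hm]⟩, hE h, ?_⟩
  filter_upwards [hAc.isOpen_compl.mem_nhdsSet.2 hAK] with x hx using hEid h (fun _ => id) x hx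

/-- An isotopy of the compact space `X` fixing a neighbourhood of `K` restricts to an isotopy of `X \ K`. -/
theorem mem_H0_of_ambient_isotopy {X M : Type*} [TopologicalSpace X] [T2Space X] [CompactSpace X]
    [TopologicalSpace M] [T2Space M] {K : Set X} (e : M ≃ₜ {x // x ∉ K}) {h : M ≃ₜ M}
    {F : unitInterval × X → X} (hF : Continuous F) (hb : ∀ t, (fun x => F (t, x)).Bijective)
    (hK : ∀ᶠ x in 𝓝ˢ K, ∀ t, F (t, x) = x) (h0 : ∀ x, F (0, x) = x) (h1 : ∀ m, F (1, e m) = e (h m)) :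
    h ∈ H0 M := by
  have hFt : ∀ t, Continuous fun x => F (t, x) := fun t => by fun_prop
  let φ : unitInterval → X ≃ₜ X := fun t =>
    Continuous.homeoOfEquivCompactToT2 (f := Equiv.ofBijective _ (hb t)) (hFt t)
  have hφ : ∀ t x, φ t x = F (t, x) := fun t x => rfl
  have hφK : ∀ t x, x ∉ K ↔ φ t x ∉ K := fun t x =>
    (mem_iff_of_eq_self (S := Kᶜ) (φ t).injective
      (fun z hz => hK.self_of_nhdsSet z (not_not.1 hz) t) x).symm
  let G : unitInterval → M ≃ₜ M := fun t => (e.trans ((φ t).subtype (hφK t))).trans e.symm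
  have hG : ∀ t m, (e (G t m) : X) = F (t, e m) := fun t m => by
    simp [G, hφ]
  have hGc : Continuous fun p : unitInterval × M => G p.1 p.2 := by
    have hi : IsInducing fun m => (e m : X) := IsInducing.subtypeVal.comp e.isInducing
    rw [hi.continuous_iff]
    have : ((fun m => (e m : X)) ∘ fun p : unitInterval × M => G p.1 p.2)
      = fun p => F (p.1, e p.2) := funext fun p => hG _ _
    rw [this]; fun_prop
  obtain ⟨U, hU, hKU, hUf⟩ := eventually_nhdsSet_iff_exists.1 hK
  have hC : IsCompact ((fun m => (e m : X)) ⁻¹' Uᶜ) := by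
    have hi : IsInducing fun m => (e m : X) := IsInducing.subtypeVal.comp e.isInducing
    refine (hi.isCompact_preimage_iff ?_).2 hU.isClosed_compl.isCompact
    exact fun x hx => ⟨e.symm ⟨x, fun hxK => hx (hKU hxK)⟩, by simp⟩
  have hfin := mem_H0_of_isotopy G hGc hC
    (fun t m hm => e.injective (Subtype.ext ((hG t m).trans (hUf _ (not_not.1 hm) t))))
    (fun m => e.injective (Subtype.ext ((hG 0 m).trans (h0 _))))
  have : G 1 = h := Homeomorph.ext fun m => e.injective (Subtype.ext ((hG 1 m).trans (h1 m)))
  rwa [this] at hfin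

section

variable {σ : ℤ} (hσ : σ = 1 ∨ σ = -1) {X : Type*} [TopologicalSpace X] {q : strip → X}

/-- The nearest point projection of the plane to the strip. -/
def clampStrip (z : Plane) : strip :=
  ⟨(z.1, max (-2) (min 2 z.2)), by
    simp only [mem_ofPred_eq, _root_.abs_le]
    exact ⟨le_max_left _ _, max_le (by norm_num) (min_le_left _ _)⟩⟩

theorem continuous_clampStrip : Continuous clampStrip := Continuous.subtype_mk (by fun_prop) _

theorem clampStrip_of_mem (z : strip) : clampStrip z = z := by
  have h := _root_.abs_le.1 (show |(z : Plane).2| ≤ 2 from z.2)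
  refine Subtype.ext (Prod.ext rfl ?_)
  simp [clampStrip, h.1, h.2]

theorem clampStrip_of_two_le {z : Plane} (hz : 2 ≤ z.2) : clampStrip z = ⟨(z.1, 2), by simp⟩ := by
  refine Subtype.ext (Prod.ext rfl ?_)
  simp [clampStrip, hz]

theorem clampStrip_of_le_neg_two {z : Plane} (hz : z.2 ≤ -2) : clampStrip z =
    ⟨(z.1, -2), by simp⟩ := by
  refine Subtype.ext (Prod.ext rfl ?_)
  simp only [clampStrip]
  rw [min_eq_right (by linarith), max_eq_left hz]

/-- The extension of a self-map of the strip to the plane by vertical translation. -/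
def stripExtend (H : strip → strip) (z : Plane) : Plane :=
  (H (clampStrip z) : Plane) + (0, z.2 - (clampStrip z : Plane).2)

theorem stripExtend_of_mem (H : strip → strip) (z : strip) : stripExtend H z = H z := by
  simp [stripExtend, clampStrip_of_mem]

theorem continuous_stripExtend {H : strip → strip} (hH : Continuous H) : Continuous
    (stripExtend H) := by
  have := continuous_clampStrip
  exact (continuous_subtype_val.comp (hH.comp this)).add (by fun_prop)

theorem clampStrip_stripExtend {H : strip → strip}
    (hb : ∀ z : strip, |(z : Plane).2| = 2 → (H z : Plane).2 = (z : Plane).2) (z : Plane) :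
    clampStrip (stripExtend H z) = H (clampStrip z) := by
  rcases le_or_gt (|z.2|) 2 with h | h
  · rw [stripExtend_of_mem H ⟨z, h⟩, clampStrip_of_mem, clampStrip_of_mem ⟨z, h⟩]
  · rcases lt_abs.1 h with h | h
    · have h1 := hb ⟨(z.1, 2), by simp⟩ (by simp)
      rw [clampStrip_of_two_le]
      · rw [stripExtend, clampStrip_of_two_le h.le]
        exact Subtype.ext (Prod.ext (by simp) h1.symm)
      · rw [stripExtend, clampStrip_of_two_le h.le]
        simp only [Prod.snd_add, h1]; linarith
    · have h1 := hb ⟨(z.1, -2), by simp⟩ (by simp)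
      have h' : z.2 ≤ -2 := by linarith
      rw [clampStrip_of_le_neg_two]
      · rw [stripExtend, clampStrip_of_le_neg_two h']
        exact Subtype.ext (Prod.ext (by simp) h1.symm)
      · rw [stripExtend, clampStrip_of_le_neg_two h']
        simp only [Prod.snd_add, h1]; linarith

theorem stripExtend_stripExtend {G H : strip → strip}
    (hb : ∀ z : strip, |(z : Plane).2| = 2 → (H z : Plane).2 = (z : Plane).2)
      (hGH : ∀ z, G (H z) = z)
    (z : Plane) : stripExtend G (stripExtend H z) = z := by
  rw [stripExtend, clampStrip_stripExtend hb, hGH, stripExtend]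
  refine Prod.ext ?_ ?_
  · simp [clampStrip]
  · simp only [Prod.snd_add]; ring

theorem stripExtend_deck {H : strip → strip} (hd : ∀ z, H (stripDeck hσ 1 z) = stripDeck hσ 1 (H z))
    (z : Plane) : stripExtend H (deck σ z) = deck σ (stripExtend H z) := by
  have h1 : clampStrip (deck σ z) = stripDeck hσ 1 (clampStrip z) := by
    refine Subtype.ext (Prod.ext (by simp [clampStrip, stripDeck, deckPow, deck]) ?_)
    rcases hσ with rfl | rfl
    · simp [clampStrip, stripDeck, deckPow, deck]
    · simp only [clampStrip, stripDeck, deckPow, deck]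
      push_cast
      rw [zpow_one, neg_one_mul, neg_one_mul]
      grind
  rw [stripExtend, h1, hd, stripExtend]
  refine Prod.ext ?_ ?_
  · simp [stripDeck, deckPow, deck]
  · simp [stripDeck, deckPow, deck]; ring

theorem exists_isotopy_of_iso (hq : IsQuotientMap q) (hqo : IsOpenMap q)
    (hfib : ∀ z w, q z = q w ↔ ∃ k, stripDeck hσ k w = z) {H : Plane → Plane} {h : X → X}
    (hqH : ∀ z w : strip, (w : Plane) = H z → q w = h (q z)) {K : Set X}
    (hH : Iso (deck σ) strip (𝓝ˢ (Subtype.val '' (q ⁻¹' K))) H) :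
    ∃ F : unitInterval × X → X, Continuous F ∧ (∀ t, (fun x => F (t, x)).Bijective) ∧
      (∀ᶠ x in 𝓝ˢ K, ∀ t, F (t, x) = x) ∧ (∀ x, F (0, x) = x) ∧ ∀ x, F (1, x) = h x := by
  obtain ⟨Φ, hΦ, hb, -, hd, hS, hK, h0, h1⟩ := hH
  let Ψ : unitInterval × strip → strip := fun p => ⟨Φ (p.1, p.2), (hS p.1 p.2).2 p.2.2⟩
  have hΨ : Continuous Ψ := Continuous.subtype_mk (by fun_prop) _
  have hΨd : ∀ t k z, Ψ (t, stripDeck hσ k z) = stripDeck hσ k (Ψ (t, z)) := fun t k z =>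
    Subtype.ext (deckPow_comm hσ (h := fun z => Φ (t, z)) (hd t) k z)
  let F : unitInterval × X → X := fun p => q (Ψ (p.1, Function.surjInv hq.surjective p.2))
  have hF : ∀ t z, F (t, q z) = q (Ψ (t, z)) := fun t z => by
    obtain ⟨k, hk⟩ := (hfib (Function.surjInv hq.surjective (q z)) z).1 (Function.surjInv_eq _ _)
    exact (hfib _ _).2 ⟨k, by rw [← hk, hΨd]⟩
  have hqq : IsOpenQuotientMap (Prod.map (id : unitInterval → unitInterval) q) :=
    IsOpenQuotientMap.id.prodMap ⟨hq.surjective, hq.continuous, hqo⟩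
  refine ⟨F, ?_, fun t => ⟨?_, ?_⟩, ?_, ?_, ?_⟩
  · rw [hqq.isQuotientMap.continuous_iff]
    have : F ∘ Prod.map id q = q ∘ Ψ := funext fun p => hF p.1 p.2
    rw [this]
    exact hq.continuous.comp hΨ
  · intro x y hxy
    obtain ⟨z, rfl⟩ := hq.surjective x
    obtain ⟨w, rfl⟩ := hq.surjective y
    simp only [hF] at hxy
    obtain ⟨k, hk⟩ := (hfib _ _).1 hxy
    rw [← hΨd] at hk
    exact (hfib _ _).2 ⟨k, Subtype.ext ((hb t).1 (congrArg Subtype.val hk))⟩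
  · intro x
    obtain ⟨z, rfl⟩ := hq.surjective x
    obtain ⟨w, hw⟩ := (hb t).2 z
    have hwS : w ∈ strip := (hS t w).1 (by simp only at hw; rw [hw]; exact z.2)
    exact ⟨q ⟨w, hwS⟩, (hF _ _).trans <| congrArg q (Subtype.ext hw)⟩
  · obtain ⟨U, hU, hKU, hUf⟩ := eventually_nhdsSet_iff_exists.1 hK
    refine eventually_nhdsSet_iff_exists.2 ⟨q '' (Subtype.val ⁻¹' U),
      hqo _ (hU.preimage continuous_subtype_val), fun x hx => ?_, ?_⟩
    · obtain ⟨z, rfl⟩ := hq.surjective x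
      exact ⟨z, hKU ⟨z, hx, rfl⟩, rfl⟩
    · rintro _ ⟨z, hz, rfl⟩ t
      rw [hF]
      exact congrArg q (Subtype.ext (hUf z hz t))
  · intro x
    obtain ⟨z, rfl⟩ := hq.surjective x
    rw [hF]
    exact congrArg q (Subtype.ext (h0 z))
  · intro x
    obtain ⟨z, rfl⟩ := hq.surjective x
    rw [hF]
    exact hqH _ _ (h1 z)

theorem t2Space_of_strip (hq : IsQuotientMap q) (hqo : IsOpenMap q)
    (hfib : ∀ z w, q z = q w ↔ ∃ k, stripDeck hσ k w = z) : T2Space X := by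
  rw [t2Space_iff_of_isOpenQuotientMap ⟨hq.surjective, hq.continuous, hqo⟩]
  let c : ℝ → ℝ := fun a => if σ = 1 then 1 else Real.cos (a * Real.pi)
  have hc : Continuous c := by
    by_cases h : σ = 1
    · simp only [c, h, if_true]; fun_prop
    · simp only [c, h, if_false]; fun_prop
  have hcσ : ∀ k : ℤ, c k = (σ : ℝ) ^ k := fun k => by
    rcases hσ with rfl | rfl
    · simp [c]
    · simp [c, Real.cos_int_mul_pi]
  have : {p : strip × strip | q p.1 = q p.2} = {p : strip × strip |
      Real.sin (((p.1 : Plane).1 - (p.2 : Plane).1) * Real.pi) = 0 ∧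
      (p.1 : Plane).2 = c ((p.1 : Plane).1 - (p.2 : Plane).1) * (p.2 : Plane).2} := by
    ext ⟨z, w⟩
    simp only [mem_ofPred_eq, hfib]
    constructor
    · rintro ⟨k, rfl⟩
      simp [stripDeck, deckPow, hcσ, Real.sin_int_mul_pi]
    · rintro ⟨h1, h2⟩
      obtain ⟨k, hk⟩ := Real.sin_eq_zero_iff.1 h1
      have hk' := mul_right_cancel₀ Real.pi_ne_zero hk
      refine ⟨k, Subtype.ext (Prod.ext ?_ ?_)⟩
      · simp [stripDeck, deckPow, hk']
      · rw [← hk', hcσ] at h2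
        exact h2.symm
  rw [this]
  exact (isClosed_eq (by fun_prop) (by fun_prop)).inter (isClosed_eq (by fun_prop) (by fun_prop))

theorem mem_H0_of_strip [CompactSpace X] (hq : IsQuotientMap q)
    (hfib : ∀ z w, q z = q w ↔ ∃ k, stripDeck hσ k w = z) {K : Set X} (hKc : IsCompact K)
      (hne : K.Nonempty)
    (hKb : ∀ z, q z ∈ K → |(z : Plane).2| = 2)
    (hKs : σ = 1 → ∀ z w, q z ∈ K → q w ∈ K → (z : Plane).2 = (w : Plane).2)
    {M : Type*} [TopologicalSpace M] [T2Space M] (e : M ≃ₜ {x // x ∉ K}) {h : M ≃ₜ M}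
      (hh : h ∈ Hc M) :
    h ∈ H0 M := by
  obtain ⟨hcov, hqo⟩ := isAddQuotientCoveringMap_strip hσ hq hfib
  have := t2Space_of_strip hσ hq hqo hfib
  obtain ⟨g, hge, hgK⟩ := exists_extension_of_mem_Hc hKc.isClosed e hh
  obtain ⟨x, hx⟩ := hne
  obtain ⟨p, rfl⟩ := hq.surjective x
  have hgK' : ∀ x ∈ K, g x = x := fun x hx => hgK.self_of_nhdsSet x hx
  obtain ⟨H, hqH, hHp⟩ := exists_strip_lift hcov g (hgK' _ hx)
  have hp := hKb p hx
  have hnear : ∀ z, q z ∈ K → H z = z → ∀ᶠ w in 𝓝 z, H w = w := fun z hz hHz =>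
    eventually_lift_eq_self hcov H.continuous hqH hHz (eventually_nhdsSet_iff_forall.1 hgK _ hz)
  have hid := hnear p hx hHp
  have hcomm := strip_lift_comm hσ hcov hfib hqH hp hHp hid
  have hb : ∀ z : strip, |(z : Plane).2| = 2 → (H z : Plane).2 = (z : Plane).2 := fun z hz =>
    snd_strip_homeomorph H hp hHp hz
  have hb' : ∀ z : strip, |(z : Plane).2| = 2 → (H.symm z : Plane).2 = (z : Plane).2 := fun z hz =>
    snd_strip_homeomorph H.symm hp (by rw [H.symm_apply_eq, hHp]) hz
  let E : Plane ≃ₜ Plane := ⟨⟨stripExtend H, stripExtend H.symm,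
    stripExtend_stripExtend hb H.symm_apply_apply, stripExtend_stripExtend hb' H.apply_symm_apply⟩,
    continuous_stripExtend H.continuous, continuous_stripExtend H.symm.continuous⟩
  have hE : ∀ z, E z = stripExtend H z := fun z => rfl
  have hiso : Iso (deck σ) strip (𝓝ˢ (Subtype.val '' (q ⁻¹' K))) E := by
    refine iso_strip hσ E (fun z => stripExtend_deck hσ (hcomm 1) z) ?_ ?_ ?_ ?_
    · intro x y hy
      have h1 := hb ⟨(x, 2), by simp⟩ (by simp)
      rw [hE, hE, stripExtend, stripExtend, clampStrip_of_two_le hy, clampStrip_of_two_le le_rfl]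
      refine Prod.ext (by simp) ?_
      simp only [Prod.snd_add, h1]; ring
    · intro x y hy
      have h1 := hb ⟨(x, -2), by simp⟩ (by simp)
      rw [hE, hE, stripExtend, stripExtend, clampStrip_of_le_neg_two hy,
        clampStrip_of_le_neg_two le_rfl]
      refine Prod.ext (by simp) ?_
      simp only [Prod.snd_add, h1]; ring
    · rintro _ ⟨z, hz, rfl⟩
      exact hKb z hz
    · rw [eventually_nhdsSet_iff_forall]
      rintro _ ⟨z, hz, rfl⟩
      have h1 : H z = z := strip_lift_eq_self hσ hcov hfib hqH hp hHp hid (hKb z hz)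
        (fun h => hKs h _ _ hz hx) (hgK' _ hz)
      have h2 : ∀ᶠ w : Plane in 𝓝 z, H (clampStrip w) = clampStrip w :=
        continuous_clampStrip.continuousAt.eventually
          (by rw [clampStrip_of_mem]; exact hnear z hz h1)
      filter_upwards [h2] with w hw
      rw [hE, stripExtend, hw]
      refine Prod.ext (by simp [clampStrip]) ?_
      simp only [Prod.snd_add]; ring
  obtain ⟨F, hF, hFb, hFK, hF0, hF1⟩ := exists_isotopy_of_iso hσ hq hqo hfib (h := g) (K := K)
    (fun z w hw => by
      rw [hE, stripExtend_of_mem] at hw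
      rw [Subtype.ext hw, hqH]) hiso
  exact mem_H0_of_ambient_isotopy e hF hFb hFK hF0 fun m => by rw [hF1, hge]

end

/-- The universal covering of the annulus. -/
def annulusCover (z : strip) : Circle2 × unitInterval :=
  (⟨!₂[Real.cos (2 * Real.pi * (z : Plane).1), Real.sin (2 * Real.pi * (z : Plane).1)], by
    simp [EuclideanSpace.norm_eq, Fin.sum_univ_two]⟩,
   ⟨((z : Plane).2 + 2) / 4, by
    have h := _root_.abs_le.1 (show |(z : Plane).2| ≤ 2 from z.2)
    exact ⟨by linarith, by linarith⟩⟩)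

theorem continuous_annulusCover : Continuous annulusCover := by
  refine Continuous.prodMk (Continuous.subtype_mk ?_ _) (Continuous.subtype_mk (by fun_prop) _)
  refine (PiLp.continuous_toLp 2 _).comp (continuous_pi fun i => ?_)
  fin_cases i <;> simp <;> fun_prop

theorem annulusCover_eq_iff (z w : strip) :
    annulusCover z = annulusCover w ↔ ∃ k, stripDeck (Or.inl rfl : (1 : ℤ) = 1 ∨ (1 : ℤ) = -1) k w =
      z := by
  constructor
  · intro h
    have h1 : (z : Plane).2 = (w : Plane).2 := by
      have := congrArg (fun p : Circle2 × unitInterval => (p.2 : ℝ)) h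
      simp only [annulusCover] at this
      linarith
    have h2 := congrArg (fun p : Circle2 × unitInterval => (p.1 : EuclideanSpace ℝ (Fin 2)) 0) h
    have h3 := congrArg (fun p : Circle2 × unitInterval => (p.1 : EuclideanSpace ℝ (Fin 2)) 1) h
    simp only [annulusCover] at h2 h3
    obtain ⟨k, hk⟩ := Real.Angle.angle_eq_iff_two_pi_dvd_sub.1 (Real.Angle.cos_sin_inj h2 h3)
    rw [← mul_sub] at hk
    have hk' := mul_left_cancel₀ Real.two_pi_pos.ne' hk
    refine ⟨k, Subtype.ext (Prod.ext ?_ ?_)⟩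
    · simp only [stripDeck, deckPow]; linarith
    · simp [stripDeck, deckPow, h1]
  · rintro ⟨k, rfl⟩
    have : 2 * Real.pi * ((w : Plane).1 + k) = 2 * Real.pi * (w : Plane).1 +
      k * (2 * Real.pi) := by ring
    simp [annulusCover, stripDeck, deckPow, this]

theorem exists_stripDeck_mem {σ : ℤ} (hσ : σ = 1 ∨ σ = -1) (z : strip) :
    ∃ k, (stripDeck hσ k z : Plane).1 ∈ Icc (0 : ℝ) 1 := by
  refine ⟨-⌊(z : Plane).1⌋, ?_⟩
  have h1 := Int.floor_le (z : Plane).1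
  have h2 := Int.lt_floor_add_one (z : Plane).1
  simp only [stripDeck, deckPow]
  push_cast
  exact ⟨by linarith, by linarith⟩

theorem abs_four_mul_sub_two_le (t : unitInterval) : |4 * (t : ℝ) - 2| ≤ 2 :=
  _root_.abs_le.2 ⟨by linarith [t.2.1], by linarith [t.2.2]⟩

/-- The fundamental domain of the strip. -/
def stripCell (p : unitInterval × unitInterval) : strip :=
  ⟨(p.1, 4 * (p.2 : ℝ) - 2), abs_four_mul_sub_two_le p.2⟩

theorem continuous_stripCell : Continuous stripCell := Continuous.subtype_mk (by fun_prop) _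

theorem exists_stripCell_eq {z : strip} (hz : (z : Plane).1 ∈ Icc (0 : ℝ) 1) : ∃ p, stripCell p =
    z := by
  have h := _root_.abs_le.1 (show |(z : Plane).2| ≤ 2 from z.2)
  refine ⟨(⟨_, hz⟩, ⟨((z : Plane).2 + 2) / 4, by constructor <;> linarith⟩), ?_⟩
  refine Subtype.ext (Prod.ext rfl ?_)
  simp only [stripCell]; ring

theorem annulusCover_surjective : Function.Surjective annulusCover := by
  rintro ⟨⟨c, hc⟩, t⟩
  have hc1 : c 0 ^ 2 + c 1 ^ 2 = 1 := by
    have := EuclideanSpace.norm_sq_eq c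
    rw [mem_sphere_zero_iff_norm.1 hc, Fin.sum_univ_two] at this
    simpa using this.symm
  have hn : ‖(⟨c 0, c 1⟩ : ℂ)‖ = 1 := by
    rw [Complex.norm_def, Complex.normSq_mk, ← sq, ← sq, hc1, Real.sqrt_one]
  have h0 : (⟨c 0, c 1⟩ : ℂ) ≠ 0 := fun h => by rw [h, norm_zero] at hn; norm_num at hn
  refine ⟨⟨((⟨c 0, c 1⟩ : ℂ).arg / (2 * Real.pi), 4 * (t : ℝ) - 2), abs_four_mul_sub_two_le t⟩, ?_⟩
  refine Prod.ext (Subtype.ext ?_) (Subtype.ext ?_)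
  · simp only [annulusCover]
    rw [mul_div_cancel₀ _ Real.two_pi_pos.ne', Complex.cos_arg h0, Complex.sin_arg, hn]
    ext i
    fin_cases i <;> simp
  · simp only [annulusCover]; ring

theorem isQuotientMap_annulusCover : IsQuotientMap annulusCover := by
  refine IsQuotientMap.of_comp continuous_stripCell continuous_annulusCover ?_
  have hc := continuous_annulusCover.comp continuous_stripCell
  refine hc.isClosedMap.isQuotientMap hc fun x => ?_
  obtain ⟨z, rfl⟩ := annulusCover_surjective x
  obtain ⟨k, hk⟩ := exists_stripDeck_mem (Or.inl rfl : (1 : ℤ) = 1 ∨ (1 : ℤ) = -1) z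
  obtain ⟨p, hp⟩ := exists_stripCell_eq hk
  exact ⟨p, (annulusCover_eq_iff _ _).2 ⟨k, hp.symm⟩⟩

theorem mem_H0_of_annulus {M : Type*} [TopologicalSpace M] [T2Space M]
    {K : Set (Circle2 × unitInterval)}
    (hne : K.Nonempty) (hK : IsCompact K) {i : unitInterval} (hi : i = 0 ∨ i = 1)
      (hKi : ∀ p ∈ K, p.2 = i)
    (e : M ≃ₜ {p // p ∉ K}) {h : M ≃ₜ M} (hh : h ∈ Hc M) : h ∈ H0 M := by
  have key : ∀ z : strip, annulusCover z ∈ K → (z : Plane).2 = 4 * (i : ℝ) - 2 := fun z hz => by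
    have := congrArg Subtype.val (hKi _ hz)
    simp only [annulusCover] at this
    linarith
  refine mem_H0_of_strip (Or.inl rfl : (1 : ℤ) = 1 ∨ (1 : ℤ) = -1) isQuotientMap_annulusCover
    annulusCover_eq_iff hK hne (fun z hz => ?_) (fun _ z w hz hw => by rw [key z hz, key w hw]) e hh
  rw [key z hz]
  rcases hi with rfl | rfl <;> norm_num

/-- The orbit relation of the deck transformations whose quotient is the Möbius band. -/
def mobiusSetoid : Setoid strip where
  r z w := ∃ k, stripDeck (Or.inr rfl : (-1 : ℤ) = 1 ∨ (-1 : ℤ) = -1) k w = z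
  iseqv :=
    { refl := fun z => ⟨0, stripDeck_zero _ z⟩
      symm := by
        rintro z w ⟨k, rfl⟩
        exact ⟨-k, by rw [← stripDeck_add, neg_add_cancel, stripDeck_zero]⟩
      trans := by
        rintro x y z ⟨k, rfl⟩ ⟨l, rfl⟩
        exact ⟨k + l, stripDeck_add _ _ _ _⟩ }

theorem mobiusSetoid_mk_eq_iff (z w : strip) : (Quotient.mk mobiusSetoid z =
    Quotient.mk mobiusSetoid w) ↔
    ∃ k, stripDeck (Or.inr rfl : (-1 : ℤ) = 1 ∨ (-1 : ℤ) = -1) k w = z :=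
  Quotient.eq (r := mobiusSetoid)

/-- The comparison map from the Möbius band to the orbit space of the strip. -/
def mobiusToQuotient : MobiusBand → Quotient mobiusSetoid :=
  Quot.lift (fun p => Quotient.mk mobiusSetoid (stripCell p)) (by
    rintro p p' ⟨h1, h2, h3⟩
    refine (mobiusSetoid_mk_eq_iff _ _).2 ⟨-1, Subtype.ext (Prod.ext ?_ ?_)⟩
    · simp [stripDeck, deckPow, stripCell, h1, h2]
    · simp [stripDeck, deckPow, stripCell, h3]; ring)

theorem continuous_mobiusToQuotient : Continuous mobiusToQuotient :=
  continuous_quot_lift _ (continuous_quotient_mk'.comp continuous_stripCell)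

theorem mobiusToQuotient_bijective : Function.Bijective mobiusToQuotient := by
  constructor
  · have hrel : ∀ p p' : unitInterval × unitInterval,
        stripDeck (Or.inr rfl : (-1 : ℤ) = 1 ∨ (-1 : ℤ) = -1) 1 (stripCell p) = stripCell p' →
        mobiusRel p p' := fun p p' h => by
      have h1 := congrArg (fun z : strip => (z : Plane).1) h
      have h2 := congrArg (fun z : strip => (z : Plane).2) h
      simp only [stripDeck, deckPow, stripCell] at h1 h2
      push_cast at h1 h2
      refine ⟨?_, ?_, ?_⟩
      · exact Subtype.ext (le_antisymm (by linarith [p'.1.2.2, Set.Icc.coe_zero (R := ℝ)]) p.1.2.1)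
      · exact Subtype.ext (le_antisymm p'.1.2.2 (by linarith [p.1.2.1, Set.Icc.coe_one (R := ℝ)]))
      · rw [zpow_one] at h2; linarith
    rintro ⟨p⟩ ⟨p'⟩ h
    obtain ⟨k, hk⟩ := (mobiusSetoid_mk_eq_iff _ _).1 h
    have h1 := congrArg (fun z : strip => (z : Plane).1) hk
    simp only [stripDeck, deckPow, stripCell] at h1
    have h2 : (-2 : ℝ) < k := by linarith [p.1.2.1, p'.1.2.2]
    have h3 : (k : ℝ) < 2 := by linarith [p.1.2.2, p'.1.2.1]
    have h4 : -2 < k := by exact_mod_cast h2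
    have h5 : k < 2 := by exact_mod_cast h3
    have h6 : k = -1 ∨ k = 0 ∨ k = 1 := by omega
    rcases h6 with rfl | rfl | rfl
    · refine Quot.sound (hrel _ _ ?_)
      rw [← hk, ← stripDeck_add, add_neg_cancel, stripDeck_zero]
    · rw [stripDeck_zero] at hk
      have h7 := congrArg (fun z : strip => (z : Plane).1) hk
      have h8 := congrArg (fun z : strip => (z : Plane).2) hk
      simp only [stripCell] at h7 h8
      have : p = p' := Prod.ext (Subtype.ext h7.symm) (Subtype.ext (by linarith))
      rw [this]
    · exact (Quot.sound (hrel _ _ hk)).symm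
  · rintro ⟨z⟩
    obtain ⟨k, hk⟩ := exists_stripDeck_mem (Or.inr rfl : (-1 : ℤ) = 1 ∨ (-1 : ℤ) = -1) z
    obtain ⟨p, hp⟩ := exists_stripCell_eq hk
    exact ⟨Quot.mk _ p, (mobiusSetoid_mk_eq_iff _ _).2 ⟨k, hp.symm⟩⟩

theorem mem_H0_of_mobiusBand {M : Type*} [TopologicalSpace M] [T2Space M] {K : Set MobiusBand}
    (hne : K.Nonempty) (hK : IsCompact K) (hKb : K ⊆ mobiusBoundary)
    (e : M ≃ₜ {p // p ∉ K}) {h : M ≃ₜ M} (hh : h ∈ Hc M) : h ∈ H0 M := by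
  have hσ : (-1 : ℤ) = 1 ∨ (-1 : ℤ) = -1 := Or.inr rfl
  have : CompactSpace MobiusBand := inferInstanceAs (CompactSpace (Quot mobiusRel))
  have hq : IsQuotientMap (Quotient.mk mobiusSetoid) := isQuotientMap_quotient_mk'
  have : T2Space (Quotient mobiusSetoid) := t2Space_of_strip hσ hq
    (isAddQuotientCoveringMap_strip hσ hq mobiusSetoid_mk_eq_iff).2 mobiusSetoid_mk_eq_iff
  let φ : MobiusBand ≃ₜ Quotient mobiusSetoid :=
    Continuous.homeoOfEquivCompactToT2 (f := Equiv.ofBijective _ mobiusToQuotient_bijective)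
      continuous_mobiusToQuotient
  refine mem_H0_of_strip hσ (q := fun z => φ.symm (Quotient.mk mobiusSetoid z))
    (φ.symm.isQuotientMap.comp hq) (fun z w => ?_) hK hne (fun z hz => ?_) (by norm_num) e hh
  · rw [φ.symm.injective.eq_iff, mobiusSetoid_mk_eq_iff]
  · obtain ⟨p, hp, hpz⟩ := hKb hz
    have h1 : mobiusToQuotient (Quot.mk _ p) = Quotient.mk mobiusSetoid z :=
      (congrArg φ hpz).trans (φ.apply_symm_apply _)
    obtain ⟨k, hk⟩ := (mobiusSetoid_mk_eq_iff (stripCell p) z).1 h1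
    have h2 : |(stripCell p : Plane).2| = 2 := by
      rcases hp with hp | hp <;> simp only [stripCell, hp] <;> norm_num
    rwa [← hk, stripDeck, abs_deckPow_snd hσ] at h2

/-- The closed upper half-plane. -/
abbrev halfplane : Set Plane := {z | 0 ≤ z.2}

theorem zero_mem_halfplane (x : ℝ) : ((x, 0) : Plane) ∈ halfplane := le_refl (0 : ℝ)

theorem convex_halfplane : Convex ℝ halfplane :=
  (convex_Ici (0 : ℝ)).is_linear_preimage (IsLinearMap.mk (fun _ _ => rfl) fun _ _ => rfl)

theorem interior_halfplane : interior halfplane = {z | 0 < z.2} := by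
  have : halfplane = Prod.snd ⁻¹' Ici (0 : ℝ) := rfl
  rw [this, ← isOpenMap_snd.preimage_interior_eq_interior_preimage continuous_snd, interior_Ici]
  rfl

theorem snd_halfplane_homeomorph (H : halfplane ≃ₜ halfplane) {z : halfplane}
    (hz : (z : Plane).2 = 0) :
    (H z : Plane).2 = 0 := by
  have h1 : ((H z : Plane)) ∉ interior halfplane :=
    notMem_interior_of_homeomorph convex_halfplane
      (by rw [interior_halfplane]; exact ⟨(0, 1), by simp⟩) H
        (by rw [interior_halfplane]; simp [hz])
  rw [interior_halfplane] at h1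
  exact le_antisymm (not_lt.1 h1) (H z).2

/-- The nearest point projection of the plane to the half-plane. -/
def clampHalfplane (z : Plane) : halfplane := 
  ⟨(z.1, max 0 z.2), show (0 : ℝ) ≤ max 0 z.2 from le_max_left _ _⟩

theorem continuous_clampHalfplane : Continuous clampHalfplane :=
    Continuous.subtype_mk (by fun_prop) _

theorem clampHalfplane_of_mem (z : halfplane) : clampHalfplane z = z :=
  Subtype.ext (Prod.ext rfl (max_eq_right (show 0 ≤ (z : Plane).2 from z.2)))

theorem clampHalfplane_of_nonpos {z : Plane} (hz : z.2 ≤ 0) : 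
    clampHalfplane z = ⟨(z.1, 0), zero_mem_halfplane _⟩ :=
  Subtype.ext (Prod.ext rfl (max_eq_left hz))

/-- The extension of a self-map of the half-plane to the plane by vertical translation. -/
def halfplaneExtend (H : halfplane → halfplane) (z : Plane) : Plane :=
  (H (clampHalfplane z) : Plane) + (0, z.2 - (clampHalfplane z : Plane).2)

theorem halfplaneExtend_of_mem (H : halfplane → halfplane) (z : halfplane) :
    halfplaneExtend H z = H z := by
  simp [halfplaneExtend, clampHalfplane_of_mem]

theorem halfplaneExtend_eq_self {H : halfplane → halfplane} {z : Plane}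
    (hz : H (clampHalfplane z) = clampHalfplane z) : halfplaneExtend H z = z := by
  rw [halfplaneExtend, hz]
  refine Prod.ext (by simp [clampHalfplane]) ?_
  simp only [Prod.snd_add]; ring

theorem continuous_halfplaneExtend {H : halfplane → halfplane} (hH : Continuous H) :
    Continuous (halfplaneExtend H) := by
  have := continuous_clampHalfplane
  exact (continuous_subtype_val.comp (hH.comp this)).add (by fun_prop)

theorem halfplaneExtend_halfplaneExtend {G H : halfplane → halfplane}
    (hb : ∀ z : halfplane, (z : Plane).2 = 0 → (H z : Plane).2 = 0) (hGH : ∀ z, G (H z) = z)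
    (z : Plane) : halfplaneExtend G (halfplaneExtend H z) = z := by
  have hc : clampHalfplane (halfplaneExtend H z) = H (clampHalfplane z) := by
    rcases le_total 0 z.2 with h | h
    · rw [halfplaneExtend_of_mem H ⟨z, h⟩, clampHalfplane_of_mem, clampHalfplane_of_mem ⟨z, h⟩]
    · have h1 := hb ⟨(z.1, 0), zero_mem_halfplane _⟩ rfl
      rw [clampHalfplane_of_nonpos]
      · rw [halfplaneExtend, clampHalfplane_of_nonpos h]
        exact Subtype.ext (Prod.ext (by simp) h1.symm)
      · rw [halfplaneExtend, clampHalfplane_of_nonpos h]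
        simp only [Prod.snd_add, h1]; linarith
  rw [halfplaneExtend, hc, hGH, halfplaneExtend]
  refine Prod.ext ?_ ?_
  · simp [clampHalfplane]
  · simp only [Prod.snd_add]; ring

theorem exists_isotopy_of_iso_halfplane {X : Type*} [TopologicalSpace X] [T2Space X] {p : X}
    (ψ : halfplane ≃ₜ {x // x ≠ p}) {H : Plane → Plane} {h : X → X} (hhp : h p = p)
    (hqH : ∀ z w : halfplane, (w : Plane) = H z → (ψ w : X) = h (ψ z)) {K : Set X} {r : ℝ}
    (hH : Iso id halfplane (𝓝ˢ (Subtype.val '' {z | (ψ z : X) ∈ K}) ⊔ 𝓟 {z | 0 ≤ z.2 ∧ r ≤ ‖z‖}) H) :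
    ∃ F : unitInterval × X → X, Continuous F ∧ (∀ t, (fun x => F (t, x)).Bijective) ∧
      (∀ᶠ x in 𝓝ˢ K, ∀ t, F (t, x) = x) ∧ (∀ x, F (0, x) = x) ∧ ∀ x, F (1, x) = h x := by
  classical
  obtain ⟨Φ, hΦ, hb, -, -, hS, hK, h0, h1⟩ := hH
  rw [eventually_sup, eventually_principal] at hK
  obtain ⟨hK, hr⟩ := hK
  let q : halfplane → X := fun z => ψ z
  have hq : IsOpenEmbedding q := (isOpen_compl_singleton (x := p)).isOpenEmbedding_subtypeVal.comp
    ψ.isOpenEmbedding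
  have hqp : ∀ z, q z ≠ p := fun z => (ψ z).2
  have hcases : ∀ x, x = p ∨ ∃ z, q z = x := fun x => or_iff_not_imp_left.2 fun hx =>
    ⟨ψ.symm ⟨x, hx⟩, by simp [q]⟩
  let Ψ : unitInterval × halfplane → halfplane := fun p => ⟨Φ (p.1, p.2), (hS p.1 p.2).2 p.2.2⟩
  have hΨ : Continuous Ψ := Continuous.subtype_mk (by fun_prop) _
  let F : unitInterval × X → X := fun s => if hx : s.2 = p then p else q (Ψ (s.1, ψ.symm ⟨s.2, hx⟩))
  have hF : ∀ t z, F (t, q z) = q (Ψ (t, z)) := fun t z => by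
    simp only [F, hqp z, dif_neg, not_false_eq_true]
    congr 3
    exact ψ.symm_apply_apply z
  have hFp : ∀ t, F (t, p) = p := fun t => by simp [F]
  set V : Set X := (q '' {z | ‖(z : Plane)‖ ≤ r})ᶜ with hV
  have hVo : IsOpen V := by
    have hc : IsCompact {z : halfplane | ‖(z : Plane)‖ ≤ r} := by
      have hcl : IsClosed halfplane := isClosed_le continuous_const continuous_snd
      have h2 := hcl.isClosedEmbedding_subtypeVal.isCompact_preimage
        (isCompact_closedBall (0 : Plane) r)
      convert h2 using 1
      ext z; simp
    exact (hc.image hq.continuous).isClosed.isOpen_compl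
  have hpV : p ∈ V := by
    rintro ⟨z, -, hz⟩
    exact hqp z hz
  have hFV : ∀ x ∈ V, ∀ t, F (t, x) = x := fun x hx t => by
    rcases hcases x with rfl | ⟨z, rfl⟩
    · exact hFp t
    · rw [hF]
      refine congrArg q (Subtype.ext (hr z ⟨z.2, ?_⟩ t))
      by_contra h'
      exact hx ⟨z, (not_le.1 h').le, rfl⟩
  refine ⟨F, ?_, fun t => ⟨?_, ?_⟩, ?_, ?_, ?_⟩
  · rw [continuous_iff_continuousAt]
    rintro ⟨t, x⟩
    rcases hcases x with rfl | ⟨z, rfl⟩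
    · refine continuousAt_snd.congr ?_
      filter_upwards [continuousAt_snd.eventually (hVo.mem_nhds hpV)] with s hs
      exact (hFV s.2 hs s.1).symm
    · have h2 : IsOpenEmbedding (Prod.map (id : unitInterval → unitInterval) q) :=
        IsOpenEmbedding.id.prodMap hq
      have h3 : F ∘ Prod.map id q = q ∘ Ψ := funext fun s => hF s.1 s.2
      have h4 := h2.continuousAt_iff (g := F) (x := (t, z))
      rw [h3] at h4
      exact h4.1 (hq.continuous.comp hΨ).continuousAt
  · intro x y hxy
    rcases hcases x with rfl | ⟨z, rfl⟩ <;> rcases hcases y with hy | ⟨w, rfl⟩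
    · exact hy.symm
    · simp only [hF, hFp] at hxy
      exact (hqp _ hxy.symm).elim
    · subst hy
      simp only [hF, hFp] at hxy
      exact (hqp _ hxy).elim
    · simp only [hF] at hxy
      exact congrArg q (Subtype.ext ((hb t).1 (congrArg Subtype.val (hq.injective hxy))))
  · intro x
    rcases hcases x with rfl | ⟨z, rfl⟩
    · exact ⟨_, hFp t⟩
    · obtain ⟨w, hw⟩ := (hb t).2 z
      have hwS : w ∈ halfplane := (hS t w).1 (by simp only at hw; rw [hw]; exact z.2)
      exact ⟨q ⟨w, hwS⟩, (hF _ _).trans <| congrArg q (Subtype.ext hw)⟩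
  · obtain ⟨U, hU, hKU, hUf⟩ := eventually_nhdsSet_iff_exists.1 hK
    refine eventually_nhdsSet_iff_exists.2 ⟨q '' (Subtype.val ⁻¹' U) ∪ V,
      (hq.isOpenMap _ (hU.preimage continuous_subtype_val)).union hVo, fun x hx => ?_, ?_⟩
    · rcases hcases x with rfl | ⟨z, rfl⟩
      · exact Or.inr hpV
      · exact Or.inl ⟨z, hKU ⟨z, hx, rfl⟩, rfl⟩
    · rintro _ (⟨z, hz, rfl⟩ | hx) t
      · rw [hF]
        exact congrArg q (Subtype.ext (hUf z hz t))
      · exact hFV _ hx t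
  · intro x
    rcases hcases x with rfl | ⟨z, rfl⟩
    · exact hFp 0
    · rw [hF]
      exact congrArg q (Subtype.ext (h0 z))
  · intro x
    rcases hcases x with rfl | ⟨z, rfl⟩
    · rw [hFp, hhp]
    · rw [hF]
      exact hqH _ _ (h1 z)

theorem mem_H0_of_halfplane {X : Type*} [TopologicalSpace X] [T2Space X] [CompactSpace X] {p : X}
    (ψ : halfplane ≃ₜ {x // x ≠ p}) {K : Set X} (hKc : IsClosed K) (hp : p ∈ K)
    (hKb : ∀ z, (ψ z : X) ∈ K → (z : Plane).2 = 0)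
    {M : Type*} [TopologicalSpace M] [T2Space M] (e : M ≃ₜ {x // x ∉ K}) {h : M ≃ₜ M}
      (hh : h ∈ Hc M) :
    h ∈ H0 M := by
  obtain ⟨g, hge, hgK⟩ := exists_extension_of_mem_Hc hKc e hh
  have hgp : g p = p := hgK.self_of_nhdsSet p hp
  let H : halfplane ≃ₜ halfplane := (ψ.trans (g.subtype (fun x => not_congr
    ⟨fun hx => by rw [hx, hgp], fun hx => g.injective (hx.trans hgp.symm)⟩))).trans ψ.symm
  have hqH : ∀ z, (ψ (H z) : X) = g (ψ z) := fun z => by simp [H]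
  have hHid : ∀ z, g (ψ z) = ψ z → H z = z := fun z hz =>
    ψ.injective (Subtype.ext ((hqH z).trans hz))
  have hψ : Continuous fun z => (ψ z : X) := by fun_prop
  obtain ⟨U, hU, hKU, hUf⟩ := eventually_nhdsSet_iff_exists.1 hgK
  obtain ⟨R, hR⟩ : ∃ R, ∀ z : halfplane, R ≤ ‖(z : Plane)‖ → (ψ z : X) ∈ U := by
    have hi : IsInducing fun z => (ψ z : X) := IsInducing.subtypeVal.comp ψ.isInducing
    have hc : IsCompact ((fun z => (ψ z : X)) ⁻¹' Uᶜ) :=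
      (hi.isCompact_preimage_iff (fun x (hx : x ∉ U) =>
        ⟨ψ.symm ⟨x, fun h' => hx (h' ▸ hKU hp)⟩, by simp⟩)).2 hU.isClosed_compl.isCompact
    obtain ⟨R, hR⟩ := ((hc.image continuous_subtype_val).isBounded).exists_norm_le
    refine ⟨R + 1, fun z hz => ?_⟩
    by_contra h'
    have := hR _ ⟨z, h', rfl⟩
    linarith
  have hb : ∀ z : halfplane, (z : Plane).2 = 0 → (H z : Plane).2 = 0 := fun z hz =>
    snd_halfplane_homeomorph H hz
  have hb' : ∀ z : halfplane, (z : Plane).2 = 0 → (H.symm z : Plane).2 = 0 := fun z hz =>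
    snd_halfplane_homeomorph H.symm hz
  let E : Plane ≃ₜ Plane := ⟨⟨halfplaneExtend H, halfplaneExtend H.symm,
    halfplaneExtend_halfplaneExtend hb H.symm_apply_apply,
    halfplaneExtend_halfplaneExtend hb' H.apply_symm_apply⟩,
    continuous_halfplaneExtend H.continuous, continuous_halfplaneExtend H.symm.continuous⟩
  have hE : ∀ z, E z = halfplaneExtend H z := fun z => rfl
  obtain ⟨r, hr⟩ := iso_halfplane E (K := Subtype.val '' {z | (ψ z : X) ∈ K}) (R := R)
    (fun x y hy => by
      have h1 := hb ⟨(x, 0), zero_mem_halfplane _⟩ rfl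
      rw [hE, hE, halfplaneExtend, halfplaneExtend, clampHalfplane_of_nonpos hy,
        clampHalfplane_of_nonpos le_rfl]
      refine Prod.ext (by simp) ?_
      simp only [Prod.snd_add, h1]; ring)
    (by rintro _ ⟨z, hz, rfl⟩; exact hKb z hz)
    (by
      rw [eventually_nhdsSet_iff_forall]
      rintro _ ⟨z, hz, rfl⟩
      have h2 : ∀ᶠ w : Plane in 𝓝 z, (ψ (clampHalfplane w) : X) ∈ U :=
        (hψ.comp continuous_clampHalfplane).continuousAt.eventually
          (hU.mem_nhds (by simp only [Function.comp_apply, clampHalfplane_of_mem]; exact hKU hz))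
      filter_upwards [h2] with w hw
      exact halfplaneExtend_eq_self (hHid _ (hUf _ hw)))
    (fun z hz hz' => halfplaneExtend_eq_self (hHid _ (hUf _ (hR _ (by
      rwa [clampHalfplane_of_mem ⟨z, hz⟩])))))
  obtain ⟨F, hF, hFb, hFK, hF0, hF1⟩ := exists_isotopy_of_iso_halfplane ψ hgp
    (fun z w hw => by
      rw [hE, halfplaneExtend_of_mem] at hw
      rw [Subtype.ext hw, hqH]) hr
  exact mem_H0_of_ambient_isotopy e hF hFb hFK hF0 fun m => by rw [hF1, hge]

theorem cayley_normSq (w : ℂ) : Complex.normSq (w + Complex.I) - Complex.normSq (w - Complex.I) =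
    4 * w.im := by
  simp [Complex.normSq_apply]; ring

theorem cayley_ne_zero {w : ℂ} (hw : 0 ≤ w.im) : w + Complex.I ≠ 0 := fun h => by
  have := congrArg Complex.im h
  simp at this; linarith

theorem cayley_ne_one (w : ℂ) : (w - Complex.I) / (w + Complex.I) ≠ 1 := fun h => by
  have h0 : w + Complex.I ≠ 0 := fun h0 => by simp [h0] at h
  rw [div_eq_one_iff_eq h0] at h
  have := congrArg Complex.im h
  simp at this; linarith

theorem cayley_inv_im (u : ℂ) : (Complex.I * (1 + u) / (1 - u)).im =
    (1 - ‖u‖ ^ 2) / Complex.normSq (1 - u) := by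
  rw [← Complex.normSq_eq_norm_sq, Complex.div_im, ← sub_div]
  congr 1
  simp [Complex.normSq_apply]; ring

theorem norm_cayley_le_one {w : ℂ} (hw : 0 ≤ w.im) : ‖(w - Complex.I) / (w + Complex.I)‖ ≤ 1 := by
  rw [norm_div, div_le_one (norm_pos_iff.2 (cayley_ne_zero hw)),
    ← sq_le_sq₀ (norm_nonneg _) (norm_nonneg _),
    ← Complex.normSq_eq_norm_sq, ← Complex.normSq_eq_norm_sq]
  linarith [cayley_normSq w]

/-- The Cayley transform, from the half-plane to the disk without a boundary point. -/
def cayley : halfplane ≃ₜ {u : Metric.closedBall (0 : ℂ) 1 // u ≠ ⟨1, by simp⟩} where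
  toFun z := ⟨⟨(planeToComplex z - Complex.I) / (planeToComplex z + Complex.I), by
    simpa using norm_cayley_le_one (w := planeToComplex z) z.2⟩, fun h =>
      cayley_ne_one _ (congrArg Subtype.val h)⟩
  invFun u := ⟨((Complex.I * (1 + (u : Metric.closedBall (0 : ℂ) 1)) /
    (1 - (u : Metric.closedBall (0 : ℂ) 1))).re,
    (Complex.I * (1 + (u : Metric.closedBall (0 : ℂ) 1)) /
      (1 - (u : Metric.closedBall (0 : ℂ) 1))).im), by
      have h1 : ‖((u : Metric.closedBall (0 : ℂ) 1) : ℂ)‖ ≤ 1 :=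
        mem_closedBall_zero_iff.1 (u : Metric.closedBall (0 : ℂ) 1).2
      show 0 ≤ (Complex.I * (1 + (u : Metric.closedBall (0 : ℂ) 1)) /
        (1 - (u : Metric.closedBall (0 : ℂ) 1)) : ℂ).im
      rw [cayley_inv_im]
      exact div_nonneg (sub_nonneg.2 (pow_le_one₀ (norm_nonneg _) h1)) (Complex.normSq_nonneg _)⟩
  left_inv z := by
    have h1 : planeToComplex z + Complex.I ≠ 0 := cayley_ne_zero z.2
    have h2 : Complex.I * (1 + (planeToComplex z - Complex.I) / (planeToComplex z + Complex.I)) /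
        (1 - (planeToComplex z - Complex.I) / (planeToComplex z + Complex.I)) = planeToComplex z :=
          by
      rw [div_eq_iff (sub_ne_zero.2 (cayley_ne_one _).symm)]
      field_simp
      ring_nf
    exact Subtype.ext (Prod.ext (congrArg Complex.re h2) (congrArg Complex.im h2))
  right_inv u := by
    have h1 : (1 : ℂ) - (u : Metric.closedBall (0 : ℂ) 1) ≠ 0 := sub_ne_zero.2 fun h =>
      u.2 (Subtype.ext h.symm)
    have h2 : ∀ w : ℂ, planeToComplex (w.re, w.im) = w := fun w => rfl
    refine Subtype.ext (Subtype.ext ?_)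
    simp only [h2]
    generalize (((u : Metric.closedBall (0 : ℂ) 1)) : ℂ) = v at h1
    have h3 : Complex.I * (1 + v) / (1 - v) + Complex.I = 2 * Complex.I / (1 - v) := by
      field_simp; ring
    have h4 : Complex.I * (1 + v) / (1 - v) - Complex.I = 2 * Complex.I * v / (1 - v) := by
      field_simp; ring
    rw [h3, h4]
    have := Complex.I_ne_zero
    field_simp
  continuous_toFun := by
    refine Continuous.subtype_mk (Continuous.subtype_mk ?_ _) _
    have := continuous_planeToComplex.comp (continuous_subtype_val (p := (· ∈ halfplane)))
    exact (this.sub continuous_const).div (this.add continuous_const) fun z => cayley_ne_zero z.2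
  continuous_invFun := by
    refine Continuous.subtype_mk ?_ _
    have h0 : Continuous fun u : {u : Metric.closedBall (0 : ℂ) 1 // u ≠ ⟨1, by simp⟩} =>
        ((u : Metric.closedBall (0 : ℂ) 1) : ℂ) := by fun_prop
    have : Continuous fun u : {u : Metric.closedBall (0 : ℂ) 1 // u ≠ ⟨1, by simp⟩} =>
        Complex.I * (1 + (u : Metric.closedBall (0 : ℂ) 1)) /
          (1 - (u : Metric.closedBall (0 : ℂ) 1)) :=
      (continuous_const.mul (continuous_const.add h0)).div (continuous_const.sub h0)
        fun u => sub_ne_zero.2 fun h => u.2 (Subtype.ext h.symm)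
    exact (Complex.continuous_re.comp this).prodMk (Complex.continuous_im.comp this)

theorem snd_eq_zero_of_norm_cayley {z : halfplane}
    (hz : ‖((cayley z : Metric.closedBall (0 : ℂ) 1) : ℂ)‖ = 1) : (z : Plane).2 = 0 := by
  have h1 : ((cayley.symm (cayley z) : halfplane) : Plane).2 = 0 := by
    refine (cayley_inv_im _).trans ?_
    rw [hz]; simp
  rwa [cayley.symm_apply_apply] at h1

theorem exists_linearIsometryEquiv_apply_one {p : EuclideanSpace ℝ (Fin 2)} (hp : ‖p‖ = 1) :
    ∃ L : ℂ ≃ₗᵢ[ℝ] EuclideanSpace ℝ (Fin 2), L 1 = p := by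
  let B := Complex.orthonormalBasisOneI.repr
  have h1 : ‖B.symm p‖ = 1 := by rw [LinearIsometryEquiv.norm_map, hp]
  refine ⟨(rotation ⟨B.symm p, mem_sphere_zero_iff_norm.2 h1⟩).trans B, ?_⟩
  exact (congrArg B (mul_one (B.symm p))).trans (B.apply_symm_apply p)

theorem mem_H0_of_disk {M : Type*} [TopologicalSpace M] [T2Space M]
    {K : Set (EuclideanSpace ℝ (Fin 2))}
    (hne : K.Nonempty) (hK : IsCompact K) (hKs : K ⊆ Metric.sphere (0 : EuclideanSpace ℝ (Fin 2)) 1)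
    (e : M ≃ₜ ↥(Metric.closedBall (0 : EuclideanSpace ℝ (Fin 2)) 1 \ K)) {h : M ≃ₜ M}
      (hh : h ∈ Hc M) :
    h ∈ H0 M := by
  obtain ⟨p, hp⟩ := hne
  obtain ⟨L, hL⟩ := exists_linearIsometryEquiv_apply_one (mem_sphere_zero_iff_norm.1 (hKs hp))
  let K' : Set (Metric.closedBall (0 : ℂ) 1) := {u | L u ∈ K}
  have hK' : IsClosed K' := hK.isClosed.preimage (by fun_prop)
  let E : ↥(Metric.closedBall (0 : EuclideanSpace ℝ (Fin 2)) 1 \ K) ≃ₜ {u // u ∉ K'} :=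
    { toFun := fun x => ⟨⟨L.symm x, by simpa using x.2.1⟩, fun hx => x.2.2 (by simpa [K'] using hx)⟩
      invFun := fun u => ⟨L u.1, by
        rw [mem_closedBall_zero_iff, LinearIsometryEquiv.norm_map]
        exact mem_closedBall_zero_iff.1 u.1.2, u.2⟩
      left_inv := fun x => by simp
      right_inv := fun x => by simp
      continuous_toFun := by fun_prop
      continuous_invFun := by fun_prop }
  refine mem_H0_of_halfplane cayley hK' (show L 1 ∈ K by rwa [hL]) (fun z hz => ?_) (e.trans E) hh
  refine snd_eq_zero_of_norm_cayley ?_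
  have := hKs hz
  rwa [mem_sphere_zero_iff_norm, LinearIsometryEquiv.norm_map] at this

end

variable (M : Type*) [TopologicalSpace M] [T2Space M] [SigmaCompactSpace M]
  [ChartedSpace (EuclideanHalfSpace 2) M] [ConnectedSpace M]

/-- If a σ-compact non-compact connected 2-manifold `M` is exceptional (homeomorphic to
`X \ K` with `X` the annulus, the disk or the Möbius band and `K` a non-empty compact
subset of a boundary circle of `X`), then every compactly supported homeomorphism of `M`
lies in the identity component `𝓗₀(M)`, i.e. `𝓜_c(M)` is trivial. -/
theorem mcg_trivial_of_exceptional (hnc : ¬ CompactSpace M) (hex : IsExceptional M) :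
    ∀ h ∈ Hc M, h ∈ H0 M := by
  intro h hh
  rcases hex with ⟨K, hne, hK, ⟨i, hi, hKi⟩, ⟨e⟩⟩ | ⟨K, hne, hK, hKs, ⟨e⟩⟩ | ⟨K, hne, hK, hKb, ⟨e⟩⟩
  · exact mem_H0_of_annulus hne hK hi hKi e hh
  · exact mem_H0_of_disk hne hK hKs e hh
  · exact mem_H0_of_mobiusBand hne hK hKb e hh

end
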